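/- arXiv:2210.03959 — 2 statements merged into one kernel-verified Lean document; each statement's English description precedes it below -/
import Mathlib

section
/- Every 3-connected graph with at least 6 vertices contains two cycles whose lengths are consecutive even integers. -/
open SimpleGraph

/-- `G` contains two cycles of consecutive even lengths `2m` and `2m+2`. -/
def HasTwoConsecEvenCycles {V : Type*} (G : SimpleGraph V) : Prop :=
  ∃ (u v : V) (c₁ : G.Walk u u) (c₂ : G.Walk v v) (m : ℕ),
    c₁.IsCycle ∧ c₂.IsCycle ∧ 0 < m ∧ c₁.length = 2 * m ∧ c₂.length = 2 * m + 2

/-- `G` is `k`-connected: more than `k` vertices, and deleting any set of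
fewer than `k` vertices leaves a connected graph. -/
def KConnected {V : Type*} (k : ℕ) (G : SimpleGraph V) : Prop :=
  k + 1 ≤ Nat.card V ∧ ∀ S : Set V, S.ncard < k → (G.induce Sᶜ).Connected

section
namespace CE

variable {V : Type*} {G : SimpleGraph V}

/-- a path of length `n` from `u` to `v` inside `S` -/
def PathIn (G : SimpleGraph V) (S : Set V) (u v : V) (n : ℕ) : Prop :=
  ∃ p : G.Walk u v, p.IsPath ∧ p.length = n ∧ ∀ x ∈ p.support, x ∈ S

theorem PathIn.mono {S T : Set V} {u v : V} {n : ℕ} (h : PathIn G S u v n) (hST : S ⊆ T) :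
    PathIn G T u v n := by
  obtain ⟨p, h1, h2, h3⟩ := h
  exact ⟨p, h1, h2, fun x hx => hST (h3 x hx)⟩

theorem PathIn.mono_graph {G' : SimpleGraph V} {S : Set V} {u v : V} {n : ℕ}
    (h : PathIn G S u v n) (hG : G ≤ G') : PathIn G' S u v n := by
  obtain ⟨p, h1, h2, h3⟩ := h
  exact ⟨p.mapLe hG, (Walk.isPath_mapLe hG).2 h1, by simpa using h2, by simpa using h3⟩

theorem PathIn.symm {S : Set V} {u v : V} {n : ℕ} (h : PathIn G S u v n) :
    PathIn G S v u n := by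
  obtain ⟨p, h1, h2, h3⟩ := h
  exact ⟨p.reverse, h1.reverse, by simpa using h2, by simpa using h3⟩

theorem PathIn.refl {S : Set V} {u : V} (h : u ∈ S) : PathIn G S u u 0 :=
  ⟨Walk.nil, by simp, by simp, by simpa using h⟩

theorem PathIn.left_mem {S : Set V} {u v : V} {n : ℕ} (h : PathIn G S u v n) : u ∈ S := by
  obtain ⟨p, h1, h2, h3⟩ := h
  exact h3 _ p.start_mem_support

theorem PathIn.right_mem {S : Set V} {u v : V} {n : ℕ} (h : PathIn G S u v n) : v ∈ S :=
  h.symm.left_mem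

theorem PathIn.cons {S : Set V} {u v w : V} {n : ℕ} (ha : G.Adj u v) (h : PathIn G S v w n)
    (hu : u ∉ S) : PathIn G (insert u S) u w (n + 1) := by
  obtain ⟨p, h1, h2, h3⟩ := h
  refine ⟨Walk.cons ha p, ?_, by simp [h2], ?_⟩
  · rw [Walk.cons_isPath_iff]; exact ⟨h1, fun hx => hu (h3 _ hx)⟩
  · intro x hx
    simp only [Walk.support_cons, List.mem_cons] at hx
    rcases hx with rfl | hx
    · simp
    · exact Or.inr (h3 x hx)

theorem PathIn.strip {S : Set V} {u v : V} {n : ℕ} (h : PathIn G S u v (n + 1)) :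
    ∃ w, G.Adj u w ∧ PathIn G (S \ {u}) w v n := by
  obtain ⟨p, h1, h2, h3⟩ := h
  cases p with
  | nil => simp at h2
  | cons ha p =>
    rw [Walk.cons_isPath_iff] at h1
    refine ⟨_, ha, p, h1.1, by simpa using h2, fun x hx => ⟨h3 x (by simp [hx]), ?_⟩⟩
    rintro rfl
    exact h1.2 hx

theorem PathIn.zero_eq {S : Set V} {u v : V} (h : PathIn G S u v 0) : u = v := by
  obtain ⟨p, h1, h2, h3⟩ := h
  exact Walk.eq_of_length_eq_zero h2

theorem PathIn.ne {S : Set V} {u v : V} {n : ℕ} (h : PathIn G S u v n) (hn : n ≠ 0) : u ≠ v := by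
  obtain ⟨m, rfl⟩ := Nat.exists_eq_succ_of_ne_zero hn
  obtain ⟨w, _, hw⟩ := h.strip
  rintro rfl
  exact hw.right_mem.2 rfl

theorem PathIn.append {S T : Set V} {u v w : V} {a b : ℕ} (h : PathIn G S u v a)
    (h' : PathIn G T v w b) (hd : ∀ x ∈ S, x ∈ T → x = v) : PathIn G (S ∪ T) u w (a + b) := by
  induction a generalizing u S with
  | zero => obtain rfl := h.zero_eq; exact (by simpa using h'.mono Set.subset_union_right)
  | succ a ih =>
    have hm := h.left_mem
    have hne := h.ne (by omega)
    obtain ⟨x, hx, hp⟩ := h.strip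
    have := ih hp (fun y hy hy' => hd y hy.1 hy')
    have h2 := PathIn.cons hx this (by
      rintro (h | h)
      · exact h.2 rfl
      · exact hne (hd _ hm h))
    have e : a + 1 + b = a + b + 1 := by omega
    rw [e]
    refine h2.mono ?_
    rintro y (rfl | h | h)
    · exact Or.inl hm
    · exact Or.inl h.1
    · exact Or.inr h

theorem PathIn.join {S T : Set V} {u v w x : V} {a b : ℕ} (h : PathIn G S u v a)
    (ha : G.Adj v w) (h' : PathIn G T w x b) (hd : ∀ x ∈ S, x ∉ T) :
    PathIn G (S ∪ T) u x (a + b + 1) := by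
  have h1 := PathIn.cons ha h' (hd _ h.right_mem)
  have h2 := h.append h1 (by
    rintro y hy (rfl | hy')
    · rfl
    · exact absurd hy' (hd y hy))
  refine (h2.mono ?_)
  rintro y (hy | rfl | hy)
  · exact Or.inl hy
  · exact Or.inl h.right_mem
  · exact Or.inr hy

theorem PathIn.edge {S : Set V} {u v : V} (ha : G.Adj u v) (hu : u ∈ S) (hv : v ∈ S) :
    PathIn G S u v 1 := by
  refine (PathIn.cons ha (PathIn.refl (S := {v}) rfl) (by simpa using ha.ne)).mono ?_
  rintro x (rfl | rfl) <;> assumption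

/-- truncating at the first hit of `T` -/
theorem PathIn.trunc {S T : Set V} {u v : V} {n : ℕ} (h : PathIn G S u v n) (hv : v ∈ T) :
    ∃ t ∈ T, ∃ m, PathIn G {x | x ∈ S ∧ (x ∈ T → x = t)} u t m := by
  induction n generalizing u S with
  | zero =>
    have := h.left_mem
    obtain rfl := h.zero_eq
    exact ⟨u, hv, 0, PathIn.refl ⟨this, fun _ => rfl⟩⟩
  | succ n ih =>
    have hm := h.left_mem
    by_cases hu : u ∈ T
    · exact ⟨u, hu, 0, PathIn.refl ⟨hm, fun _ => rfl⟩⟩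
    obtain ⟨w, hw, hp⟩ := h.strip
    obtain ⟨t, ht, m, hq⟩ := ih hp
    refine ⟨t, ht, m + 1, (PathIn.cons hw hq (fun h => h.1.2 rfl)).mono ?_⟩
    rintro y (rfl | hy)
    · exact ⟨hm, fun h => absurd h hu⟩
    · exact ⟨hy.1.1, hy.2⟩

/-- reachability inside a set -/
def Rch (G : SimpleGraph V) (S : Set V) (u v : V) : Prop := ∃ n, PathIn G S u v n

theorem Rch.of_walk {S : Set V} {u v : V} (p : G.Walk u v) (h : ∀ x ∈ p.support, x ∈ S) :
    Rch G S u v := by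
  classical
  exact ⟨_, p.bypass, p.bypass_isPath, rfl, fun x hx => h x (p.support_bypass_subset_support hx)⟩

theorem Rch.trans {S : Set V} {u v w : V} (h : Rch G S u v) (h' : Rch G S v w) : Rch G S u w := by
  obtain ⟨_, p, -, -, hp⟩ := h
  obtain ⟨_, q, -, -, hq⟩ := h'
  refine Rch.of_walk (p.append q) ?_
  intro x hx
  rw [Walk.mem_support_append_iff] at hx
  exact hx.elim (hp x) (hq x)

theorem Rch.symm {S : Set V} {u v : V} (h : Rch G S u v) : Rch G S v u := by
  obtain ⟨n, h⟩ := h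
  exact ⟨n, h.symm⟩

theorem Rch.mono {S T : Set V} {u v : V} (h : Rch G S u v) (hST : S ⊆ T) : Rch G T u v := by
  obtain ⟨n, h⟩ := h
  exact ⟨n, h.mono hST⟩

theorem Rch.refl {S : Set V} {u : V} (h : u ∈ S) : Rch G S u u := ⟨0, PathIn.refl h⟩

theorem Rch.edge {S : Set V} {u v : V} (ha : G.Adj u v) (hu : u ∈ S) (hv : v ∈ S) :
    Rch G S u v := ⟨1, PathIn.edge ha hu hv⟩

theorem Rch.left_mem {S : Set V} {u v : V} (h : Rch G S u v) : u ∈ S := by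
  obtain ⟨n, h⟩ := h; exact h.left_mem

theorem Rch.right_mem {S : Set V} {u v : V} (h : Rch G S u v) : v ∈ S := by
  obtain ⟨n, h⟩ := h; exact h.right_mem

/-- component of `v` inside `W` -/
def comp (G : SimpleGraph V) (W : Set V) (v : V) : Set V := {y | Rch G W v y}

/-- a path inside `W` starting at `v` stays in the component -/
theorem PathIn.comp {W : Set V} {v x y : V} {n : ℕ} (hx : x ∈ comp G W v) (h : PathIn G W x y n) :
    PathIn G (comp G W v) x y n := by
  induction n generalizing x with
  | zero => obtain rfl := h.zero_eq; exact PathIn.refl hx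
  | succ n ih =>
    obtain ⟨p, h1, h2, h3⟩ := h
    refine ⟨p, h1, h2, fun z hz => ?_⟩
    classical
    refine Rch.trans hx (Rch.of_walk (p.takeUntil z hz) ?_)
    exact fun a ha => h3 a (p.support_takeUntil_subset_support hz ha)

theorem comp_sub {W : Set V} {v : V} : comp G W v ⊆ W := fun _ h => h.right_mem

theorem comp_self {W : Set V} {v : V} (h : v ∈ W) : v ∈ comp G W v := Rch.refl h

theorem comp_closed {W : Set V} {v x y : V} (hx : x ∈ comp G W v) (ha : G.Adj x y) (hy : y ∈ W) :
    y ∈ comp G W v := Rch.trans hx (Rch.edge ha hx.right_mem hy)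

/-- connected sets -/
def ConnS (G : SimpleGraph V) (B : Set V) : Prop := ∀ x ∈ B, ∀ y ∈ B, Rch G B x y

theorem comp_conn {W : Set V} {v : V} : ConnS G (comp G W v) := by
  intro x hx y hy
  obtain ⟨n, h⟩ := Rch.trans (Rch.symm hx) hy
  exact ⟨n, h.comp hx⟩

theorem ConnS.insertV {B : Set V} (hB : ConnS G B) {b x : V} (hx : x ∈ B) (ha : G.Adj b x) :
    ConnS G (insert b B) := by
  have key : ∀ y ∈ insert b B, Rch G (insert b B) x y := by
    rintro y (rfl | hy)
    · exact Rch.edge ha.symm (Or.inr hx) (Or.inl rfl)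
    · exact (hB x hx y hy).mono (Set.subset_insert _ _)
  intro y hy z hz
  exact (key y hy).symm.trans (key z hz)

/-! ### cycles -/

/-- `c` is a periodic parametrisation of a cycle of length `k` -/
structure Cyc (G : SimpleGraph V) (k : ℕ) (c : ℤ → V) : Prop where
  three : 3 ≤ k
  adj : ∀ i, G.Adj (c i) (c (i + 1))
  per : ∀ i, c (i + k) = c i
  inj : ∀ i j : ℤ, i < j → j < i + k → c i ≠ c j

def CycIn (G : SimpleGraph V) (S : Set V) (n : ℕ) : Prop := ∃ c, Cyc G n c ∧ ∀ i, c i ∈ S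

theorem CycIn.mono {S T : Set V} {n : ℕ} (h : CycIn G S n) (hS : S ⊆ T) : CycIn G T n := by
  obtain ⟨c, h1, h2⟩ := h
  exact ⟨c, h1, fun i => hS (h2 i)⟩

namespace Cyc
variable {k : ℕ} {c : ℤ → V}

theorem shift (h : Cyc G k c) (a : ℤ) : Cyc G k (fun i => c (a + i)) where
  three := h.three
  adj i := by have := h.adj (a + i); rwa [add_assoc] at this
  per i := by rw [← add_assoc]; exact h.per _
  inj i j h1 h2 := h.inj _ _ (by omega) (by omega)

theorem rev (h : Cyc G k c) : Cyc G k (fun i => c (-i)) where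
  three := h.three
  adj i := by
    have := (h.adj (-(i+1))).symm
    have e : -(i+1)+1 = -i := by omega
    rw [e] at this
    exact this
  per i := by
    have := h.per (-(i+k))
    have e : -(i+(k:ℤ))+k = -i := by omega
    rw [e] at this
    exact this.symm
  inj i j h1 h2 := (h.inj (-j) (-i) (by omega) (by omega)).symm

theorem per_mul (h : Cyc G k c) (i : ℤ) (n : ℤ) : c (i + k * n) = c i := by
  have hn : ∀ n : ℕ, ∀ i : ℤ, c (i + k * n) = c i := by
    intro n
    induction n with
    | zero => simp
    | succ n ih =>
      intro i
      have := ih (i + k)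
      rw [h.per] at this
      rw [← this]; congr 1; push_cast; ring
  rcases Int.eq_nat_or_neg n with ⟨m, rfl | rfl⟩
  · exact hn m i
  · rw [← hn m]; congr 1; ring

theorem window (h : Cyc G k c) (a i : ℤ) : ∃ j, a ≤ j ∧ j < a + k ∧ c j = c i := by
  have hk : (0:ℤ) < k := by have := h.three; omega
  refine ⟨a + (i - a) % k, ?_, ?_, ?_⟩
  · have := Int.emod_nonneg (i - a) hk.ne'; omega
  · have := Int.emod_lt_of_pos (i - a) hk; omega
  · have e := Int.emod_add_mul_ediv (i-a) k
    rw [← h.per_mul (a + (i - a) % k) ((i-a)/k)]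
    congr 1; omega

theorem inj' (h : Cyc G k c) {i j : ℤ} (he : c i = c j) (h1 : i - j < k) (h2 : j - i < k) : i = j := by
  rcases lt_trichotomy i j with hl | hl | hl
  · exact absurd he (h.inj _ _ hl (by omega))
  · exact hl
  · exact absurd he.symm (h.inj _ _ hl (by omega))

theorem arc (h : Cyc G k c) (a : ℤ) (n : ℕ) (hn : n < k) :
    PathIn G (c '' Set.Icc a (a + n)) (c a) (c (a + n)) n := by
  induction n with
  | zero => simpa using PathIn.refl (by simp)
  | succ n ih =>
    have h1 := (ih (by omega)).symm
    have h2 : PathIn G _ _ _ _ := PathIn.cons (h.adj (a+n)).symm h1 (by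
      rintro ⟨i, hi, he⟩
      have := h.inj' he (by have := hi.1; have := hi.2; omega) (by have := hi.1; have := hi.2; omega)
      have := hi.2; omega)
    have e : a + ((n+1 : ℕ):ℤ) = a + n + 1 := by push_cast; ring
    rw [e]
    refine h2.symm.mono ?_
    rintro x (rfl | ⟨i, hi, rfl⟩)
    · exact ⟨_, ⟨by omega, by omega⟩, rfl⟩
    · exact ⟨i, ⟨hi.1, by have := hi.2; omega⟩, rfl⟩

/-- arc given by end indices -/
theorem arc' (h : Cyc G k c) (a b : ℤ) (n : ℕ) (hab : b = a + n) (hn : n < k) :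
    PathIn G (c '' Set.Icc a b) (c a) (c b) n := by
  subst hab; exact h.arc a n hn

theorem mem_adj (h : Cyc G k c) (i : ℤ) : G.Adj (c i) (c (i-1)) := by
  have := (h.adj (i-1)).symm
  rwa [sub_add_cancel] at this

theorem range_conn (h : Cyc G k c) : ConnS G (Set.range c) := by
  have key : ∀ i, Rch G (Set.range c) (c 0) (c i) := by
    intro i
    have hn : ∀ n : ℕ, Rch G (Set.range c) (c 0) (c n) := by
      intro n
      induction n with
      | zero => exact Rch.refl ⟨0, by simp⟩
      | succ n ih => exact ih.trans (Rch.edge (by simpa using h.adj n) ⟨_, rfl⟩ ⟨_, rfl⟩)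
    obtain ⟨j, h1, h2, h3⟩ := h.window 0 i
    rw [← h3]
    obtain ⟨n, rfl⟩ := Int.eq_ofNat_of_zero_le h1
    exact hn n
  rintro _ ⟨i, rfl⟩ _ ⟨j, rfl⟩
  exact (key i).symm.trans (key j)

end Cyc

theorem PathIn.close {S : Set V} {u v : V} {n : ℕ} (h : PathIn G S u v n) (hn : 2 ≤ n)
    (ha : G.Adj v u) : CycIn G S (n + 1) := by
  obtain ⟨p, h1, h2, h3⟩ := h
  have hk : (0:ℤ) < (n:ℤ)+1 := by omega
  refine ⟨fun i => p.getVert ((i % ((n:ℤ)+1)).toNat), ⟨by omega, ?_, ?_, ?_⟩, ?_⟩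
  · intro i
    have e1 := Int.emod_nonneg i hk.ne'
    have e2 := Int.emod_lt_of_pos i hk
    obtain ⟨r, hr⟩ := Int.eq_ofNat_of_zero_le e1
    have e3 : (i + 1) % ((n:ℤ)+1) = ((r:ℤ)+1) % ((n:ℤ)+1) := by rw [Int.add_emod, hr]; simp [Int.add_emod]
    simp only [e3, hr]
    by_cases hrn : r < n
    · rw [Int.emod_eq_of_lt (by omega) (by omega)]
      have e4 : ((r:ℤ)+1).toNat = r + 1 := by omega
      rw [e4]
      simpa using p.adj_getVert_succ (i := r) (by omega)
    · have : r = n := by omega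
      subst this
      simp only [Int.emod_self]
      have := p.getVert_length
      rw [h2] at this
      simpa [this] using ha
  · intro i
    push_cast
    simp
  · intro i j hij hj he
    push_cast at hj
    have e1 := Int.emod_nonneg i hk.ne'
    have e2 := Int.emod_lt_of_pos i hk
    have e3 := Int.emod_nonneg j hk.ne'
    have e4 := Int.emod_lt_of_pos j hk
    have := h1.getVert_injOn (by simp only [Set.mem_ofPred_eq]; omega) (by simp only [Set.mem_ofPred_eq]; omega) he
    have e5 : i % ((n:ℤ)+1) = j % ((n:ℤ)+1) := by omega
    have e6 : ((n:ℤ)+1) ∣ j - i := Int.ModEq.dvd e5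
    have := Int.le_of_dvd (by omega) e6
    omega
  · intro i
    exact h3 _ (p.getVert_mem_support _)

theorem CycIn.of_two {S T : Set V} {u v : V} {a b : ℕ} (h : PathIn G S u v a) (h' : PathIn G T u v b)
    (hd : ∀ x ∈ S, x ∈ T → x = u ∨ x = v) (ha : 1 ≤ a) (hb : 2 ≤ b) : CycIn G (S ∪ T) (a + b) := by
  obtain ⟨b, rfl⟩ : ∃ b', b = b' + 1 := ⟨b - 1, by omega⟩
  have hu := h'.left_mem
  obtain ⟨w, hw, hp⟩ := h'.strip
  have := hp.append h.symm (by
    rintro x ⟨hx, hxu⟩ hx'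
    exact (hd x hx' hx).resolve_left hxu)
  have := this.close (by omega) hw
  have e : b + a + 1 = a + (b + 1) := by omega
  rw [e] at this
  refine this.mono ?_
  rintro x (hx | hx)
  · exact Or.inr hx.1
  · exact Or.inl hx

theorem path_edge {u v : V} {p : G.Walk u v} (h1 : p.IsPath) (hl : 2 ≤ p.length)
    (hmem : s(v, u) ∈ p.edges) : False := by
  cases p with
  | nil => simp at hl
  | cons hh q =>
    rw [Walk.cons_isPath_iff] at h1
    simp only [Walk.edges_cons, List.mem_cons] at hmem
    rcases hmem with hm | hm
    · rw [Sym2.eq_iff] at hm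
      rcases hm with ⟨rfl, -⟩ | ⟨rfl, -⟩
      · exact h1.2 q.end_mem_support
      · have := Walk.eq_nil_iff_nil.2 (Walk.isPath_iff_nil.1 h1.1)
        subst this
        simp at hl
    · exact h1.2 (Walk.snd_mem_support_of_mem_edges q hm)

theorem CycIn.exists_walk {S : Set V} {n : ℕ} (h : CycIn G S n) :
    ∃ u, ∃ p : G.Walk u u, p.IsCycle ∧ p.length = n := by
  obtain ⟨c, hc, -⟩ := h
  have h3 := hc.three
  obtain ⟨p, h1, h2, -⟩ := hc.arc' 1 n (n-1) (by omega) (by omega)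
  have ha : G.Adj (c n) (c 1) := by
    have := hc.adj 0
    have e := hc.per 0
    simp only [zero_add] at this e
    rwa [e]
  refine ⟨_, Walk.cons ha p, ?_, by simp [h2]; omega⟩
  rw [Walk.cons_isCycle_iff]
  refine ⟨h1, fun hmem => ?_⟩
  exact path_edge h1 (by omega) hmem

def Done (G : SimpleGraph V) : Prop := ∃ m, CycIn G Set.univ (2 * m) ∧ CycIn G Set.univ (2 * m + 2)

end CE
end

section
namespace CE
variable {V : Type*} {G : SimpleGraph V}

def Cut3 (G : SimpleGraph V) : Prop := ∀ (F : Set V) (x y f q : V), f ∈ F → q ∉ F → f ≠ x → f ≠ y →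
  q ≠ x → q ≠ y → ∃ u ∈ F, ∃ w, w ∉ F ∧ G.Adj u w ∧ u ≠ x ∧ u ≠ y ∧ w ≠ x ∧ w ≠ y

theorem cut3_of_conn (h : ∀ S : Set V, S.ncard < 3 → (G.induce Sᶜ).Connected) : Cut3 G := by
  intro F x y f q hf hq h1 h2 h3 h4
  have hS : ({x, y} : Set V).ncard < 3 := lt_of_le_of_lt (Set.ncard_insert_le _ _) (by simp)
  have hc := h _ hS
  obtain ⟨p⟩ := hc.preconnected ⟨f, by simp [h1, h2]⟩ ⟨q, by simp [h3, h4]⟩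
  obtain ⟨d, hd, hd1, hd2⟩ := p.exists_boundary_dart (Subtype.val ⁻¹' F) hf hq
  refine ⟨d.fst.1, hd1, d.snd.1, hd2, d.adj, ?_⟩
  have e1 := d.fst.2
  have e2 := d.snd.2
  simp only [Set.mem_compl_iff, Set.mem_insert_iff, Set.mem_singleton_iff, not_or] at e1 e2
  exact ⟨e1.1, e1.2, e2.1, e2.2⟩

theorem Cut3.att (hc : Cut3 G) {F : Set V} {f x y q : V} (hf : f ∈ F) (hx : x ∉ F) (hy : y ∉ F)
    (hq : q ∉ F) (h1 : q ≠ x) (h2 : q ≠ y) : ∃ u ∈ F, ∃ w, w ∉ F ∧ G.Adj u w ∧ w ≠ x ∧ w ≠ y := by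
  obtain ⟨u, hu, w, hw, ha, _, _, h3, h4⟩ := hc F x y f q hf hq (by rintro rfl; exact hx hf)
    (by rintro rfl; exact hy hf) h1 h2
  exact ⟨u, hu, w, hw, ha, h3, h4⟩

/-- three distinct attachments -/
theorem Cut3.att3 (hc : Cut3 G) {F : Set V} {f q1 q2 q3 : V} (hf : f ∈ F) (h1 : q1 ∉ F) (h2 : q2 ∉ F)
    (h3 : q3 ∉ F) (h12 : q1 ≠ q2) (h13 : q1 ≠ q3) (h23 : q2 ≠ q3) :
    ∃ u1 ∈ F, ∃ u2 ∈ F, ∃ u3 ∈ F, ∃ w1 w2 w3, w1 ∉ F ∧ w2 ∉ F ∧ w3 ∉ F ∧ w1 ≠ w2 ∧ w1 ≠ w3 ∧ w2 ≠ w3 ∧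
      G.Adj u1 w1 ∧ G.Adj u2 w2 ∧ G.Adj u3 w3 := by
  have key : ∀ x y, x ∉ F → y ∉ F → ∃ u ∈ F, ∃ w, w ∉ F ∧ G.Adj u w ∧ w ≠ x ∧ w ≠ y := by
    intro x y hx hy
    have : ∃ q, q ∉ F ∧ q ≠ x ∧ q ≠ y := by
      by_contra hcon
      push Not at hcon
      have a1 := or_iff_not_imp_left.2 (hcon q1 h1)
      have a2 := or_iff_not_imp_left.2 (hcon q2 h2)
      have a3 := or_iff_not_imp_left.2 (hcon q3 h3)
      grind
    obtain ⟨q, hq, e1, e2⟩ := this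
    exact hc.att hf hx hy hq e1 e2
  obtain ⟨u1, a1, w1, b1, c1, d1, e1⟩ := key q1 q1 h1 h1
  obtain ⟨u2, a2, w2, b2, c2, d2, e2⟩ := key w1 w1 b1 b1
  obtain ⟨u3, a3, w3, b3, c3, d3, e3⟩ := key w1 w2 b1 b2
  exact ⟨u1, a1, u2, a2, u3, a3, w1, w2, w3, b1, b2, b3, d2.symm, d3.symm, e3.symm, c1, c2, c3⟩

theorem exists_not_mem_list [Fintype V] (l : List V) (h : l.length < Fintype.card V) :
    ∃ x, x ∉ l := by
  classical
  by_contra hcon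
  push Not at hcon
  have : (Finset.univ : Finset V) ⊆ l.toFinset := by
    intro x _; simpa using hcon x
  have := Finset.card_le_card this
  have := l.toFinset_card_le
  simp at *
  omega

theorem Cut3.deg3 [Fintype V] (hc : Cut3 G) (h6 : 6 ≤ Fintype.card V) (v : V) :
    ∃ w1 w2 w3, w1 ≠ w2 ∧ w1 ≠ w3 ∧ w2 ≠ w3 ∧ G.Adj v w1 ∧ G.Adj v w2 ∧ G.Adj v w3 := by
  obtain ⟨q1, h1⟩ := exists_not_mem_list [v] (by simp; omega)
  obtain ⟨q2, h2⟩ := exists_not_mem_list [v, q1] (by simp; omega)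
  obtain ⟨q3, h3⟩ := exists_not_mem_list [v, q1, q2] (by simp; omega)
  simp only [List.mem_cons, List.not_mem_nil, or_false, not_or] at h1 h2 h3
  obtain ⟨u1, rfl, u2, rfl, u3, rfl, w1, w2, w3, h⟩ := hc.att3 (F := {v}) (f := v) rfl (q1 := q1) (q2 := q2) (q3 := q3)
    h1 h2.1 h3.1 (Ne.symm h2.2) (Ne.symm h3.2.1) (Ne.symm h3.2.2)
  exact ⟨w1, w2, w3, h.2.2.2⟩

theorem Cut3.deg [Fintype V] (hc : Cut3 G) (h6 : 6 ≤ Fintype.card V) (v x y : V) :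
    ∃ w, G.Adj v w ∧ w ≠ x ∧ w ≠ y := by
  obtain ⟨w1, w2, w3, h⟩ := hc.deg3 h6 v
  by_contra hcon
  push Not at hcon
  have := or_iff_not_imp_left.2 (hcon w1 h.2.2.2.1)
  have := or_iff_not_imp_left.2 (hcon w2 h.2.2.2.2.1)
  have := or_iff_not_imp_left.2 (hcon w3 h.2.2.2.2.2)
  grind

/-! tree colouring -/

theorem ConnS.induce_connected {F : Set V} (h : ConnS G F) (hne : F.Nonempty) :
    (G.induce F).Connected := by
  have : Nonempty F := hne.to_subtype
  refine ⟨?_⟩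
  rintro ⟨x, hx⟩ ⟨y, hy⟩
  obtain ⟨n, p, -, -, hp⟩ := h x hx y hy
  exact ⟨p.induce F hp⟩

theorem PathIn.of_induce {F : Set V} {H : SimpleGraph F} (hH : H ≤ G.induce F) {x y : F} {p : H.Walk x y}
    (hp : p.IsPath) : PathIn G F x y p.length := by
  have := (Walk.isPath_mapLe hH).2 hp
  have key : ∀ {x y : F} (q : (G.induce F).Walk x y), q.IsPath →
      PathIn G (Subtype.val '' {z | z ∈ q.support}) x y q.length := by
    intro x y q
    induction q with
    | nil => intro _; exact PathIn.refl ⟨_, by simp, rfl⟩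
    | @cons u v w ha q ih =>
      intro hq
      rw [Walk.cons_isPath_iff] at hq
      have h1 := PathIn.cons (induce_adj.1 ha) (ih hq.1) (by
        rintro ⟨a, ha, he⟩
        have : a = u := Subtype.ext he
        exact hq.2 (this ▸ ha))
      refine h1.mono ?_
      rintro x (rfl | ⟨a, ha, rfl⟩)
      · exact ⟨u, by simp, rfl⟩
      · exact ⟨a, by simpa using Or.inr ha, rfl⟩
  have h2 := (key _ this).mono (T := F) (by rintro _ ⟨a, _, rfl⟩; exact a.2)
  simpa using h2

theorem ConnS.colour [Finite V] {F : Set V} (h : ConnS G F) : ∃ col : V → Bool, ∀ x ∈ F, ∀ y ∈ F,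
    ∃ n, PathIn G F x y n ∧ (Even n ↔ col x = col y) := by
  classical
  by_cases hne : F.Nonempty
  swap
  · refine ⟨fun _ => true, fun x hx => absurd ⟨x, hx⟩ hne⟩
  obtain ⟨T, hT, hTree⟩ := (h.induce_connected hne).exists_isTree_le
  obtain ⟨C⟩ := hTree.isBipartite
  let C' : T.Coloring Bool := (recolorOfEquiv T finTwoEquiv) C
  refine ⟨fun x => if hx : x ∈ F then C' ⟨x, hx⟩ else true, fun x hx y hy => ?_⟩
  obtain ⟨p, hp⟩ := (hTree.connected.preconnected ⟨x, hx⟩ ⟨y, hy⟩).exists_isPath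
  refine ⟨p.length, PathIn.of_induce hT hp, ?_⟩
  rw [C'.even_length_iff_congr p]
  simp only [hx, hy, dif_pos]
  exact Bool.coe_iff_coe

theorem Cyc.reroute {k : ℕ} {c : ℤ → V} (h : Cyc G k c) {S : Set V} {z y : V} {n : ℕ} (hp : PathIn G S z y n)
    (hS : ∀ x ∈ S, x ∉ Set.range c) {a b : ℤ} (hz : G.Adj z (c a)) (hy : G.Adj y (c b)) (r : ℕ)
    (hb : b = a + r) (hr : 0 < r) (hrk : r < k) : CycIn G (S ∪ c '' Set.Icc a b) (n + 2 + r) := by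
  have h1 := hp.join hy (h.arc' a b r hb hrk).symm (fun x hx hx' => hS x hx (Set.image_subset_range _ _ hx'))
  have := h1.close (by omega) hz.symm
  have e : n + r + 1 + 1 = n + 2 + r := by omega
  rwa [e] at this

theorem Cyc.reroute' {k : ℕ} {c : ℤ → V} (h : Cyc G k c) {S : Set V} {z y : V} {n : ℕ} (hp : PathIn G S z y n)
    (hS : ∀ x ∈ S, x ∉ Set.range c) {a b : ℤ} (hz : G.Adj z (c a)) (hy : G.Adj y (c b)) (r : ℕ)
    (hb : b = a + r) (hr : 0 < r) (hrk : r < k) :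
    CycIn G (S ∪ c '' Set.Icc b (a + k)) (n + 2 + (k - r)) := by
  refine h.reroute hp.symm hS hy (b := a + k) (by rwa [h.per]) (k - r) (by omega) (by omega) (by omega)

theorem Cyc.chord {k : ℕ} {c : ℤ → V} (h : Cyc G k c) {a b : ℤ} (ha : G.Adj (c a) (c b)) (r : ℕ)
    (hb : b = a + r) (hr : 2 ≤ r) (hrk : r < k) : CycIn G (c '' Set.Icc a b) (r + 1) :=
  (h.arc' a b r hb hrk).close hr ha.symm

end CE
end

section
namespace CE
variable {V : Type*} {G : SimpleGraph V}

theorem Cyc.window' {k : ℕ} {c : ℤ → V} (h : Cyc G k c) (a i : ℤ) :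
    ∃ j t, a ≤ j ∧ j < a + k ∧ j = i + k * t ∧ c j = c i := by
  have hk : (0:ℤ) < k := by have := h.three; omega
  have e := Int.emod_add_mul_ediv (i-a) k
  have e3 : a + (i - a) % k = i + k * (-((i-a)/k)) := by rw [mul_neg]; omega
  refine ⟨a + (i - a) % k, -((i-a)/k), ?_, ?_, e3, ?_⟩
  · have := Int.emod_nonneg (i - a) hk.ne'; omega
  · have := Int.emod_lt_of_pos (i - a) hk; omega
  · rw [e3, h.per_mul]

theorem ext [Fintype V] (hc : Cut3 G) {C0 : Set V} (hne : C0.Nonempty)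
    (hC0 : ConnS G C0) {m0 : ℕ} (hD : CycIn G C0ᶜ (2 * m0)) :
    ∃ m c, Cyc G (2 * m) c ∧ (∀ i, c i ∉ C0) ∧ ConnS G (Set.range c)ᶜ ∧
      ∀ n, n < m → ¬ CycIn G (Set.range c) (2 * n) := by
  classical
  let P : Set V → Prop := fun B => C0 ⊆ B ∧ ConnS G B ∧ ∃ m, CycIn G Bᶜ (2 * m)
  obtain ⟨B, hB⟩ := Set.Finite.exists_maximal (s := {B | P B}) (Set.toFinite _) ⟨C0, subset_rfl, hC0, m0, hD⟩
  have hBP : P B := hB.prop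
  obtain ⟨h1, h2, h3⟩ := hBP
  let m := Nat.find h3
  obtain ⟨c, hcy, hcB⟩ : CycIn G Bᶜ (2 * m) := Nat.find_spec h3
  have hmin : ∀ n, n < m → ¬ CycIn G Bᶜ (2 * n) := fun n hn => Nat.find_min h3 hn
  have hmax : ∀ b x, x ∈ B → b ∉ B → G.Adj b x → ∀ n, ¬ CycIn G (insert b B)ᶜ (2 * n) := by
    intro b x hx hb ha n hcyc
    have : P (insert b B) := ⟨h1.trans (Set.subset_insert _ _), h2.insertV hx ha, n, hcyc⟩
    exact hb (hB.le_of_ge this (Set.subset_insert _ _) (Set.mem_insert _ _))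
  have hclosed : ∀ x y, x ∈ B → G.Adj y x → y ∉ Set.range c → y ∈ B := by
    intro x y hx ha hy
    by_contra hyB
    refine hmax y x hx hyB ha m ⟨c, hcy, fun i => ?_⟩
    rintro (he | he)
    · exact hy ⟨i, he⟩
    · exact hcB i he
  have hBne : B.Nonempty := hne.mono h1
  have h3k := hcy.three
  have hd01 : c 0 ≠ c 1 := hcy.inj 0 1 (by omega) (by omega)
  have hd02 : c 0 ≠ c 2 := hcy.inj 0 2 (by omega) (by omega)
  have hd12 : c 1 ≠ c 2 := hcy.inj 1 2 (by omega) (by omega)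
  have hBc : (Set.range c)ᶜ = B := by
    apply Set.Subset.antisymm
    · intro v hv
      by_contra hvB
      let W : Set V := {x | x ∉ Set.range c ∧ x ∉ B}
      let F := comp G W v
      have hvF : v ∈ F := comp_self ⟨hv, hvB⟩
      have hFW : F ⊆ W := comp_sub
      have hatt : ∀ u ∈ F, ∀ w, w ∉ F → G.Adj u w → w ∈ Set.range c := by
        intro u hu w hw ha
        by_contra hwr
        by_cases hwB : w ∈ B
        · exact (hFW hu).2 (hclosed w u hwB ha (hFW hu).1)
        · exact hw (comp_closed hu ha ⟨hwr, hwB⟩)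
      obtain ⟨col, hcol⟩ := (comp_conn : ConnS G F).colour
      have key : ∀ u ∈ F, ∀ u' ∈ F, ∀ s s' : ℤ, c s ≠ c s' → G.Adj u (c s) → G.Adj u' (c s') →
          (col u = col u' ↔ Even (s - s')) → False := by
        intro u hu u' hu' s s' hss ha ha' hpar
        obtain ⟨b, hbr, hbs, hbs', x, hxB, hbx⟩ : ∃ b, b ∈ Set.range c ∧ b ≠ c s ∧ b ≠ c s' ∧
            ∃ x, x ∈ B ∧ G.Adj b x := by
          obtain ⟨b0, hb0⟩ := hBne
          have : ∃ q : ℤ, c q ≠ c s ∧ c q ≠ c s' := by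
            by_contra hcon
            push Not at hcon
            have a1 := or_iff_not_imp_left.2 (hcon 0)
            have a2 := or_iff_not_imp_left.2 (hcon 1)
            have a3 := or_iff_not_imp_left.2 (hcon 2)
            grind
          obtain ⟨q, hq1, hq2⟩ := this
          obtain ⟨u, hu, w, hw, ha, e1, e2⟩ := hc.att hb0 (hcB s) (hcB s') (hcB q) hq1 hq2
          exact ⟨w, by by_contra hwr; exact hw (hclosed u w hu ha.symm hwr), e1, e2, u, hu, ha.symm⟩
        obtain ⟨j, t, hj1, hj2, hj3, hj4⟩ := hcy.window' s s'
        have hjs : j ≠ s := by rintro rfl; exact hss hj4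
        obtain ⟨r, hr⟩ : ∃ r : ℕ, j = s + r := ⟨(j - s).toNat, by omega⟩
        obtain ⟨n, hn, hnp⟩ := hcol u hu u' hu'
        have hFr : ∀ x ∈ F, x ∉ Set.range c := fun x hx => (hFW hx).1
        have hnr : Even n ↔ Even r := by
          rw [hnp, hpar]
          have : (s - s') = -(r:ℤ) + 2 * (m * t) := by push_cast at hj3; linarith
          rw [this, Int.even_add]
          simp
        rw [← hj4] at ha'
        obtain ⟨i, hi1, hi2, hi3⟩ : ∃ i, s ≤ i ∧ i < s + (2 * m : ℕ) ∧ c i = b := by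
          obtain ⟨i0, rfl⟩ := hbr
          obtain ⟨i, e1, e2, e3⟩ := hcy.window s i0
          exact ⟨i, e1, e2, e3⟩
        have his : i ≠ s := by rintro rfl; exact hbs hi3.symm
        have hij : i ≠ j := by rintro rfl; exact hbs' (hi3.symm.trans hj4)
        have hbB : b ∉ B := by rw [← hi3]; exact hcB i
        have hbF : b ∉ F := fun h => hFr b h hbr
        have hsub : ∀ x y : ℤ, s ≤ x → y ≤ s + (2 * m : ℕ) → (i < x ∨ y < i) →
            F ∪ c '' Set.Icc x y ⊆ (insert b B)ᶜ := by
          intro x y hx hy hi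
          rintro z (hz | ⟨l, hl, rfl⟩)
          · rintro (rfl | h)
            · exact hbF hz
            · exact (hFW hz).2 h
          · rintro (h | h)
            · rw [← hi3] at h
              have l1 := hl.1
              have l2 := hl.2
              by_cases hls : l - i < (2*m : ℕ)
              · have := hcy.inj' h hls (by omega)
                omega
              · omega
            · exact hcB l h
        by_cases hlt : i < j
        · have hcyc := hcy.reroute' hn hFr ha ha' r hr (by omega) (by omega)
          have hcyc := hcyc.mono (hsub _ _ hj1 (le_refl _) (Or.inl hlt))
          obtain ⟨e, he⟩ : Even (n + 2 + (2 * m - r)) := by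
            have : Even (n + r) := by rw [Nat.even_add]; exact hnr
            obtain ⟨e, he⟩ := this
            exact ⟨e + 1 + m - r, by omega⟩
          rw [he, ← two_mul] at hcyc
          exact hmax b x hxB hbB hbx _ hcyc
        · have hcyc := hcy.reroute hn hFr ha ha' r hr (by omega) (by omega)
          have hcyc := hcyc.mono (hsub _ _ (le_refl _) (by omega) (Or.inr (by omega)))
          obtain ⟨e, he⟩ : Even (n + 2 + r) := by
            have : Even (n + r) := by rw [Nat.even_add]; exact hnr
            obtain ⟨e, he⟩ := this
            exact ⟨e + 1, by omega⟩
          rw [he, ← two_mul] at hcyc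
          exact hmax b x hxB hbB hbx _ hcyc
      have hnF : ∀ i, c i ∉ F := fun i h => (hFW h).1 ⟨i, rfl⟩
      obtain ⟨u1, g1, u2, g2, u3, g3, w1, w2, w3, f1, f2, f3, n12, n13, n23, a1, a2, a3⟩ :=
        hc.att3 hvF (hnF 0) (hnF 1) (hnF 2) hd01 hd02 hd12
      obtain ⟨s1, rfl⟩ := hatt _ g1 _ f1 a1
      obtain ⟨s2, rfl⟩ := hatt _ g2 _ f2 a2
      obtain ⟨s3, rfl⟩ := hatt _ g3 _ f3 a3
      have k12 := key _ g1 _ g2 s1 s2 n12 a1 a2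
      have k13 := key _ g1 _ g3 s1 s3 n13 a1 a3
      have k23 := key _ g2 _ g3 s2 s3 n23 a2 a3
      rw [Int.even_sub] at k12 k13 k23
      cases e1 : col u1 <;> cases e2 : col u2 <;> cases e3 : col u3 <;> simp [e1, e2, e3] at k12 k13 k23 <;>
        tauto
    · intro x hx ⟨i, hi⟩
      exact hcB i (hi ▸ hx)
  refine ⟨m, c, hcy, fun i hi => hcB i (h1 hi), by rw [hBc]; exact h2, fun n hn hcn => hmin n hn (hcn.mono ?_)⟩
  rintro _ ⟨i, rfl⟩
  exact hcB i

end CE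
end

section
namespace CE
variable {V : Type*} {G : SimpleGraph V}

theorem Done.of {S T : Set V} {n n' : ℕ} (h : CycIn G S n) (h' : CycIn G T n') (e : n' = n + 2) (he : Even n) :
    Done G := by
  obtain ⟨m, rfl⟩ := he
  subst e
  rw [← two_mul] at h h'
  exact ⟨m, h.mono (Set.subset_univ _), h'.mono (Set.subset_univ _)⟩

/-- two disjoint paths joined by two edges -/
theorem CycIn.out {S T : Set V} {x t x' t' : V} {l n N : ℕ} (h : PathIn G S x t l) (h' : PathIn G T x' t' n)
    (hd : ∀ z ∈ S, z ∉ T) (ha : G.Adj x x') (hb : G.Adj t t') (hl : 1 ≤ l + n) (hN : N = l + n + 2) :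
    CycIn G (S ∪ T) N := by
  have := (h.join hb h'.symm hd).close (by omega) ha.symm
  rwa [hN]

structure Good (G : SimpleGraph V) (m : ℕ) (c : ℤ → V) : Prop where
  cyc : Cyc G (2 * m) c
  conn : ConnS G (Set.range c)ᶜ
  min : ∀ n, n < m → ¬ CycIn G (Set.range c) (2 * n)

theorem range_shift (c : ℤ → V) (a : ℤ) : Set.range (fun i => c (a + i)) = Set.range c := by
  ext x; constructor
  · rintro ⟨i, rfl⟩; exact ⟨_, rfl⟩
  · rintro ⟨i, rfl⟩; exact ⟨i - a, by simp⟩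

theorem Good.shift {m : ℕ} {c : ℤ → V} (h : Good G m c) (a : ℤ) : Good G m (fun i => c (a + i)) := by
  refine ⟨h.cyc.shift a, ?_, ?_⟩
  · rw [range_shift]; exact h.conn
  · rw [range_shift]; exact h.min

def Exit (G : SimpleGraph V) (c : ℤ → V) (i : ℤ) : Prop := ∃ y, y ∉ Set.range c ∧ G.Adj (c i) y

theorem Cyc.exit_or_chord [Fintype V] (hc : Cut3 G) (h6 : 6 ≤ Fintype.card V) {k : ℕ} {c : ℤ → V}
    (h : Cyc G k c) (i : ℤ) : Exit G c i ∨ ∃ r : ℕ, 2 ≤ r ∧ r + 2 ≤ k ∧ G.Adj (c i) (c (i + r)) := by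
  obtain ⟨w, hw, h1, h2⟩ := hc.deg h6 (c i) (c (i+1)) (c (i-1))
  by_cases hr : w ∈ Set.range c
  swap
  · exact Or.inl ⟨w, hr, hw⟩
  right
  obtain ⟨j, rfl⟩ := hr
  obtain ⟨j', e1, e2, e3⟩ := h.window i j
  rw [← e3] at hw h1 h2
  have n0 : j' ≠ i := by rintro rfl; exact hw.ne rfl
  have n1 : j' ≠ i + 1 := by rintro rfl; exact h1 rfl
  have n2 : j' ≠ i - 1 + k := by rintro rfl; exact h2 (h.per _)
  refine ⟨(j' - i).toNat, by omega, by omega, ?_⟩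
  have : i + ((j' - i).toNat : ℤ) = j' := by omega
  rw [this]; exact hw

theorem Good.no_even {m : ℕ} {c : ℤ → V} (h : Good G m c) {S : Set V} {n : ℕ} (hn : CycIn G S n)
    (hS : S ⊆ Set.range c) (he : Even n) (hlt : n < 2 * m) : False := by
  obtain ⟨e, rfl⟩ := he
  rw [← two_mul] at hn
  exact h.min e (by omega) (hn.mono hS)

theorem Good.chord_even {m : ℕ} {c : ℤ → V} (h : Good G m c) {a b : ℤ} (ha : G.Adj (c a) (c b)) (r : ℕ)
    (hb : b = a + r) (hr : 2 ≤ r) (hrk : r + 2 ≤ 2 * m) : Even r := by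
  by_contra hodd
  rw [Nat.not_even_iff_odd] at hodd
  exact h.no_even (h.cyc.chord ha r hb hr (by omega)) (Set.image_subset_range _ _) hodd.add_one (by omega)

theorem icc_disj {k : ℕ} {c : ℤ → V} (h : Cyc G k c) {a b a' b' : ℤ} (h1 : b < a') (h2 : b' < a + k) :
    ∀ z ∈ c '' Set.Icc a b, z ∉ c '' Set.Icc a' b' := by
  rintro _ ⟨x, hx, rfl⟩ ⟨y, hy, he⟩
  have := hx.1; have := hx.2; have := hy.1; have := hy.2
  have := h.inj' he (by omega) (by omega)
  omega

theorem Good.no_chord_at {m : ℕ} {c : ℤ → V} (h : Good G m c) (hm : 3 ≤ m) {i s : ℕ} (hi : 1 ≤ i) (him : i < m)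
    (hch : G.Adj (c 0) (c (2 * i))) (hs : 0 < s) (hs2 : s < 2 * i) {r : ℕ} (hr : 2 ≤ r) (hr2 : r + 2 ≤ 2 * m)
    (ha : G.Adj (c s) (c (s + r))) : False := by
  have hev := h.chord_even ha r rfl hr hr2
  have nest : ∀ a b : ℕ, a < b → b ≤ 2 * i → 0 < a ∨ b < 2 * i → Even (b - a) → G.Adj (c a) (c b) → False := by
    intro a b hab hb hne he hadj
    have h1 := h.cyc.arc' 0 a a (by omega) (by omega)
    have h2 := h.cyc.arc' b (2 * i) (2 * i - b) (by omega) (by omega)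
    have h3 := h1.join hadj h2 (icc_disj h.cyc (by omega) (by omega))
    obtain ⟨e, he⟩ := he
    have h4 := h3.close (by omega) hch.symm
    refine h.no_even h4 ?_ ⟨i + 1 - e, by omega⟩ (by omega)
    rintro _ (⟨x, _, rfl⟩ | ⟨x, _, rfl⟩) <;> exact ⟨x, rfl⟩
  have cross : ∀ a b : ℕ, 0 < a → a < 2 * i → 2 * i < b → b < 2 * m → Even (b - a) → G.Adj (c a) (c b) → False := by
    intro a b h0 h1 h2 h3 he hadj
    obtain ⟨e, he⟩ := he
    have p1 := h.cyc.arc' 0 a a (by omega) (by omega)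
    have p2 := h.cyc.arc' (2 * i) b (b - 2 * i) (by omega) (by omega)
    have p3 := (p1.join hadj p2.symm (icc_disj h.cyc (by omega) (by omega))).close (by omega) hch.symm
    have q1 := h.cyc.arc' a (2 * i) (2 * i - a) (by omega) (by omega)
    have q2 := h.cyc.arc' b (0 + (2 * m : ℕ)) (2 * m - b) (by omega) (by omega)
    have q3 := (q1.symm.join hadj q2 (icc_disj h.cyc (by omega) (by push_cast; omega))).close (by omega)
      (by rw [h.cyc.per]; exact hch)
    by_cases hlt : a + (b - 2 * i) + 1 + 1 < 2 * m
    · refine h.no_even p3 ?_ ⟨e + a + 1 - i, by omega⟩ hlt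
      rintro _ (⟨x, _, rfl⟩ | ⟨x, _, rfl⟩) <;> exact ⟨x, rfl⟩
    · refine h.no_even q3 ?_ ⟨m + i - e - a + 1, by omega⟩ (by omega)
      rintro _ (⟨x, _, rfl⟩ | ⟨x, _, rfl⟩) <;> exact ⟨x, rfl⟩
  obtain ⟨e, rfl⟩ := hev
  by_cases h1 : s + (e + e) ≤ 2 * i
  · exact nest s (s + (e + e)) (by omega) h1 (by omega) ⟨e, by omega⟩ (by exact_mod_cast ha)
  by_cases h2 : s + (e + e) < 2 * m
  · exact cross s (s + (e + e)) hs hs2 (by omega) h2 ⟨e, by omega⟩ (by exact_mod_cast ha)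
  · have e1 : c (s + (e + e : ℕ)) = c ((s + (e + e) - 2 * m : ℕ)) := by
      rw [← h.cyc.per ((s + (e + e) - 2 * m : ℕ) : ℤ)]
      congr 1; omega
    rw [e1] at ha
    exact nest (s + (e + e) - 2 * m) s (by omega) (by omega) (by omega) ⟨m - e, by omega⟩ ha.symm

theorem Good.chord_done [Fintype V] (hc : Cut3 G) (h6 : 6 ≤ Fintype.card V) {m : ℕ} {c : ℤ → V}
    (h : Good G m c) (hm : 3 ≤ m) {a : ℤ} {r : ℕ} (hr : 2 ≤ r) (hr2 : r + 2 ≤ 2 * m)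
    (ha : G.Adj (c a) (c (a + r))) : Done G := by
  have main : ∀ c : ℤ → V, Good G m c → ∀ i j : ℕ, 2 ≤ i → 1 ≤ j → i + j = m → G.Adj (c 0) (c (2 * i)) →
      Done G := by
    intro c h i j hi hj hij hch
    have ex1 : Exit G c (i + 1 : ℕ) := by
      rcases h.cyc.exit_or_chord hc h6 (i + 1 : ℕ) with he | ⟨r, h1, h2, h3⟩
      · exact he
      · exact (h.no_chord_at hm (by omega) (by omega) hch (by omega) (by omega) h1 h2 h3).elim
    have ex2 : Exit G c (2 * i + j : ℕ) := by
      rcases h.cyc.exit_or_chord hc h6 (2 * i + j : ℕ) with he | ⟨r, h1, h2, h3⟩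
      · exact he
      · refine ((h.shift (2 * i)).no_chord_at hm (i := j) (s := j) (by omega) (by omega) ?_ (by omega) (by omega) h1 h2 ?_).elim
        · have : 2 * (i:ℤ) + 2 * j = 0 + (2 * m : ℕ) := by push_cast; omega
          simp only [this]
          rw [h.cyc.per]
          simpa using hch.symm
        · push_cast at h3
          simpa [add_assoc] using h3
    obtain ⟨t', ht', hat⟩ := ex1
    obtain ⟨x', hx', hax⟩ := ex2
    obtain ⟨n, hn⟩ := h.conn x' hx' t' ht'
    have r1 := h.cyc.arc' (2 * i + j : ℕ) ((i + 1 : ℕ) + (2 * m : ℕ)) (j + i + 1) (by push_cast; omega) (by omega)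
    rw [h.cyc.per] at r1
    have r2 := (h.cyc.arc' (i + 1 : ℕ) (2 * i + j : ℕ) (j + i - 1) (by push_cast; omega) (by omega)).symm
    have r3a := (h.cyc.arc' (2 * i + j : ℕ) (0 + (2 * m : ℕ)) j (by push_cast; omega) (by omega)).symm
    have r3b := (h.cyc.arc' (i + 1 : ℕ) (2 * i) (i - 1) (by push_cast; omega) (by omega))
    have r3 := r3b.join hch.symm (by rw [h.cyc.per] at r3a; exact r3a) (icc_disj h.cyc (by push_cast; omega) (by push_cast; omega))
    have r4a := (h.cyc.arc' 0 (i + 1 : ℕ) (i + 1) (by push_cast; omega) (by omega)).symm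
    have r4b := (h.cyc.arc' (2 * i) (2 * i + j : ℕ) j (by push_cast; omega) (by omega))
    have r4 := r4a.join hch r4b (icc_disj h.cyc (by push_cast; omega) (by push_cast; omega))
    have sub : ∀ S : Set ℤ, ∀ z ∈ c '' S, z ∉ (Set.range c)ᶜ := by
      rintro S _ ⟨z, _, rfl⟩ hz
      exact hz ⟨z, rfl⟩
    have sub2 : ∀ S T : Set ℤ, ∀ z ∈ c '' S ∪ c '' T, z ∉ (Set.range c)ᶜ := by
      rintro S T _ (⟨z, _, rfl⟩ | ⟨z, _, rfl⟩) hz <;>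
      exact hz ⟨z, rfl⟩
    have c1 := CycIn.out r1 hn (sub _) hax hat (by omega) rfl
    have c2 := CycIn.out r2 hn (sub _) hax hat (by omega) rfl
    have c3 := CycIn.out r3.symm hn (sub2 _ _) hax hat (by omega) rfl
    have c4 := CycIn.out r4.symm hn (sub2 _ _) hax hat (by omega) rfl
    by_cases hp : Even (j + i + n + 1)
    · obtain ⟨e, he⟩ := hp
      exact Done.of c2 c1 (by omega) ⟨e, by omega⟩
    · rw [Nat.not_even_iff_odd] at hp
      obtain ⟨e, he⟩ := hp
      exact Done.of c3 c4 (by omega) ⟨e + 1, by omega⟩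
  obtain ⟨i, hi⟩ := h.chord_even ha r rfl hr hr2
  by_cases h2 : 2 ≤ i
  · refine main _ (h.shift a) i (m - i) h2 (by omega) (by omega) ?_
    have : a + (2 * (i:ℤ)) = a + r := by omega
    simpa [this] using ha
  · refine main _ (h.shift (a + r)) (m - i) i (by omega) (by omega) (by omega) ?_
    have : a + r + (2 * ((m - i : ℕ):ℤ)) = a + (2 * m : ℕ) := by push_cast; omega
    simp only [this]
    rw [h.cyc.per]
    simpa using ha.symm

/-- either done, or all indices have exits, or the cycle is a 4-cycle -/
theorem Good.exits [Fintype V] (hc : Cut3 G) (h6 : 6 ≤ Fintype.card V) {m : ℕ} {c : ℤ → V}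
    (h : Good G m c) (hm : 3 ≤ m) : Done G ∨ ∀ i, Exit G c i := by
  by_cases hd : Done G
  · exact Or.inl hd
  refine Or.inr fun i => ?_
  rcases h.cyc.exit_or_chord hc h6 i with he | ⟨r, h1, h2, h3⟩
  · exact he
  · exact (hd (h.chord_done hc h6 hm h1 h2 h3)).elim

/-- for a 4-cycle, after a shift the indices 0,1,2 have exits -/
theorem Good.exits4 [Fintype V] (hc : Cut3 G) (h6 : 6 ≤ Fintype.card V) {c : ℤ → V}
    (h : Good G 2 c) : ∃ a, Exit G c a ∧ Exit G c (a + 1) ∧ Exit G c (a + 2) := by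
  have key : ∀ x y : ℤ, ∃ s, c s ≠ c x ∧ c s ≠ c y ∧ Exit G c s := by
    intro x y
    have : ∃ q : ℤ, c q ≠ c x ∧ c q ≠ c y := by
      have hd01 : c 0 ≠ c 1 := h.cyc.inj 0 1 (by omega) (by omega)
      have hd02 : c 0 ≠ c 2 := h.cyc.inj 0 2 (by omega) (by omega)
      have hd12 : c 1 ≠ c 2 := h.cyc.inj 1 2 (by omega) (by omega)
      by_contra hcon
      push Not at hcon
      have a1 := or_iff_not_imp_left.2 (hcon 0)
      have a2 := or_iff_not_imp_left.2 (hcon 1)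
      have a3 := or_iff_not_imp_left.2 (hcon 2)
      grind
    obtain ⟨q, hq1, hq2⟩ := this
    obtain ⟨f, hf⟩ := exists_not_mem_list [c 0, c 1, c 2, c 3] (by simp; omega)
    have hf' : f ∈ (Set.range c)ᶜ := by
      rintro ⟨i, rfl⟩
      obtain ⟨j, e1, e2, e3⟩ := h.cyc.window 0 i
      rw [← e3] at hf
      have : j = 0 ∨ j = 1 ∨ j = 2 ∨ j = 3 := by push_cast at e2; omega
      rcases this with rfl | rfl | rfl | rfl <;> simp at hf
    obtain ⟨u, hu, w, hw, ha, e1, e2⟩ := hc.att (x := c x) (y := c y) (q := c q) hf' (by simp) (by simp) (by simp) hq1 hq2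
    simp only [Set.mem_compl_iff, not_not] at hw
    obtain ⟨s, rfl⟩ := hw
    exact ⟨s, e1, e2, u, hu, ha.symm⟩
  have ex : ∀ s t, c s = c t → Exit G c s → Exit G c t := by
    intro s t he; unfold Exit; rw [he]; exact id
  have per : ∀ i, c (i + 4) = c i := fun i => h.cyc.per i
  have key2 : ∀ a, ¬ Exit G c a → Exit G c (a + 1) ∧ Exit G c (a + 2) ∧ Exit G c (a + 3) := by
    intro a ha
    have k : ∀ x y : ℤ, ∃ s, a < s ∧ s < a + 4 ∧ c s ≠ c x ∧ c s ≠ c y ∧ Exit G c s := by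
      intro x y
      obtain ⟨s, h1, h2, h3⟩ := key x y
      obtain ⟨j, e1, e2, e3⟩ := h.cyc.window a s
      rw [← e3] at h1 h2
      have h4 := ex _ _ e3.symm h3
      have : j ≠ a := by rintro rfl; exact ha h4
      exact ⟨j, by omega, by push_cast at e2; omega, h1, h2, h4⟩
    refine ⟨?_, ?_, ?_⟩
    · obtain ⟨s, h1, h2, h3, h4, h5⟩ := k (a + 2) (a + 3)
      have : s ≠ a + 2 := by rintro rfl; exact h3 rfl
      have : s ≠ a + 3 := by rintro rfl; exact h4 rfl
      have : s = a + 1 := by omega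
      rwa [← this]
    · obtain ⟨s, h1, h2, h3, h4, h5⟩ := k (a + 1) (a + 3)
      have : s ≠ a + 1 := by rintro rfl; exact h3 rfl
      have : s ≠ a + 3 := by rintro rfl; exact h4 rfl
      have : s = a + 2 := by omega
      rwa [← this]
    · obtain ⟨s, h1, h2, h3, h4, h5⟩ := k (a + 1) (a + 2)
      have : s ≠ a + 1 := by rintro rfl; exact h3 rfl
      have : s ≠ a + 2 := by rintro rfl; exact h4 rfl
      have : s = a + 3 := by omega
      rwa [← this]
  by_cases h0 : Exit G c 0
  · by_cases h1 : Exit G c 1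
    · by_cases h2 : Exit G c 2
      · exact ⟨0, h0, h1, h2⟩
      · have := key2 2 h2
        exact ⟨3, this.1, this.2.1, this.2.2⟩
    · have := key2 1 h1
      exact ⟨2, this.1, this.2.1, this.2.2⟩
  · have := key2 0 h0
    exact ⟨1, by simpa using this.1, by simpa using this.2.1, by simpa using this.2.2⟩

/-- a pair at distance `m-1`, joined through the outside by a path of suitable parity -/
theorem Cyc.pair_done {m : ℕ} {c : ℤ → V} (h : Cyc G (2 * m) c) {T : Set V} {i : ℤ} {x y : V} {n : ℕ}
    (hx : G.Adj (c i) x) (hy : G.Adj (c (i + (m - 1 : ℕ))) y) (hp : PathIn G T x y n)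
    (hT : ∀ z ∈ T, z ∉ Set.range c) (hpar : Even (n + m + 1)) : Done G := by
  have h3 := h.three
  obtain ⟨e, he⟩ := hpar
  have c1 := h.reroute hp hT hx.symm hy.symm (m - 1) rfl (by omega) (by omega)
  have c2 := h.reroute' hp hT hx.symm hy.symm (m - 1) rfl (by omega) (by omega)
  exact Done.of c1 c2 (by omega) ⟨e, by omega⟩

end CE
end

section
namespace CE
variable {V : Type*} {G : SimpleGraph V}

theorem PathIn.length_lt [Fintype V] {S : Set V} {x y : V} {n : ℕ} (h : PathIn G S x y n) : n < Fintype.card V := by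
  obtain ⟨p, h1, h2, h3⟩ := h
  rw [← h2]
  exact h1.length_lt

theorem exists_longest [Fintype V] {X : Set V} (hX : X.Nonempty) : ∃ x y q, PathIn G X x y q ∧
    ∀ x' y' q', PathIn G X x' y' q' → q' ≤ q := by
  classical
  let P : ℕ → Prop := fun q => ∃ x y, PathIn G X x y q
  obtain ⟨v, hv⟩ := hX
  have h0 : P 0 := ⟨v, v, PathIn.refl hv⟩
  have hb : ∀ q, P q → q ≤ Fintype.card V := by
    rintro q ⟨x, y, h⟩; exact h.length_lt.le
  have hs : P (Nat.findGreatest P (Fintype.card V)) := Nat.findGreatest_spec (Nat.zero_le _) h0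
  obtain ⟨x, y, h⟩ := hs
  refine ⟨x, y, _, h, fun x' y' q' h' => ?_⟩
  exact Nat.le_findGreatest (hb _ ⟨x', y', h'⟩) ⟨x', y', h'⟩

theorem leaf {X : Set V} {x y : V} {q : ℕ} (h : PathIn G X x y q)
    (hmax : ∀ x' y' q', PathIn G X x' y' q' → q' ≤ q) (hac : ∀ n, ¬ CycIn G X n) :
    (∀ w ∈ X, G.Adj x w → q ≠ 0) ∧ ∀ w ∈ X, ∀ w' ∈ X, G.Adj x w → G.Adj x w' → w = w' := by
  obtain ⟨p, h1, h2, h3⟩ := h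
  have key : ∀ w ∈ X, G.Adj x w → q ≠ 0 ∧ w = p.getVert 1 := by
    intro w hw ha
    have hws : w ∈ p.support := by
      by_contra hws
      have h4 : PathIn G {z | z ∈ p.support} x y q := ⟨p, h1, h2, fun z hz => hz⟩
      have := (PathIn.cons ha.symm h4 hws).mono (T := X) (by
        rintro z (rfl | hz)
        · exact hw
        · exact h3 z hz)
      have := hmax _ _ _ this
      omega
    obtain ⟨j, hj, hjl⟩ := Walk.mem_support_iff_exists_getVert.1 hws
    have hp : PathIn G X x w j := by
      subst hj
      refine ⟨p.take j, h1.take j, ?_, ?_⟩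
      · rw [Walk.take_length]; omega
      · intro z hz; exact h3 z ((p.isSubwalk_take j).support_subset hz)
    by_cases hj2 : 2 ≤ j
    · exact (hac _ (hp.close hj2 ha.symm)).elim
    · have : j ≠ 0 := by
        rintro rfl
        have := hp.zero_eq
        subst this
        exact ha.ne rfl
      have : j = 1 := by omega
      subst this
      exact ⟨by omega, hj.symm⟩
  refine ⟨fun w hw ha => (key w hw ha).1, fun w hw w' hw' ha ha' => ?_⟩
  rw [(key w hw ha).2, (key w' hw' ha').2]

theorem exists_cycle [Fintype V] {X : Set V} (hX : X.Nonempty)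
    (h : ∀ v ∈ X, ∃ w ∈ X, ∃ w' ∈ X, w ≠ w' ∧ G.Adj v w ∧ G.Adj v w') : ∃ n, CycIn G X n := by
  by_contra hcon
  push Not at hcon
  obtain ⟨x, y, q, hp, hmax⟩ := exists_longest (G := G) hX
  obtain ⟨w, hw, w', hw', hne, h1, h2⟩ := h x hp.left_mem
  exact hne ((leaf hp hmax hcon).2 w hw w' hw' h1 h2)

theorem case0 [Fintype V] (hc : Cut3 G) (h6 : 6 ≤ Fintype.card V)
    (hev : ∀ S n, CycIn G S n → Even n) : Done G := by
  obtain ⟨r, -⟩ := exists_not_mem_list ([] : List V) (by simp; omega)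
  have : ∃ n, CycIn G ({r}ᶜ : Set V) n := by
    refine exists_cycle ?_ ?_
    · obtain ⟨x, hx⟩ := exists_not_mem_list [r] (by simp; omega)
      exact ⟨x, by simpa using hx⟩
    · intro v hv
      obtain ⟨w, h1, h2, -⟩ := hc.deg h6 v r r
      obtain ⟨w', h3, h4, h5⟩ := hc.deg h6 v r w
      exact ⟨w, h2, w', h4, h5.symm, h1, h3⟩
  obtain ⟨n, hn⟩ := this
  obtain ⟨m0, rfl⟩ := hev _ _ hn
  rw [← two_mul] at hn
  obtain ⟨m, c, hcy, -, hconn, hmin⟩ := ext hc (C0 := {r}) ⟨r, rfl⟩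
    (by rintro x rfl y rfl; exact Rch.refl rfl) hn
  have hg : Good G m c := ⟨hcy, hconn, hmin⟩
  have h3 := hcy.three
  have fin : ∀ i, Exit G c i → Exit G c (i + (m - 1 : ℕ)) → Done G := by
    rintro i ⟨x, hx, hax⟩ ⟨y, hy, hay⟩
    obtain ⟨n, hn⟩ := hconn x hx y hy
    refine hcy.pair_done hax hay hn (fun z hz => hz) ?_
    obtain ⟨e, he⟩ := hev _ _ (hcy.reroute hn (fun z hz => hz) hax.symm hay.symm (m-1) rfl (by omega) (by omega))
    exact ⟨e, by omega⟩
  by_cases hm : 3 ≤ m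
  · rcases hg.exits hc h6 hm with h | h
    · exact h
    · exact fin 0 (h _) (h _)
  · have : m = 2 := by omega
    subst this
    obtain ⟨a, e1, e2, e3⟩ := hg.exits4 hc h6
    exact fin a e1 (by simpa using e2)

end CE
end

section
namespace CE
variable {V : Type*} {G : SimpleGraph V}

theorem PathIn.exact {S : Set V} {u v : V} {n : ℕ} (h : PathIn G S u v n) :
    ∃ S' ⊆ S, PathIn G S' u v n ∧ ∀ z ∈ S', z = v ∨ Rch G (S' \ {v}) u z := by
  induction n generalizing u S with
  | zero =>
    have := h.left_mem
    obtain rfl := h.zero_eq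
    exact ⟨{u}, by simpa using this, PathIn.refl rfl, fun z hz => Or.inl hz⟩
  | succ n ih =>
    have hne := h.ne (by omega)
    have hm := h.left_mem
    obtain ⟨w, hw, hp⟩ := h.strip
    obtain ⟨S', h1, h2, h3⟩ := ih hp
    refine ⟨insert u S', ?_, PathIn.cons hw h2 (fun h => (h1 h).2 rfl), ?_⟩
    · rintro z (rfl | hz)
      · exact hm
      · exact (h1 hz).1
    · rintro z (rfl | hz)
      · exact Or.inr (Rch.refl ⟨Or.inl rfl, hne⟩)
      · rcases h3 z hz with h | h
        · exact Or.inl h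
        · have h' := h.mono (T := insert u S' \ {v}) (fun a ha => ⟨Or.inr ha.1, ha.2⟩)
          exact Or.inr (Rch.trans (Rch.edge hw (show u ∈ insert u S' \ {v} from ⟨Or.inl rfl, hne⟩) h'.left_mem) h')

theorem edge_split {G' : SimpleGraph V} {x y : V}
    (hG : ∀ u v, G.Adj u v → G'.Adj u v ∨ (u = x ∧ v = y) ∨ (u = y ∧ v = x)) {S : Set V} {a t : V}
    (h : Rch G S a t) : Rch G' S a t ∨ (Rch G' S a x ∧ Rch G' S y t) ∨ (Rch G' S a y ∧ Rch G' S x t) := by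
  obtain ⟨n, h⟩ := h
  induction n generalizing a with
  | zero =>
    have := h.left_mem
    obtain rfl := h.zero_eq
    exact Or.inl (Rch.refl this)
  | succ n ih =>
    have hm := h.left_mem
    obtain ⟨w, hw, hp⟩ := h.strip
    have hp := hp.mono Set.sdiff_subset
    have hwm := hp.left_mem
    rcases hG _ _ hw with h1 | ⟨rfl, rfl⟩ | ⟨rfl, rfl⟩
    · have e := Rch.edge h1 hm hwm
      rcases ih hp with h | h | h
      · exact Or.inl (e.trans h)
      · exact Or.inr (Or.inl ⟨e.trans h.1, h.2⟩)
      · exact Or.inr (Or.inr ⟨e.trans h.1, h.2⟩)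
    · rcases ih hp with h | h | h
      · exact Or.inr (Or.inl ⟨Rch.refl hm, h⟩)
      · exact Or.inr (Or.inl ⟨Rch.refl hm, h.2⟩)
      · exact Or.inl h.2
    · rcases ih hp with h | h | h
      · exact Or.inr (Or.inr ⟨Rch.refl hm, h⟩)
      · exact Or.inl h.2
      · exact Or.inr (Or.inr ⟨Rch.refl hm, h.2⟩)

theorem mhyp {G' : SimpleGraph V} {x y z0 : V} {W A T : Set V}
    (hG : ∀ u v, G.Adj u v → G'.Adj u v ∨ (u = x ∧ v = y) ∨ (u = y ∧ v = x))
    (hyp : ∀ z, ∃ a ∈ A, ∃ t ∈ T, Rch G (W \ {z}) a t)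
    (hno : ∀ a ∈ A, ∀ t ∈ T, ¬ Rch G' (W \ {z0}) a t) {a0 t0 : V} (ha0 : a0 ∈ A) (ht0 : t0 ∈ T)
    (hax : Rch G' (W \ {z0}) a0 x) (hyt : Rch G' (W \ {z0}) y t0) :
    ∀ z, ∃ a ∈ A, ∃ t ∈ ({x, z0} : Set V), Rch G' (W \ {z}) a t := by
  intro z
  have hxz : x ≠ z0 := fun h => hax.right_mem.2 h
  obtain ⟨a, ha, t, ht, n, hp⟩ := hyp z
  obtain ⟨t', ht', n', hp'⟩ := hp.trunc (T := {x, z0} ∪ T) (Or.inr ht)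
  refine ⟨a, ha, ?_⟩
  by_cases h1 : t' = z0
  · refine ⟨z0, by simp, ?_⟩
    subst h1
    rcases edge_split hG ⟨n', hp'⟩ with h | h | h
    · exact h.mono (fun _ hx => hx.1)
    · exact absurd (h.1.right_mem.2 (by simp)) hxz
    · exact absurd (h.2.left_mem.2 (by simp)) hxz
  have hz0 : ∀ v, v ∈ {x_1 | x_1 ∈ W \ {z} ∧ (x_1 ∈ {x, z0} ∪ T → x_1 = t')} → v ∈ W \ {z0} := by
    intro v hv
    refine ⟨hv.1.1, ?_⟩
    rintro rfl
    exact h1 (hv.2 (by simp)).symm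
  by_cases h2 : t' = x
  · refine ⟨x, by simp, ?_⟩
    subst h2
    rcases edge_split hG ⟨n', hp'⟩ with h | h | h
    · exact h.mono (fun _ hx => hx.1)
    · exact h.1.mono (fun _ hx => hx.1)
    · exact (hno a ha t0 ht0 ((h.1.mono hz0).trans hyt)).elim
  · exfalso
    have ht'T : t' ∈ T := by simpa [h1, h2] using ht'
    rcases edge_split hG ⟨n', hp'⟩ with h | h | h
    · exact hno a ha t' ht'T (h.mono hz0)
    · exact h2 (h.1.right_mem.2 (by simp)).symm
    · exact h2 (h.2.left_mem.2 (by simp)).symm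

/-- two disjoint paths from `A` to `T` inside `W` -/
def TwoPaths (G : SimpleGraph V) (W A T : Set V) : Prop :=
  ∃ S1 S2 : Set V, S1 ⊆ W ∧ S2 ⊆ W ∧ (∀ z ∈ S1, z ∉ S2) ∧ ∃ a1 ∈ A, ∃ a2 ∈ A, ∃ t1 ∈ T, ∃ t2 ∈ T, ∃ n1 n2,
    PathIn G S1 a1 t1 n1 ∧ PathIn G S2 a2 t2 n2

theorem TwoPaths.ordered {W A : Set V} {x z0 : V} (h : TwoPaths G W A {x, z0}) :
    ∃ S1 S2 : Set V, S1 ⊆ W ∧ S2 ⊆ W ∧ (∀ z ∈ S1, z ∉ S2) ∧ ∃ a1 ∈ A, ∃ a2 ∈ A, ∃ n1 n2,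
    PathIn G S1 a1 x n1 ∧ PathIn G S2 a2 z0 n2 ∧
    (∀ v ∈ S1, Rch G (W \ {z0}) a1 v) ∧ (∀ v ∈ S2, v = z0 ∨ Rch G (W \ {z0}) a2 v) := by
  have key : ∀ S1 S2 : Set V, S1 ⊆ W → S2 ⊆ W → (∀ z ∈ S1, z ∉ S2) → ∀ a1 ∈ A, ∀ a2 ∈ A, ∀ n1 n2,
    PathIn G S1 a1 x n1 → PathIn G S2 a2 z0 n2 → ∃ S1 S2 : Set V, S1 ⊆ W ∧ S2 ⊆ W ∧ (∀ z ∈ S1, z ∉ S2) ∧ ∃ a1 ∈ A, ∃ a2 ∈ A, ∃ n1 n2,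
    PathIn G S1 a1 x n1 ∧ PathIn G S2 a2 z0 n2 ∧
    (∀ v ∈ S1, Rch G (W \ {z0}) a1 v) ∧ (∀ v ∈ S2, v = z0 ∨ Rch G (W \ {z0}) a2 v) := by
    intro S1 S2 h1 h2 h3 a1 ha1 a2 ha2 n1 n2 p1 p2
    obtain ⟨S1', e1, e2, e3⟩ := p1.exact
    obtain ⟨S2', f1, f2, f3⟩ := p2.exact
    have hz : z0 ∉ S1' := fun h => h3 z0 (e1 h) p2.right_mem
    have hsub : S1' ⊆ W \ {z0} := fun v hv => ⟨h1 (e1 hv), by rintro rfl; exact hz hv⟩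
    refine ⟨S1', S2', e1.trans h1, f1.trans h2, fun z hz hz' => h3 z (e1 hz) (f1 hz'), a1, ha1, a2, ha2, n1, n2, e2, f2, ?_, ?_⟩
    · intro v hv
      rcases e3 v hv with rfl | h
      · exact (⟨n1, e2.mono hsub⟩ : Rch _ _ _ _)
      · exact h.mono (Set.sdiff_subset.trans hsub)
    · intro v hv
      refine (f3 v hv).imp id fun h => h.mono ?_
      exact Set.sdiff_subset_sdiff_left (f1.trans h2)
  obtain ⟨S1, S2, h1, h2, h3, a1, ha1, a2, ha2, t1, ht1, t2, ht2, n1, n2, p1, p2⟩ := h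
  have hne : t1 ≠ t2 := by
    rintro rfl
    exact h3 _ p1.right_mem p2.right_mem
  rcases ht1 with rfl | rfl <;> rcases ht2 with rfl | rfl
  · exact (hne rfl).elim
  · exact key S1 S2 h1 h2 h3 a1 ha1 a2 ha2 n1 n2 p1 p2
  · exact key S2 S1 h2 h1 (fun z hz hz' => h3 z hz' hz) a2 ha2 a1 ha1 n2 n1 p2 p1
  · exact (hne rfl).elim

theorem TwoPaths.symm {W A T : Set V} (h : TwoPaths G W A T) : TwoPaths G W T A := by
  obtain ⟨S1, S2, h1, h2, h3, a1, ha1, a2, ha2, t1, ht1, t2, ht2, n1, n2, p1, p2⟩ := h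
  exact ⟨S1, S2, h1, h2, h3, t1, ht1, t2, ht2, a1, ha1, a2, ha2, n1, n2, p1.symm, p2.symm⟩

theorem menger2 [Finite V] [Nonempty V] (W : Set V) : ∀ (G : SimpleGraph V) (A T : Set V),
    (∀ z, ∃ a ∈ A, ∃ t ∈ T, Rch G (W \ {z}) a t) → TwoPaths G W A T := by
  intro G
  induction G using WellFoundedLT.induction with
  | ind G ih =>
  intro A T hyp
  by_cases hE : ∃ x y, G.Adj x y
  swap
  · push Not at hE
    have key : ∀ z, ∃ a ∈ A, a ∈ T ∧ a ∈ W \ {z} := by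
      intro z
      obtain ⟨a, ha, t, ht, n, hp⟩ := hyp z
      cases n with
      | zero =>
        have := hp.left_mem
        obtain rfl := hp.zero_eq
        exact ⟨a, ha, ht, this⟩
      | succ n =>
        obtain ⟨w, hw, _⟩ := hp.strip
        exact (hE _ _ hw).elim
    obtain ⟨a0, h1, h2, h3⟩ := key (Classical.arbitrary V)
    obtain ⟨a1, g1, g2, g3⟩ := key a0
    refine ⟨{a0}, {a1}, ?_, ?_, ?_, a0, h1, a1, g1, a0, h2, a1, g2, 0, 0, PathIn.refl rfl, PathIn.refl rfl⟩
    · rintro _ rfl; exact h3.1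
    · rintro _ rfl; exact g3.1
    · rintro _ rfl h
      exact g3.2 h.symm
  obtain ⟨x, y, hxy⟩ := hE
  let G' := G.deleteEdges {s(x, y)}
  have hle : G' ≤ G := deleteEdges_le _
  have hlt : G' < G := by
    refine lt_of_le_of_ne hle fun h => ?_
    have : G'.Adj x y := h ▸ hxy
    simp [G'] at this
  have hG : ∀ u v, G.Adj u v → G'.Adj u v ∨ (u = x ∧ v = y) ∨ (u = y ∧ v = x) := by
    intro u v h
    by_cases he : s(u, v) = s(x, y)
    · right; simpa using he
    · left; simp only [G', deleteEdges_adj]; exact ⟨h, by simpa using he⟩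
  by_cases hyp' : ∀ z, ∃ a ∈ A, ∃ t ∈ T, Rch G' (W \ {z}) a t
  · obtain ⟨S1, S2, h1, h2, h3, a1, ha1, a2, ha2, t1, ht1, t2, ht2, n1, n2, p1, p2⟩ := ih G' hlt A T hyp'
    exact ⟨S1, S2, h1, h2, h3, a1, ha1, a2, ha2, t1, ht1, t2, ht2, n1, n2, p1.mono_graph hle, p2.mono_graph hle⟩
  push Not at hyp'
  obtain ⟨z0, hno⟩ := hyp'
  have main : ∀ x y, G.Adj x y → (∀ u v, G.Adj u v → G'.Adj u v ∨ (u = x ∧ v = y) ∨ (u = y ∧ v = x)) →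
      ∀ a ∈ A, ∀ t ∈ T, Rch G' (W \ {z0}) a x → Rch G' (W \ {z0}) y t → TwoPaths G W A T := by
    intro x y hxy hG a ha t ht hax hyt
    have hyp1 := mhyp hG hyp hno ha ht hax hyt
    have hyp2 := mhyp (G := G) (G' := G') (x := y) (y := x) (z0 := z0) (W := W) (A := T) (T := A)
      (fun u v h => (hG u v h).imp id Or.symm)
      (fun z => by obtain ⟨a, ha, t, ht, h⟩ := hyp z; exact ⟨t, ht, a, ha, h.symm⟩)
      (fun t ht a ha h => hno a ha t ht h.symm) ht ha hyt.symm hax.symm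
    obtain ⟨S1, S2, h1, h2, h3, a1, ha1, a2, ha2, n1, n2, p1, p2, e1, e2⟩ := (ih G' hlt _ _ hyp1).ordered
    obtain ⟨T1, T2, g1, g2, g3, t1, ht1, t2, ht2, l1, l2, q1, q2, f1, f2⟩ := (ih G' hlt _ _ hyp2).ordered
    have nXY : ∀ a ∈ A, ∀ t ∈ T, ∀ v, Rch G' (W \ {z0}) a v → Rch G' (W \ {z0}) t v → False :=
      fun a ha t ht v h h' => hno a ha t ht (h.trans h'.symm)
    have d11 : ∀ v ∈ S1, v ∉ T1 := fun v hv hv' => nXY a1 ha1 t1 ht1 v (e1 v hv) (f1 v hv')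
    have d12 : ∀ v ∈ S1, v ∉ T2 := by
      intro v hv hv'
      rcases f2 v hv' with rfl | h
      · exact (e1 _ hv).right_mem.2 rfl
      · exact nXY a1 ha1 t2 ht2 v (e1 v hv) h
    have d21 : ∀ v ∈ S2, v ∉ T1 := by
      intro v hv hv'
      rcases e2 v hv with rfl | h
      · exact (f1 _ hv').right_mem.2 rfl
      · exact nXY a2 ha2 t1 ht1 v h (f1 v hv')
    have d22 : ∀ v ∈ S2, v ∈ T2 → v = z0 := by
      intro v hv hv'
      rcases e2 v hv with h | h
      · exact h
      rcases f2 v hv' with h' | h'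
      · exact h'
      · exact (nXY a2 ha2 t2 ht2 v h h').elim
    refine ⟨S1 ∪ T1, S2 ∪ T2, Set.union_subset h1 g1, Set.union_subset h2 g2, ?_, a1, ha1, a2, ha2, t1, ht1, t2, ht2, _, _,
      (p1.mono_graph hle).join hxy (q1.mono_graph hle).symm d11, (p2.mono_graph hle).append (q2.mono_graph hle).symm d22⟩
    rintro v (hv | hv) (hv' | hv')
    · exact h3 v hv hv'
    · exact d12 v hv hv'
    · exact d21 v hv' hv
    · exact g3 v hv hv'
  obtain ⟨a, ha, t, ht, h⟩ := hyp z0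
  rcases edge_split hG h with h | h | h
  · exact (hno a ha t ht h).elim
  · exact main x y hxy hG a ha t ht h.1 h.2
  · exact main y x hxy.symm (fun u v h => (hG u v h).imp id Or.symm) a ha t ht h.1 h.2

end CE
end

section
namespace CE
variable {V : Type*} {G : SimpleGraph V}

/-- on an odd cycle, two distinct vertices are joined by arcs of both parities -/
theorem odd_arcs {l : ℕ} {d : ℤ → V} (h : Cyc G l d) (hl : Odd l) {x y : V} (hx : x ∈ Set.range d)
    (hy : y ∈ Set.range d) (hne : x ≠ y) (b : Prop) : ∃ r, PathIn G (Set.range d) x y r ∧ 1 ≤ r ∧ r < l ∧ (Even r ↔ b) := by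
  obtain ⟨s, rfl⟩ := hx
  obtain ⟨s', rfl⟩ := hy
  obtain ⟨j, h1, h2, h3⟩ := h.window s s'
  have hjs : j ≠ s := by rintro rfl; exact hne h3
  rw [← h3]
  have p1 := (h.arc' s j (j - s).toNat (by omega) (by omega)).mono (Set.image_subset_range _ _)
  have p2 := (h.arc' j (s + l) (l - (j - s).toNat) (by omega) (by omega)).mono (Set.image_subset_range _ _)
  rw [h.per] at p2
  by_cases hb : Even (j - s).toNat ↔ b
  · exact ⟨_, p1, by omega, by omega, hb⟩
  · refine ⟨_, p2.symm, by omega, by omega, ?_⟩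
    rw [Nat.even_sub (by omega)]
    rw [← Nat.not_even_iff_odd] at hl
    tauto

section
variable (G) (F C : Set V)

def RR (z : V) : Set V := {w | ∃ t ∈ C, Rch G (F \ {z}) w t}

def Blocks (z p : V) : Prop := ∀ w, G.Adj p w → w ∉ RR G F C z

def PP (z p : V) : Prop := z ∈ F ∧ Blocks G F C z p ∧ ∀ z' ∈ F, Blocks G F C z' p → RR G F C z ⊆ RR G F C z'
end

theorem RR_sub {F C : Set V} {z : V} : RR G F C z ⊆ F \ {z} := by
  rintro w ⟨t, ht, h⟩; exact h.left_mem

theorem RR_step {F C : Set V} {z a b : V} (hb : b ∈ RR G F C z) (ha : a ∈ F) (haz : a ≠ z) (hab : G.Adj a b) :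
    a ∈ RR G F C z := by
  obtain ⟨t, ht, h⟩ := hb
  exact ⟨t, ht, Rch.trans (Rch.edge hab (show a ∈ F \ {z} from ⟨ha, haz⟩) h.left_mem) h⟩

theorem blocks_comparable {F C : Set V} (hF : ConnS G F) {z z' p q : V}
    (hz : z ∈ F) (hb : Blocks G F C z p) (hb' : Blocks G F C z' p) (hq : q ∈ F)
    (hpq : G.Adj p q) : RR G F C z ⊆ RR G F C z' ∨ RR G F C z' ⊆ RR G F C z := by
  by_cases hzz : z = z'
  · subst hzz; exact Or.inl subset_rfl
  have key : ∀ z z', z ≠ z' → z ∉ RR G F C z' → RR G F C z' ⊆ RR G F C z := by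
    intro z z' _ hz w hw
    obtain ⟨t, ht, n, h⟩ := hw
    refine ⟨t, ht, n, (h.comp (comp_self h.left_mem)).mono ?_⟩
    intro v hv
    refine ⟨(comp_sub hv).1, ?_⟩
    rintro rfl
    exact hz ⟨t, ht, Rch.trans (Rch.symm hv) ⟨n, h⟩⟩
  by_cases h1 : z ∈ RR G F C z'
  swap
  · exact Or.inr (key z z' hzz h1)
  by_cases h2 : z' ∈ RR G F C z
  swap
  · exact Or.inl (key z' z (Ne.symm hzz) h2)
  exfalso
  have hcl : ∀ n v, PathIn G F q v n → v ∉ RR G F C z ∧ v ∉ RR G F C z' := by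
    intro n v h
    replace h := h.symm
    induction n generalizing v with
    | zero => obtain rfl := h.zero_eq; exact ⟨hb _ hpq, hb' _ hpq⟩
    | succ n ih =>
      have hv := h.left_mem
      obtain ⟨w, hw, hp⟩ := h.strip
      have hp := hp.mono Set.sdiff_subset
      obtain ⟨i1, i2⟩ := ih w hp
      have hwF := hp.left_mem
      have w1 : w ≠ z := by rintro rfl; exact i2 h1
      have w2 : w ≠ z' := by rintro rfl; exact i1 h2
      exact ⟨fun h => i1 (RR_step h hwF w1 hw.symm), fun h => i2 (RR_step h hwF w2 hw.symm)⟩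
  obtain ⟨n, hn⟩ := hF q hq z hz
  exact (hcl n z hn).2 h1

theorem PP_exists [Finite V] {F C : Set V} (hF : ConnS G F) {z p q : V} (hz : z ∈ F) (hb : Blocks G F C z p)
    (hq : q ∈ F) (hpq : G.Adj p q) : ∃ z, PP G F C z p := by
  obtain ⟨z0, hz0⟩ := Set.Finite.exists_minimalFor (RR G F C) {z | z ∈ F ∧ Blocks G F C z p} (Set.toFinite _) ⟨z, hz, hb⟩
  refine ⟨z0, hz0.prop.1, hz0.prop.2, fun z' hz' hb' => ?_⟩
  rcases blocks_comparable hF hz0.prop.1 hz0.prop.2 hb' hq hpq with h | h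
  · exact h
  · exact hz0.le_of_le ⟨hz', hb'⟩ h

theorem PP_link {F C : Set V} (hF : ConnS G F) {z z' p p' q : V} (hP : PP G F C z p) (hz' : z' ∈ F)
    (h1 : Blocks G F C z' p) (h2 : Blocks G F C z' p') (hq : q ∈ F) (hpq : G.Adj p' q) : PP G F C z p' := by
  have hb : Blocks G F C z p' := fun w hw h => h2 w hw (hP.2.2 z' hz' h1 h)
  refine ⟨hP.1, hb, fun z'' hz'' hb'' => ?_⟩
  rcases blocks_comparable hF hP.1 hb hb'' hq hpq with h | h
  · exact h
  · exact hP.2.2 z'' hz'' fun w hw hh => hP.2.1 w hw (h hh)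

theorem pair_or [Fintype V] {m : ℕ} {c : ℤ → V} (h : Good G m c) {l : ℕ} {d : ℤ → V} (hd : Cyc G l d) (hl : Odd l)
    (hdis : ∀ i, c i ∉ Set.range d) {i : ℤ} (e1 : Exit G c i) (e2 : Exit G c (i + (m - 1 : ℕ))) :
    Done G ∨ ∃ z ∈ (Set.range c)ᶜ, Blocks G (Set.range c)ᶜ (Set.range d) z (c i) ∧
      Blocks G (Set.range c)ᶜ (Set.range d) z (c (i + (m - 1 : ℕ))) := by
  have h3 := h.cyc.three
  have hne : c i ≠ c (i + (m - 1 : ℕ)) := h.cyc.inj _ _ (by omega) (by omega)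
  set F := (Set.range c)ᶜ with hF
  set p := c i with hp
  set p' := c (i + (m - 1 : ℕ)) with hp'
  have hpF : p ∉ F := fun h => h ⟨i, rfl⟩
  have hpF' : p' ∉ F := fun h => h ⟨_, rfl⟩
  have hdF : Set.range d ⊆ F := by
    rintro _ ⟨j, rfl⟩ ⟨i, hi⟩
    exact hdis i ⟨j, hi.symm⟩
  have hNV : Nonempty V := ⟨p⟩
  by_cases hyp : ∀ z, ∃ a ∈ ({p, p'} : Set V), ∃ t ∈ Set.range d, Rch G ((F ∪ {p, p'}) \ {z}) a t
  · left
    have tp := menger2 _ _ _ _ hyp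
    have main : ∀ S1 S2 : Set V, S1 ⊆ F ∪ {p, p'} → S2 ⊆ F ∪ {p, p'} → (∀ z ∈ S1, z ∉ S2) → ∀ t1 ∈ Set.range d,
        ∀ t2 ∈ Set.range d, ∀ n1 n2, PathIn G S1 p t1 n1 → PathIn G S2 p' t2 n2 → Done G := by
      intro S1 S2 hS1 hS2 hS t1 ht1 t2 ht2 n1 n2 p1 p2
      obtain ⟨u1, hu1, k1, q1⟩ := p1.trunc ht1
      obtain ⟨u2, hu2, k2, q2⟩ := p2.trunc ht2
      have k1z : k1 ≠ 0 := by
        rintro rfl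
        exact hpF (q1.zero_eq ▸ hdF hu1)
      have k2z : k2 ≠ 0 := by
        rintro rfl
        exact hpF' (q2.zero_eq ▸ hdF hu2)
      obtain ⟨k1, rfl⟩ := Nat.exists_eq_succ_of_ne_zero k1z
      obtain ⟨k2, rfl⟩ := Nat.exists_eq_succ_of_ne_zero k2z
      have hu : u1 ≠ u2 := by
        rintro rfl
        exact hS _ q1.right_mem.1 q2.right_mem.1
      obtain ⟨x1, hx1, r1⟩ := q1.strip
      obtain ⟨x2, hx2, r2⟩ := q2.strip
      obtain ⟨r, hr, -, -, hrp⟩ := odd_arcs hd hl hu1 hu2 hu (Even (k1 + k2 + m + 1))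
      have j1 := r1.append hr (fun v hv hv' => hv.1.2 hv')
      have j2 := j1.append r2.symm (by
        rintro v (hv | hv) hv'
        · exact (hS v hv.1.1 hv'.1.1).elim
        · exact hv'.1.2 hv)
      refine h.cyc.pair_done hx1 hx2 j2 ?_ ?_
      · have hF' : ∀ v, v ∉ Set.range c ↔ v ∈ F := fun v => Iff.rfl
        intro v hv
        rw [hF']
        rcases hv with (hv | hv) | hv
        · rcases hS1 hv.1.1 with h | rfl | rfl
          · exact h
          · exact (hv.2 rfl).elim
          · exact (hS _ hv.1.1 q2.left_mem.1).elim
        · exact hdF hv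
        · rcases hS2 hv.1.1 with h | rfl | rfl
          · exact h
          · exact (hS _ q1.left_mem.1 hv.1.1).elim
          · exact (hv.2 rfl).elim
      · have e : k1 + r + k2 + m + 1 = r + (k1 + k2 + m + 1) := by omega
        rw [e, Nat.even_add]; exact hrp
    obtain ⟨S1, S2, h1, h2, h3, a1, ha1, a2, ha2, t1, ht1, t2, ht2, n1, n2, p1, p2⟩ := tp
    have hna : a1 ≠ a2 := by
      rintro rfl
      exact h3 _ p1.left_mem p2.left_mem
    rcases ha1 with rfl | rfl <;> rcases ha2 with rfl | rfl
    · exact (hna rfl).elim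
    · exact main S1 S2 h1 h2 h3 t1 ht1 t2 ht2 n1 n2 p1 p2
    · exact main S2 S1 h2 h1 (fun z hz hz' => h3 z hz' hz) t2 ht2 t1 ht1 n2 n1 p2 p1
    · exact (hna rfl).elim
  · right
    push Not at hyp
    obtain ⟨z, hz⟩ := hyp
    have hzF : z ∈ F := by
      by_contra hzF
      have hsub : F ⊆ (F ∪ {p, p'}) \ {z} := fun v hv => ⟨Or.inl hv, by rintro rfl; exact hzF hv⟩
      have key : ∀ a ∈ ({p, p'} : Set V), a ≠ z → (∃ y, y ∈ F ∧ G.Adj a y) → False := by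
        rintro a ha haz ⟨y, hy, hay⟩
        refine hz a ha (d 0) ⟨0, rfl⟩ (Rch.trans (Rch.edge hay ?_ (hsub hy)) ((h.conn y hy (d 0) (hdF ⟨0, rfl⟩)).mono hsub))
        exact ⟨Or.inr ha, haz⟩
      by_cases hpz : p = z
      · exact key p' (by simp) (by rw [← hpz]; exact hne.symm) e2
      · exact key p (by simp) hpz e1
    have hsub : F \ {z} ⊆ (F ∪ {p, p'}) \ {z} := fun v hv => ⟨Or.inl hv.1, hv.2⟩
    refine ⟨z, hzF, ?_, ?_⟩
    · rintro w hw ⟨t, ht, hr⟩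
      refine hz p (by simp) t ht (Rch.trans (Rch.edge hw ?_ (hsub hr.left_mem)) (hr.mono hsub))
      exact ⟨by simp, by rintro rfl; exact hpF hzF⟩
    · rintro w hw ⟨t, ht, hr⟩
      refine hz p' (by simp) t ht (Rch.trans (Rch.edge hw ?_ (hsub hr.left_mem)) (hr.mono hsub))
      exact ⟨by simp, by rintro rfl; exact hpF' hzF⟩

theorem case1 [Fintype V] (hc : Cut3 G) (h6 : 6 ≤ Fintype.card V) {l : ℕ} {d : ℤ → V} (hd : Cyc G l d)
    (hl : Odd l) {m0 : ℕ} (hD : CycIn G (Set.range d)ᶜ (2 * m0)) : Done G := by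
  obtain ⟨m, c, hcy, hdis, hconn, hmin⟩ := ext hc (Set.range_nonempty d) hd.range_conn hD
  have hg : Good G m c := ⟨hcy, hconn, hmin⟩
  by_contra hnd
  have h3 := hcy.three
  set F := (Set.range c)ᶜ with hF
  have hdF : Set.range d ⊆ F := by
    rintro _ ⟨j, rfl⟩ ⟨i, hi⟩
    exact hdis i ⟨j, hi.symm⟩
  have fin : ∀ z1 ∈ F, ∀ z2 ∈ F, (∀ i, Blocks G F (Set.range d) z1 (c i) ∨ Blocks G F (Set.range d) z2 (c i)) → False := by
    intro z1 hz1 z2 hz2 hbl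
    let A : Set V := {w | ∃ t ∈ Set.range d, Rch G (F \ {z1, z2}) w t}
    have hAF : A ⊆ F \ {z1, z2} := by rintro w ⟨t, ht, h⟩; exact h.left_mem
    obtain ⟨j, hj1, hj2⟩ : ∃ j, d j ≠ z1 ∧ d j ≠ z2 := by
      have := hd.three
      have hd01 : d 0 ≠ d 1 := hd.inj 0 1 (by omega) (by omega)
      have hd02 : d 0 ≠ d 2 := hd.inj 0 2 (by omega) (by omega)
      have hd12 : d 1 ≠ d 2 := hd.inj 1 2 (by omega) (by omega)
      by_contra hcon
      push Not at hcon
      have a1 := or_iff_not_imp_left.2 (hcon 0)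
      have a2 := or_iff_not_imp_left.2 (hcon 1)
      have a3 := or_iff_not_imp_left.2 (hcon 2)
      grind
    have hfA : d j ∈ A := ⟨d j, ⟨j, rfl⟩, Rch.refl (show d j ∈ F \ {z1, z2} from ⟨hdF ⟨j, rfl⟩, by simp [hj1, hj2]⟩)⟩
    have hq : c 0 ∉ F := fun h => h ⟨0, rfl⟩
    obtain ⟨u, hu, w, hw, ha, u1, u2, w1, w2⟩ := hc A z1 z2 (d j) (c 0) hfA (fun h => hq (hAF h).1) hj1 hj2
      (by rintro rfl; exact hq hz1) (by rintro rfl; exact hq hz2)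
    obtain ⟨t, ht, hr⟩ := hu
    by_cases hwF : w ∈ F
    · refine hw ⟨t, ht, Rch.trans (Rch.edge ha.symm ?_ hr.left_mem) hr⟩
      exact ⟨hwF, by simp [w1, w2]⟩
    · have : w ∈ Set.range c := by simpa [hF] using hwF
      obtain ⟨i, rfl⟩ := this
      rcases hbl i with h | h
      · exact h u ha.symm ⟨t, ht, hr.mono fun v hv => ⟨hv.1, fun h => hv.2 (Or.inl h)⟩⟩
      · exact h u ha.symm ⟨t, ht, hr.mono fun v hv => ⟨hv.1, fun h => hv.2 (Or.inr h)⟩⟩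
  have pair : ∀ i, Exit G c i → Exit G c (i + (m - 1 : ℕ)) → ∃ z ∈ F, Blocks G F (Set.range d) z (c i) ∧
      Blocks G F (Set.range d) z (c (i + (m - 1 : ℕ))) := fun i e1 e2 =>
    (pair_or hg hd hl hdis e1 e2).resolve_left hnd
  have start : ∀ i, Exit G c i → Exit G c (i + (m - 1 : ℕ)) → ∃ z, PP G F (Set.range d) z (c i) := by
    intro i e1 e2
    obtain ⟨z, hz, hb, -⟩ := pair i e1 e2
    obtain ⟨q, hq, hpq⟩ := e1
    exact PP_exists hconn hz hb hq hpq
  have linkF : ∀ i z, Exit G c i → Exit G c (i + (m - 1 : ℕ)) → PP G F (Set.range d) z (c i) →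
      PP G F (Set.range d) z (c (i + (m - 1 : ℕ))) := by
    intro i z e1 e2 hP
    obtain ⟨z', hz', h1, h2⟩ := pair i e1 e2
    obtain ⟨q, hq, hpq⟩ := e2
    exact PP_link hconn hP hz' h1 h2 hq hpq
  have linkB : ∀ i z, Exit G c i → Exit G c (i + (m - 1 : ℕ)) → PP G F (Set.range d) z (c (i + (m - 1 : ℕ))) →
      PP G F (Set.range d) z (c i) := by
    intro i z e1 e2 hP
    obtain ⟨z', hz', h1, h2⟩ := pair i e1 e2
    obtain ⟨q, hq, hpq⟩ := e1
    exact PP_link hconn hP hz' h2 h1 hq hpq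
  by_cases hm : 3 ≤ m
  · have hex := (hg.exits hc h6 hm).resolve_left hnd
    have step : ∀ i z, PP G F (Set.range d) z (c i) → PP G F (Set.range d) z (c (i + 2)) := by
      intro i z hP
      have h1 := linkB (i + m + 1) z (hex _) (hex _) (by
        have : i + m + 1 + (m - 1 : ℕ) = i + (2 * m : ℕ) := by push_cast; omega
        rw [this, hcy.per]; exact hP)
      refine linkB (i + 2) z (hex _) (hex _) ?_
      have : i + 2 + (m - 1 : ℕ) = i + m + 1 := by omega
      rw [this]; exact h1
    obtain ⟨z1, hz1⟩ := start 0 (hex _) (hex _)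
    obtain ⟨z2, hz2⟩ := start 1 (hex _) (hex _)
    have all1 : ∀ n : ℕ, PP G F (Set.range d) z1 (c (2 * n)) := by
      intro n
      induction n with
      | zero => simpa using hz1
      | succ n ih =>
        have := step _ _ ih
        have e : (2 * ((n + 1 : ℕ) : ℤ)) = 2 * n + 2 := by push_cast; ring
        rwa [e]
    have all2 : ∀ n : ℕ, PP G F (Set.range d) z2 (c (2 * n + 1)) := by
      intro n
      induction n with
      | zero => simpa using hz2
      | succ n ih =>
        have := step _ _ ih
        have e : (2 * ((n + 1 : ℕ) : ℤ) + 1) = 2 * n + 1 + 2 := by push_cast; ring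
        rwa [e]
    refine fin z1 hz1.1 z2 hz2.1 fun i => ?_
    obtain ⟨j, j1, j2, j3⟩ := hcy.window 0 i
    rw [← j3]
    rcases Int.even_or_odd' j with ⟨k, hk | hk⟩
    · have : j = 2 * (k.toNat : ℤ) := by omega
      rw [this]; exact Or.inl (all1 _).2.1
    · have : j = 2 * (k.toNat : ℤ) + 1 := by omega
      rw [this]; exact Or.inr (all2 _).2.1
  · have : m = 2 := by omega
    subst this
    obtain ⟨a, e1, e2, e3⟩ := hg.exits4 hc h6
    simp only [Nat.reduceSub, Nat.cast_one] at start linkF linkB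
    obtain ⟨z, hz⟩ := start a e1 e2
    have hz1 := linkF a z e1 e2 hz
    have e3' : Exit G c (a + 1 + 1) := by rw [add_assoc]; exact e3
    have hz2 := linkF (a + 1) z e2 e3' hz1
    have hb3 : Blocks G F (Set.range d) z (c (a + 3)) := by
      by_cases e4 : Exit G c (a + 3)
      · have e : a + 1 + 1 + 1 = a + 3 := by ring
        have := linkF (a + 1 + 1) z e3' (by rw [e]; exact e4) hz2
        rw [e] at this
        exact this.2.1
      · intro w hw hwR
        exact e4 ⟨w, (RR_sub hwR).1, hw⟩
    refine fin z hz.1 z hz.1 fun i => Or.inl ?_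
    obtain ⟨j, j1, j2, j3⟩ := hcy.window a i
    rw [← j3]
    have : j = a ∨ j = a + 1 ∨ j = a + 1 + 1 ∨ j = a + 3 := by push_cast at j2; omega
    rcases this with rfl | rfl | rfl | rfl
    · exact hz.2.1
    · exact hz1.2.1
    · exact hz2.2.1
    · exact hb3

end CE
end

section
namespace CE
variable {V : Type*} {G : SimpleGraph V}

def NoOE (G : SimpleGraph V) : Prop := ∀ (S T : Set V) (n n' : ℕ), CycIn G S n → Odd n → CycIn G T n' → Even n' →
  (∀ z ∈ S, z ∉ T) → False

theorem Cyc.toIn {k : ℕ} {c : ℤ → V} (h : Cyc G k c) : CycIn G (Set.range c) k := ⟨c, h, fun i => ⟨i, rfl⟩⟩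

theorem theta {l : ℕ} {d : ℤ → V} (h : Cyc G l d) (hl : Odd l) {S : Set V} {z y x x' : V} {n : ℕ}
    (hp : PathIn G S z y n) (hS : ∀ v ∈ S, v ∉ Set.range d) (hx : x ∈ Set.range d) (hx' : x' ∈ Set.range d)
    (hne : x ≠ x') (ha : G.Adj z x) (ha' : G.Adj y x') : ∃ N, Even N ∧ CycIn G (Set.range d ∪ S) N := by
  obtain ⟨r, h1, h2, h3, h4⟩ := odd_arcs h hl hx hx' hne (Even n)
  have := CycIn.out h1 hp (fun v hv hv' => hS v hv' hv) ha.symm ha'.symm (by omega) rfl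
  exact ⟨_, by rw [Nat.even_add, Nat.even_add, h4]; simp, this⟩

theorem odd_chord {l : ℕ} {d : ℤ → V} (h : Cyc G l d) (hl : Odd l) {i : ℤ} {r : ℕ} (hr : 2 ≤ r) (hr2 : r + 2 ≤ l)
    (ha : G.Adj (d i) (d (i + r))) : ∃ N, Even N ∧ CycIn G (Set.range d) N := by
  have c1 := (h.chord ha r rfl hr (by omega)).mono (Set.image_subset_range _ _)
  have c2 := (h.chord (a := i + r) (b := i + l) (by rw [h.per]; exact ha.symm) (l - r) (by omega) (by omega) (by omega)).mono
    (Set.image_subset_range _ _)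
  obtain ⟨e, he⟩ := hl
  rcases Nat.even_or_odd r with ⟨f, hf⟩ | ⟨f, hf⟩
  · exact ⟨_, ⟨e - f + 1, by omega⟩, c2⟩
  · exact ⟨_, ⟨f + 1, by omega⟩, c1⟩

theorem cover [Fintype V] (hc : Cut3 G) (hno : NoOE G) {S T : Set V} {n n' : ℕ} (hS : CycIn G S n) (hn : Odd n)
    (hT : CycIn G T n') (hn' : Odd n') (hd : ∀ z ∈ S, z ∉ T) (v : V) : v ∈ S ∨ v ∈ T := by
  obtain ⟨c, hcc, hcS⟩ := hS
  obtain ⟨d, hdc, hdT⟩ := hT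
  have hcd : ∀ z ∈ Set.range c, z ∉ Set.range d := by
    rintro _ ⟨i, rfl⟩ ⟨j, hj⟩
    exact hd _ (hcS i) (hj ▸ hdT j)
  by_contra hcon
  have hv : v ∈ (Set.range c ∪ Set.range d)ᶜ := by
    rintro (⟨i, rfl⟩ | ⟨i, rfl⟩)
    · exact hcon (Or.inl (hcS i))
    · exact hcon (Or.inr (hdT i))
  set W := (Set.range c ∪ Set.range d)ᶜ with hW
  let X := comp G W v
  have hXW : X ⊆ W := comp_sub
  have hatt : ∀ u ∈ X, ∀ w, w ∉ X → G.Adj u w → w ∈ Set.range c ∨ w ∈ Set.range d := by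
    intro u hu w hw ha
    by_contra hh
    exact hw (comp_closed hu ha hh)
  have h3 := hcc.three
  have hcX : ∀ i, c i ∉ X := fun i h => hXW h (Or.inl ⟨i, rfl⟩)
  obtain ⟨u1, g1, u2, g2, u3, g3, w1, w2, w3, f1, f2, f3, n12, n13, n23, a1, a2, a3⟩ :=
    hc.att3 (comp_self hv : v ∈ X) (hcX 0) (hcX 1) (hcX 2) (hcc.inj 0 1 (by omega) (by omega))
      (hcc.inj 0 2 (by omega) (by omega)) (hcc.inj 1 2 (by omega) (by omega))
  have keyc : ∀ u ∈ X, ∀ u' ∈ X, ∀ w ∈ Set.range c, ∀ w' ∈ Set.range c, w ≠ w' → G.Adj u w → G.Adj u' w' → False := by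
    intro u hu u' hu' w hw w' hw' hne ha ha'
    obtain ⟨p, hp⟩ := (comp_conn : ConnS G X) u hu u' hu'
    obtain ⟨N, hN, hcy⟩ := theta hcc hn hp (fun v hv hv' => hXW hv (Or.inl hv')) hw hw' hne ha ha'
    refine hno _ _ _ _ hdc.toIn hn' hcy hN ?_
    rintro z hz (hz' | hz')
    · exact hcd z hz' hz
    · exact hXW hz' (Or.inr hz)
  have keyd : ∀ u ∈ X, ∀ u' ∈ X, ∀ w ∈ Set.range d, ∀ w' ∈ Set.range d, w ≠ w' → G.Adj u w → G.Adj u' w' → False := by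
    intro u hu u' hu' w hw w' hw' hne ha ha'
    obtain ⟨p, hp⟩ := (comp_conn : ConnS G X) u hu u' hu'
    obtain ⟨N, hN, hcy⟩ := theta hdc hn' hp (fun v hv hv' => hXW hv (Or.inr hv')) hw hw' hne ha ha'
    refine hno _ _ _ _ hcc.toIn hn hcy hN ?_
    rintro z hz (hz' | hz')
    · exact hcd z hz hz'
    · exact hXW hz' (Or.inl hz)
  have k1 := keyc u1 g1 u2 g2 w1
  have k2 := keyc u1 g1 u3 g3 w1
  have k3 := keyc u2 g2 u3 g3 w2
  have l1 := keyd u1 g1 u2 g2 w1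
  have l2 := keyd u1 g1 u3 g3 w1
  have l3 := keyd u2 g2 u3 g3 w2
  rcases hatt _ g1 _ f1 a1 with b1 | b1 <;> rcases hatt _ g2 _ f2 a2 with b2 | b2 <;>
    rcases hatt _ g3 _ f3 a3 with b3 | b3
  · exact k1 b1 _ b2 n12 a1 a2
  · exact k1 b1 _ b2 n12 a1 a2
  · exact k2 b1 _ b3 n13 a1 a3
  · exact l3 b2 _ b3 n23 a2 a3
  · exact k3 b2 _ b3 n23 a2 a3
  · exact l2 b1 _ b3 n13 a1 a3
  · exact l1 b1 _ b2 n12 a1 a2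
  · exact l1 b1 _ b2 n12 a1 a2

structure OPair (G : SimpleGraph V) (k l : ℕ) (c d : ℤ → V) : Prop where
  cc : Cyc G k c
  cd : Cyc G l d
  ok : Odd k
  ol : Odd l
  dis : ∀ i j, c i ≠ d j

namespace OPair
variable {k l : ℕ} {c d : ℤ → V}

theorem swap (h : OPair G k l c d) : OPair G l k d c := ⟨h.cd, h.cc, h.ol, h.ok, fun i j => (h.dis j i).symm⟩
theorem shiftC (h : OPair G k l c d) (a : ℤ) : OPair G k l (fun i => c (a + i)) d :=
  ⟨h.cc.shift a, h.cd, h.ok, h.ol, fun i j => h.dis _ j⟩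
theorem revC (h : OPair G k l c d) : OPair G k l (fun i => c (- i)) d :=
  ⟨h.cc.rev, h.cd, h.ok, h.ol, fun i j => h.dis _ j⟩
theorem shiftD (h : OPair G k l c d) (a : ℤ) : OPair G k l c (fun i => d (a + i)) :=
  ⟨h.cc, h.cd.shift a, h.ok, h.ol, fun i j => h.dis i _⟩

theorem dis' (h : OPair G k l c d) : ∀ z ∈ Set.range c, z ∉ Set.range d := by
  rintro _ ⟨i, rfl⟩ ⟨j, hj⟩
  exact h.dis i j hj.symm

/-- every vertex of the first cycle has a neighbour on the second -/
theorem nbr [Fintype V] (h : OPair G k l c d) (hc : Cut3 G) (h6 : 6 ≤ Fintype.card V) (hno : NoOE G) (i : ℤ) :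
    ∃ j, G.Adj (c i) (d j) := by
  rcases h.cc.exit_or_chord hc h6 i with ⟨y, hy, ha⟩ | ⟨r, h1, h2, h3⟩
  · rcases cover hc hno h.cc.toIn h.ok h.cd.toIn h.ol h.dis' y with hh | ⟨j, rfl⟩
    · exact (hy hh).elim
    · exact ⟨j, ha⟩
  · obtain ⟨N, hN, hcy⟩ := odd_chord h.cc h.ok h1 h2 h3
    exact (hno _ _ _ _ h.cd.toIn h.ol hcy hN (fun z hz hz' => h.dis' z hz' hz)).elim

theorem uniq_aux [Fintype V] (h : OPair G k l c d) (hc : Cut3 G) (h6 : 6 ≤ Fintype.card V) (hno : NoOE G) (hk : 5 ≤ k)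
    {x : V} (hx : x ∈ Set.range d) {g : ℕ} (hg : 1 ≤ g) (hgk : 2 * g < k) (h0 : G.Adj x (c 0))
    (h1 : G.Adj x (c (2 * g))) : Done G := by
  obtain ⟨e, he⟩ := h.ok
  have sub : ∀ S : Set ℤ, ∀ z ∈ c '' S, z ∉ Set.range d := fun S z hz => h.dis' z (Set.image_subset_range _ _ hz)
  by_cases hg2 : 2 ≤ g
  · obtain ⟨j, hj⟩ := h.nbr hc h6 hno (g + 1)
    obtain ⟨n, hn⟩ := h.cd.range_conn x hx (d j) ⟨j, rfl⟩
    have r1 := h.cc.arc' 0 (g + 1) (g + 1) (by push_cast; omega) (by omega)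
    have r2 := (h.cc.arc' (g + 1) (2 * g) (g - 1) (by omega) (by omega)).symm
    have r3 := (h.cc.arc' (g + 1) (0 + k) (k - g - 1) (by omega) (by omega)).symm
    rw [h.cc.per] at r3
    have r4 := (h.cc.arc' (2 * g) (g + 1 + k) (k - g + 1) (by omega) (by omega))
    rw [h.cc.per] at r4
    have c1 := CycIn.out r1 hn (sub _) h0.symm hj (by omega) rfl
    have c2 := CycIn.out r2 hn (sub _) h1.symm hj (by omega) rfl
    have c3 := CycIn.out r3 hn (sub _) h0.symm hj (by omega) rfl
    have c4 := CycIn.out r4 hn (sub _) h1.symm hj (by omega) rfl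
    rcases Nat.even_or_odd (g - 1 + n + 2) with hp | ⟨f, hf⟩
    · exact Done.of c2 c1 (by omega) hp
    · exact Done.of c3 c4 (by omega) ⟨e + n - f + 1, by omega⟩
  · have : g = 1 := by omega
    subst this
    obtain ⟨j, hj⟩ := h.nbr hc h6 hno 3
    obtain ⟨n, hn⟩ := h.cd.range_conn x hx (d j) ⟨j, rfl⟩
    have r1 := h.cc.arc' 0 3 3 (by norm_num) (by omega)
    have r2 := (h.cc.arc' (2 * (1:ℕ)) 3 1 (by omega) (by omega))
    have r3 := (h.cc.arc' 3 (0 + k) (k - 3) (by omega) (by omega)).symm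
    rw [h.cc.per] at r3
    have r4 := (h.cc.arc' 3 (2 * (1:ℕ) + k) (k - 1) (by omega) (by omega)).symm
    rw [h.cc.per] at r4
    have c1 := CycIn.out r1 hn (sub _) h0.symm hj (by omega) rfl
    have c2 := CycIn.out r2 hn (sub _) h1.symm hj (by omega) rfl
    have c3 := CycIn.out r3 hn (sub _) h0.symm hj (by omega) rfl
    have c4 := CycIn.out r4 hn (sub _) h1.symm hj (by omega) rfl
    rcases Nat.even_or_odd (1 + n + 2) with hp | ⟨f, hf⟩
    · exact Done.of c2 c1 (by omega) hp
    · exact Done.of c3 c4 (by omega) ⟨e + n - f + 1, by omega⟩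

theorem uniq [Fintype V] (h : OPair G k l c d) (hc : Cut3 G) (h6 : 6 ≤ Fintype.card V) (hno : NoOE G) (hk : 5 ≤ k)
    (hnd : ¬ Done G) {j s s' : ℤ} (h0 : G.Adj (d j) (c s)) (h1 : G.Adj (d j) (c s')) : c s = c s' := by
  by_contra hne
  obtain ⟨t, e1, e2, e3⟩ := h.cc.window s s'
  rw [← e3] at hne h1
  have hts : t ≠ s := by rintro rfl; exact hne rfl
  obtain ⟨e, he⟩ := h.ok
  rcases Int.even_or_odd' (t - s) with ⟨g, hg | hg⟩
  · refine hnd ((h.shiftC s).uniq_aux hc h6 hno hk ⟨j, rfl⟩ (g := g.toNat) (by omega) (by omega) ?_ ?_)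
    · simpa using h0
    · have : s + 2 * (g.toNat : ℤ) = t := by omega
      simp only [this]; exact h1
  · refine hnd ((h.shiftC t).uniq_aux hc h6 hno hk ⟨j, rfl⟩ (g := e - g.toNat) (by omega) (by omega) ?_ ?_)
    · simpa using h1
    · have : t + 2 * ((e - g.toNat : ℕ) : ℤ) = s + k := by omega
      simp only [this, h.cc.per]
      exact h0

end OPair
end CE
end

section
namespace CE
variable {V : Type*} {G : SimpleGraph V}

theorem cyc4 {a b c d : V} (h1 : G.Adj a b) (h2 : G.Adj b c) (h3 : G.Adj c d) (h4 : G.Adj d a)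
    (hac : a ≠ c) (hbd : b ≠ d) : CycIn G Set.univ 4 := by
  have p0 : PathIn G {d} d d 0 := PathIn.refl rfl
  have p1 := PathIn.cons h3 p0 (by simp [h3.ne])
  have p2 := PathIn.cons h2 p1 (by simp [h2.ne, hbd])
  have p3 := PathIn.cons h1 p2 (by simp [h1.ne, hac, h4.ne'])
  exact (p3.close (by omega) h4).mono (Set.subset_univ _)

theorem cyc6 {a b c d e f : V} (h1 : G.Adj a b) (h2 : G.Adj b c) (h3 : G.Adj c d) (h4 : G.Adj d e)
    (h5 : G.Adj e f) (h6 : G.Adj f a) (hn : [a, b, c, d, e, f].Nodup) : CycIn G Set.univ 6 := by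
  simp only [List.nodup_cons, List.mem_cons, not_or, List.not_mem_nil, not_false_eq_true] at hn
  have p0 : PathIn G {f} f f 0 := PathIn.refl rfl
  have p1 := PathIn.cons h5 p0 (by simp [h5.ne])
  have p2 := PathIn.cons h4 p1 (by simp [hn])
  have p3 := PathIn.cons h3 p2 (by simp [hn])
  have p4 := PathIn.cons h2 p3 (by simp [hn])
  have p5 := PathIn.cons h1 p4 (by simp [hn])
  exact (p5.close (by omega) h6).mono (Set.subset_univ _)

theorem cyc8 {a b c d e f g h : V} (h1 : G.Adj a b) (h2 : G.Adj b c) (h3 : G.Adj c d) (h4 : G.Adj d e)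
    (h5 : G.Adj e f) (h6 : G.Adj f g) (h7 : G.Adj g h) (h8 : G.Adj h a)
    (hn : [a, b, c, d, e, f, g, h].Nodup) : CycIn G Set.univ 8 := by
  simp only [List.nodup_cons, List.mem_cons, not_or, List.not_mem_nil, not_false_eq_true] at hn
  have p0 : PathIn G {h} h h 0 := PathIn.refl rfl
  have p1 := PathIn.cons h7 p0 (by simp [h7.ne])
  have p2 := PathIn.cons h6 p1 (by simp [hn])
  have p3 := PathIn.cons h5 p2 (by simp [hn])
  have p4 := PathIn.cons h4 p3 (by simp [hn])
  have p5 := PathIn.cons h3 p4 (by simp [hn])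
  have p6 := PathIn.cons h2 p5 (by simp [hn])
  have p7 := PathIn.cons h1 p6 (by simp [hn])
  exact (p7.close (by omega) h8).mono (Set.subset_univ _)

theorem done46 (h : CycIn G Set.univ 4) (h' : CycIn G Set.univ 6) : Done G := ⟨2, h, h'⟩
theorem done68 (h : CycIn G Set.univ 6) (h' : CycIn G Set.univ 8) : Done G := ⟨3, h, h'⟩

namespace OPair
variable {k l : ℕ} {c d : ℤ → V}

/-- cycle lengths three and three -/
theorem small33 [Fintype V] (h : OPair G 3 3 c d) (hc : Cut3 G) (h6 : 6 ≤ Fintype.card V) (hno : NoOE G) : Done G := by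
  have key : ∃ p q x x', c p ≠ c q ∧ d x ≠ d x' ∧ G.Adj (c p) (d x) ∧ G.Adj (c q) (d x') := by
    obtain ⟨x, hx⟩ := h.nbr hc h6 hno 0
    obtain ⟨y, hy⟩ := h.nbr hc h6 hno 1
    have h01 : c 0 ≠ c 1 := h.cc.inj _ _ (by omega) (by norm_num)
    by_cases hxy : d x = d y
    · have hne : d (x + 1) ≠ d x := (h.cd.adj x).ne'
      obtain ⟨j, hj⟩ := h.swap.nbr hc h6 hno (x + 1)
      by_cases h0 : c 0 = c j
      · exact ⟨1, j, y, x + 1, by rw [← h0]; exact h01.symm, by rw [← hxy]; exact hne.symm, hy, hj.symm⟩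
      · exact ⟨0, j, x, x + 1, h0, hne.symm, hx, hj.symm⟩
    · exact ⟨0, 1, x, y, h01, hxy, hx, hy⟩
  obtain ⟨p, q, x, x', hpq, hxx, a1, a2⟩ := key
  have h3 : Odd 3 := by decide
  obtain ⟨r, e1, e2, e3, e4⟩ := odd_arcs h.cc h3 ⟨p, rfl⟩ ⟨q, rfl⟩ hpq True
  obtain ⟨r', f1, f2, f3, f4⟩ := odd_arcs h.cc h3 ⟨p, rfl⟩ ⟨q, rfl⟩ hpq False
  obtain ⟨s, g1, g2, g3, g4⟩ := odd_arcs h.cd h3 ⟨x, rfl⟩ ⟨x', rfl⟩ hxx True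
  obtain ⟨s', i1, i2, i3, i4⟩ := odd_arcs h.cd h3 ⟨x, rfl⟩ ⟨x', rfl⟩ hxx False
  simp only [iff_true, iff_false, Nat.not_even_iff_odd] at e4 f4 g4 i4
  obtain ⟨_, e4⟩ := e4
  obtain ⟨_, f4⟩ := f4
  obtain ⟨_, g4⟩ := g4
  obtain ⟨_, i4⟩ := i4
  have c1 := CycIn.out f1 i1 h.dis' a1 a2 (by omega) (N := 4) (by omega)
  have c2 := CycIn.out e1 g1 h.dis' a1 a2 (by omega) (N := 6) (by omega)
  exact Done.of c1 c2 rfl (by decide)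

theorem small3 [Fintype V] (h : OPair G 3 l c d) (hc : Cut3 G) (h6 : 6 ≤ Fintype.card V) (hno : NoOE G) (hl : 5 ≤ l) :
    Done G := by
  by_contra hnd
  have key : ∀ j, G.Adj (d j) (c 0) ∨ G.Adj (d j) (c 1) ∨ G.Adj (d j) (c 2) := by
    intro j
    obtain ⟨i, hi⟩ := h.swap.nbr hc h6 hno j
    obtain ⟨t, e1, e2, e3⟩ := h.cc.window 0 i
    rw [← e3] at hi
    have : t = 0 ∨ t = 1 ∨ t = 2 := by push_cast at e2; omega
    rcases this with rfl | rfl | rfl <;> tauto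
  have u : ∀ i j : ℤ, 0 ≤ i → i < j → j < 4 → ∀ s, G.Adj (d i) (c s) → G.Adj (d j) (c s) → False := by
    intro i j h1 h2 h3 s a1 a2
    exact h.cd.inj i j h2 (by omega) (h.swap.uniq hc h6 hno hl hnd a1.symm a2.symm)
  have k0 := key 0
  have k1 := key 1
  have k2 := key 2
  have k3 := key 3
  have u01 := u 0 1 (by omega) (by omega) (by omega)
  have u02 := u 0 2 (by omega) (by omega) (by omega)
  have u03 := u 0 3 (by omega) (by omega) (by omega)
  have u12 := u 1 2 (by omega) (by omega) (by omega)
  have u13 := u 1 3 (by omega) (by omega) (by omega)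
  have u23 := u 2 3 (by omega) (by omega) (by omega)
  have := u01 0
  have := u01 1
  have := u01 2
  have := u02 0
  have := u02 1
  have := u02 2
  have := u03 0
  have := u03 1
  have := u03 2
  have := u12 0
  have := u12 1
  have := u12 2
  have := u13 0
  have := u13 1
  have := u13 2
  have := u23 0
  have := u23 1
  have := u23 2
  clear u01 u02 u03 u12 u13 u23 u
  grind

end OPair
end CE
end

section
namespace CE
variable {V : Type*} {G : SimpleGraph V}

namespace OPair
variable {k l : ℕ} {c d : ℤ → V}

theorem ladder (h : OPair G k l c d) {j j' p p' : ℤ} (hj : j < j') (hj' : j' < j + k) (hp : p - p' < l)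
    (hp' : p' - p < l) (a : G.Adj (c j) (d p)) (a' : G.Adj (c j') (d p')) :
    CycIn G (c '' Set.Icc j j' ∪ d '' Set.Icc (min p p') (max p p')) ((j' - j).toNat + (p - p').natAbs + 2) := by
  have p1 := h.cc.arc' j j' (j' - j).toNat (by omega) (by omega)
  have p2 : PathIn G (d '' Set.Icc (min p p') (max p p')) (d p) (d p') (p - p').natAbs := by
    rcases le_total p p' with hh | hh
    · rw [min_eq_left hh, max_eq_right hh]
      exact h.cd.arc' _ _ _ (by omega) (by omega)
    · rw [min_eq_right hh, max_eq_left hh]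
      exact (h.cd.arc' _ _ _ (by omega) (by omega)).symm
  refine CycIn.out p1 p2 ?_ a a' (by omega) rfl
  intro z hz hz'
  exact h.dis' z (Set.image_subset_range _ _ hz) (Set.image_subset_range _ _ hz')

theorem lemM [Fintype V] (h : OPair G k l c d) (hc : Cut3 G) (h6 : 6 ≤ Fintype.card V) (hno : NoOE G) (hk : 5 ≤ k)
    (hl : 5 ≤ l) (hnd : ¬ Done G) {o : ℤ} (ho : Odd o) (h0 : 0 < o) (hok : o < k) (a0 : G.Adj (d 0) (c 0))
    (a1 : G.Adj (d 1) (c o)) : o = 1 := by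
  by_contra ho1
  obtain ⟨o', ho'⟩ := ho
  obtain ⟨k', hk'⟩ := h.ok
  have p1 := h.cc.arc' o (0 + k) (k - o).toNat (by omega) (by omega)
  have p2 := (h.cd.arc' 0 1 1 (by norm_num) (by omega)).symm
  have a0' : G.Adj (c (0 + k)) (d 0) := by rw [h.cc.per]; exact a0.symm
  have hC := CycIn.out p1 p2 (fun z hz hz' => h.dis' z (Set.image_subset_range _ _ hz)
    (Set.image_subset_range _ _ hz')) a1.symm a0' (by omega) rfl
  have hCo : Odd ((k - o).toNat + 1 + 2) := ⟨k' - o'.toNat + 1, by omega⟩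
  have hpi : ∀ j, 1 ≤ j → j < o → ∃ p : ℤ, 2 ≤ p ∧ p < l ∧ G.Adj (c j) (d p) := by
    intro j h1 h2
    obtain ⟨i, hi⟩ := h.nbr hc h6 hno j
    obtain ⟨t, e1, e2, e3⟩ := h.cd.window 0 i
    rw [← e3] at hi
    refine ⟨t, ?_, by omega, hi⟩
    have t0 : t ≠ 0 := by
      rintro rfl
      exact h.cc.inj 0 j (by omega) (by omega) (h.uniq hc h6 hno hk hnd a0 hi.symm)
    have t1 : t ≠ 1 := by
      rintro rfl
      exact h.cc.inj j o (by omega) (by omega) (h.uniq hc h6 hno hk hnd hi.symm a1)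
    omega
  have hdis : ∀ j j' p p' : ℤ, 1 ≤ j → j < j' → j' < o → 2 ≤ p → p < l → 2 ≤ p' → p' < l → 
      ∀ z ∈ c '' Set.Icc o (0 + k) ∪ d '' Set.Icc 0 1, z ∉ c '' Set.Icc j j' ∪ d '' Set.Icc (min p p') (max p p') := by
    rintro j j' p p' h1 h2 h3 h4 h5 h6 h7 z (hz | hz) (hz' | hz')
    · exact icc_disj h.cc (by omega) (by omega) z hz' hz
    · exact h.dis' z (Set.image_subset_range _ _ hz) (Set.image_subset_range _ _ hz')
    · exact h.dis' z (Set.image_subset_range _ _ hz') (Set.image_subset_range _ _ hz)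
    · exact icc_disj h.cd (by omega) (by omega) z hz hz'
  have hpar : ∀ j j' p p' : ℤ, 1 ≤ j → j < j' → j' < o → 2 ≤ p → p < l → 2 ≤ p' → p' < l → G.Adj (c j) (d p) →
      G.Adj (c j') (d p') → Odd ((j' - j).toNat + (p - p').natAbs + 2) := by
    intro j j' p p' h1 h2 h3 h4 h5 h6 h7 a a'
    by_contra hcon
    rw [Nat.not_odd_iff_even] at hcon
    exact hno _ _ _ _ hC hCo (h.ladder h2 (by omega) (by omega) (by omega) a a') hcon
      (hdis j j' p p' h1 h2 h3 h4 h5 h6 h7)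
  obtain ⟨q1, f1, g1, b1⟩ := hpi 1 (by omega) (by omega)
  obtain ⟨q2, f2, g2, b2⟩ := hpi 2 (by omega) (by omega)
  have o12 := hpar 1 2 q1 q2 (by omega) (by omega) (by omega) f1 g1 f2 g2 b1 b2
  by_cases ho3 : o = 3
  · subst ho3
    have hD := h.ladder (j := 1) (j' := 2) (by omega) (by omega) (p := q1) (p' := q2) (by omega) (by omega) b1 b2
    have hcov := cover hc hno hC hCo hD o12 (hdis 1 2 q1 q2 (by omega) (by omega) (by omega) f1 g1 f2 g2)
    have hmem : ∀ t : ℤ, 2 ≤ t → t < l → min q1 q2 ≤ t ∧ t ≤ max q1 q2 := by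
      intro t t1 t2
      rcases hcov (d t) with (⟨x, hx, hx'⟩ | ⟨x, hx, hx'⟩) | (⟨x, hx, hx'⟩ | ⟨x, hx, hx'⟩)
      · exact (h.dis _ _ hx').elim
      · have := hx.1
        have := hx.2
        exact (h.cd.inj x t (by omega) (by omega) hx').elim
      · exact (h.dis _ _ hx').elim
      · have e1 := hx.1
        have e2 := hx.2
        have := h.cd.inj' hx' (by omega) (by omega)
        omega
    have m1 := hmem 2 (by omega) (by omega)
    have m2 := hmem (l - 1) (by omega) (by omega)
    have c01 := h.cc.adj 0
    have c12 := h.cc.adj 1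
    have c23 := h.cc.adj 2
    have d01 := h.cd.adj 0
    have d12 := h.cd.adj 1
    have dm : G.Adj (d (l - 1)) (d 0) := by
      have := h.cd.adj (l - 1)
      have e : (l : ℤ) - 1 + 1 = 0 + l := by omega
      rwa [e, h.cd.per] at this
    norm_num at c01 c12 c23 d01 d12
    have n1 := h.cc.inj 0 1 (by omega) (by omega)
    have n2 := h.cc.inj 0 2 (by omega) (by omega)
    have n3 := h.cc.inj 0 3 (by omega) (by omega)
    have n4 := h.cc.inj 1 2 (by omega) (by omega)
    have n5 := h.cc.inj 1 3 (by omega) (by omega)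
    have n6 := h.cc.inj 2 3 (by omega) (by omega)
    have i1 := h.cd.inj 0 1 (by omega) (by omega)
    have i2 := h.cd.inj 0 2 (by omega) (by omega)
    have i3 := h.cd.inj 0 (l-1) (by omega) (by omega)
    have i4 := h.cd.inj 1 2 (by omega) (by omega)
    have i5 := h.cd.inj 1 (l-1) (by omega) (by omega)
    have i6 := h.cd.inj 2 (l-1) (by omega) (by omega)
    have hd1 := h.dis
    have hd2 : ∀ i j, d i ≠ c j := fun i j => (h.dis j i).symm
    have six := cyc6 c01 c12 c23 a1.symm d01.symm a0 (by
      simp only [List.nodup_cons, List.mem_cons, not_or, List.not_mem_nil, not_false_eq_true, List.nodup_nil, and_true]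
      simp [n1, n2, n3, n4, n5, n6, hd1, i1.symm])
    have hq : (q1 = l - 1) ∨ (q1 = 2 ∧ q2 = l - 1) := by omega
    rcases hq with rfl | ⟨rfl, rfl⟩
    · exact hnd (done46 (cyc4 dm a0 c01 b1 (hd2 _ _) (hd2 _ _)) six)
    · refine hnd (done68 six (cyc8 dm a0 c01 b1 d12.symm a1 c23.symm b2 ?_))
      simp only [List.nodup_cons, List.mem_cons, not_or, List.not_mem_nil, not_false_eq_true, List.nodup_nil, and_true]
      simp [n1, n2, n3, n4, n5, n6.symm, hd1, hd2, i1, i2, i3.symm, i4.symm, i5.symm, i6.symm]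
  · obtain ⟨q3, f3, g3, b3⟩ := hpi 3 (by omega) (by omega)
    have o13 := hpar 1 3 q1 q3 (by omega) (by omega) (by omega) f1 g1 f3 g3 b1 b3
    have o23 := hpar 2 3 q2 q3 (by omega) (by omega) (by omega) f2 g2 f3 g3 b2 b3
    obtain ⟨x, hx⟩ := o12
    obtain ⟨y, hy⟩ := o13
    obtain ⟨z, hz⟩ := o23
    omega

theorem partner [Fintype V] (h : OPair G k l c d) (hc : Cut3 G) (h6 : 6 ≤ Fintype.card V) (hno : NoOE G) (hk : 5 ≤ k)
    (hl : 5 ≤ l) (hnd : ¬ Done G) {i s t : ℤ} (a0 : G.Adj (d i) (c s))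
    (a1 : G.Adj (d (i + 1)) (c t)) : G.Adj (c s) (c t) := by
  obtain ⟨r, e1, e2, e3⟩ := h.cc.window s t
  rw [← e3] at a1 ⊢
  have hrs : r ≠ s := by
    rintro rfl
    exact h.cd.inj i (i + 1) (by omega) (by omega) (h.swap.uniq hc h6 hno hl hnd a0.symm a1.symm)
  obtain ⟨k', hk'⟩ := h.ok
  have aux : ∀ x, x = r → G.Adj (d (i + 1)) (c x) := by rintro x rfl; exact a1
  rcases Int.even_or_odd' (r - s) with ⟨g, hg | hg⟩
  · have := ((h.shiftC s).revC.shiftD i).lemM hc h6 hno hk hl hnd (o := k - (r - s)) ⟨k' - g, by omega⟩ (by omega) (by omega)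
      (by simpa using a0) (by
        have e : s + -((k:ℤ) - (r - s)) + k = r := by omega
        show G.Adj (d (i + 1)) (c (s + -((k:ℤ) - (r - s))))
        rw [← h.cc.per, e]
        exact a1)
    have e : s + k = r + 1 := by omega
    rw [← h.cc.per s, e]
    exact (h.cc.adj r).symm
  · have := ((h.shiftC s).shiftD i).lemM hc h6 hno hk hl hnd (o := r - s) ⟨g, by omega⟩ (by omega) (by omega)
      (by simpa using a0) (aux _ (by omega))
    have e : r = s + 1 := by omega
    rw [e]
    exact h.cc.adj s

theorem big [Fintype V] (h : OPair G k l c d) (hc : Cut3 G) (h6 : 6 ≤ Fintype.card V) (hno : NoOE G) (hk : 5 ≤ k)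
    (hl : 5 ≤ l) : Done G := by
  by_contra hnd
  obtain ⟨s, hs⟩ := h.swap.nbr hc h6 hno 0
  obtain ⟨t, ht⟩ := h.swap.nbr hc h6 hno 1
  obtain ⟨u, hu⟩ := h.swap.nbr hc h6 hno 2
  have p1 := h.partner hc h6 hno hk hl hnd (i := 0) hs ht
  have p2 := h.partner hc h6 hno hk hl hnd (i := 1) ht hu
  have d01 := h.cd.adj 0
  have d12 := h.cd.adj 1
  norm_num at d01 d12
  have n1 := h.cd.inj 0 1 (by omega) (by omega)
  have n2 := h.cd.inj 0 2 (by omega) (by omega)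
  have n3 := h.cd.inj 1 2 (by omega) (by omega)
  have hd2 : ∀ i j, d i ≠ c j := fun i j => (h.dis j i).symm
  have nsu : c s ≠ c u := by
    intro e
    rw [e] at hs
    exact n2 (h.swap.uniq hc h6 hno hl hnd hs.symm hu.symm)
  refine hnd (done46 (cyc4 d01 ht p1.symm hs.symm (hd2 _ _) (hd2 _ _)) (cyc6 d01 d12 hu p2.symm p1.symm hs.symm ?_))
  simp only [List.nodup_cons, List.mem_cons, not_or, List.not_mem_nil, not_false_eq_true, List.nodup_nil, and_true]
  simp [n1, n2, n3, hd2, nsu.symm, p1.ne', p2.ne']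

theorem done [Fintype V] (h : OPair G k l c d) (hc : Cut3 G) (h6 : 6 ≤ Fintype.card V) (hno : NoOE G) : Done G := by
  have k3 := h.cc.three
  have l3 := h.cd.three
  obtain ⟨k', hk'⟩ := h.ok
  obtain ⟨l', hl'⟩ := h.ol
  have hk : k = 3 ∨ 5 ≤ k := by omega
  have hl : l = 3 ∨ 5 ≤ l := by omega
  rcases hk with rfl | hk
  · rcases hl with rfl | hl
    · exact h.small33 hc h6 hno
    · exact h.small3 hc h6 hno hl
  · rcases hl with rfl | hl
    · exact h.swap.small3 hc h6 hno hk
    · exact h.big hc h6 hno hk hl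

end OPair
end CE
end

section
namespace CE
variable {V : Type*} {G : SimpleGraph V}

def OddMeet (G : SimpleGraph V) : Prop := ∀ (S T : Set V) (n n' : ℕ), CycIn G S n → Odd n → CycIn G T n' →
  (∀ z ∈ S, z ∉ T) → False

/-- the end of a longest path in an acyclic component has two neighbours outside, and three if the path is trivial -/
theorem leaf_out [Fintype V] (hc : Cut3 G) (h6 : 6 ≤ Fintype.card V) {D : Set V} {v x y : V} {q : ℕ}
    (h : PathIn G (comp G Dᶜ v) x y q)
    (hmax : ∀ x' y' q', PathIn G (comp G Dᶜ v) x' y' q' → q' ≤ q) (hac : ∀ n, ¬ CycIn G (comp G Dᶜ v) n) :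
    (∃ w ∈ D, ∃ w' ∈ D, w ≠ w' ∧ G.Adj x w ∧ G.Adj x w') ∧
    (q = 0 → ∃ w1 w2 w3, w1 ∈ D ∧ w2 ∈ D ∧ w3 ∈ D ∧ w1 ≠ w2 ∧ w1 ≠ w3 ∧ w2 ≠ w3 ∧ G.Adj x w1 ∧ G.Adj x w2 ∧ G.Adj x w3) := by
  obtain ⟨l1, l2⟩ := leaf h hmax hac
  obtain ⟨w1, w2, w3, n12, n13, n23, a1, a2, a3⟩ := hc.deg3 h6 x
  have hx := h.left_mem
  have key : ∀ w, G.Adj x w → w ∈ D ∨ w ∈ comp G Dᶜ v := by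
    intro w ha
    by_cases hw : w ∈ D
    · exact Or.inl hw
    · exact Or.inr (comp_closed hx ha hw)
  constructor
  · rcases key w1 a1 with b1 | b1
    · rcases key w2 a2 with b2 | b2
      · exact ⟨w1, b1, w2, b2, n12, a1, a2⟩
      · rcases key w3 a3 with b3 | b3
        · exact ⟨w1, b1, w3, b3, n13, a1, a3⟩
        · exact (n23 (l2 _ b2 _ b3 a2 a3)).elim
    · rcases key w2 a2 with b2 | b2
      · rcases key w3 a3 with b3 | b3
        · exact ⟨w2, b2, w3, b3, n23, a2, a3⟩
        · exact (n13 (l2 _ b1 _ b3 a1 a3)).elim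
      · exact (n12 (l2 _ b1 _ b2 a1 a2)).elim
  · intro hq
    have key2 : ∀ w, G.Adj x w → w ∈ D := fun w ha => (key w ha).elim id (fun hw => (l1 w hw ha hq).elim)
    exact ⟨w1, w2, w3, key2 _ a1, key2 _ a2, key2 _ a3, n12, n13, n23, a1, a2, a3⟩

theorem comp_disj {W : Set V} {v v' : V} (h : v' ∉ comp G W v) : ∀ z ∈ comp G W v, z ∉ comp G W v' :=
  fun _ hz hz' => h (Rch.trans hz (Rch.symm hz'))

section
variable {k : ℕ} {c : ℤ → V}

theorem Cyc.not_chord (h : Cyc G k c) (hk : Odd k) (hmin : ∀ S n, CycIn G S n → Odd n → k ≤ n) {i : ℤ} {r : ℕ}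
    (h1 : 2 ≤ r) (h2 : r + 2 ≤ k) (ha : G.Adj (c i) (c (i + r))) : False := by
  have c1 := h.chord ha r rfl h1 (by omega)
  have c2 := h.chord (a := i + r) (b := i + k) (by rw [h.per]; exact ha.symm) (k - r) (by omega) (by omega) (by omega)
  obtain ⟨e, he⟩ := hk
  rcases Nat.even_or_odd r with ⟨f, hf⟩ | ⟨f, hf⟩
  · have := hmin _ _ c1 ⟨f, by omega⟩
    omega
  · have := hmin _ _ c2 ⟨e - f, by omega⟩
    omega

theorem Cyc.two (h : Cyc G k c) (hk : Odd k) (hmin : ∀ S n, CycIn G S n → Odd n → k ≤ n) {x : V} (hx : x ∉ Set.range c)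
    {i j : ℤ} (hij : i < j) (hji : j < i + k) (ha : G.Adj x (c i)) (ha' : G.Adj x (c j)) :
    j = i + 2 ∨ j = i + k - 2 := by
  have hp : PathIn G {x} x x 0 := PathIn.refl rfl
  have hS : ∀ z ∈ ({x} : Set V), z ∉ Set.range c := by rintro z rfl; exact hx
  have c1 := h.reroute hp hS ha ha' (j - i).toNat (by omega) (by omega) (by omega)
  have c2 := h.reroute' hp hS ha ha' (j - i).toNat (by omega) (by omega) (by omega)
  obtain ⟨e, he⟩ := hk
  rcases Nat.even_or_odd (j - i).toNat with ⟨f, hf⟩ | ⟨f, hf⟩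
  · have := hmin _ _ c2 ⟨e - f + 1, by omega⟩
    omega
  · have := hmin _ _ c1 ⟨f + 1, by omega⟩
    omega

theorem Cyc.two' (h : Cyc G k c) (hk : Odd k) (hmin : ∀ S n, CycIn G S n → Odd n → k ≤ n) {x : V} (hx : x ∉ Set.range c)
    {w w' : V} (hw : w ∈ Set.range c) (hw' : w' ∈ Set.range c) (hne : w ≠ w') (ha : G.Adj x w) (ha' : G.Adj x w') :
    ∃ i, G.Adj x (c (i - 1)) ∧ G.Adj x (c (i + 1)) := by
  obtain ⟨s, rfl⟩ := hw
  obtain ⟨s', rfl⟩ := hw'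
  obtain ⟨j, h1, h2, h3⟩ := h.window s s'
  rw [← h3] at ha' hne
  have : j ≠ s := by rintro rfl; exact hne rfl
  rcases h.two hk hmin hx (by omega) h2 ha ha' with rfl | rfl
  · refine ⟨s + 1, ?_, ?_⟩
    · rwa [add_sub_cancel_right]
    · rwa [add_assoc]
  · refine ⟨s + k - 1, ?_, ?_⟩
    · have e : s + (k:ℤ) - 1 - 1 = s + k - 2 := by omega
      rwa [e]
    · rwa [sub_add_cancel, h.per]

theorem Cyc.far (h : Cyc G k c) (hk : Odd k) {X : Set V} (hX : ConnS G X) (hXc : ∀ z ∈ X, z ∉ Set.range c)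
    {x z : V} (hx : x ∈ X) (hz : z ∈ X) {i t : ℤ} (a1 : G.Adj x (c (i - 1))) (a2 : G.Adj x (c (i + 1)))
    (a3 : G.Adj z (c t)) (h1 : i + 2 ≤ t) (h2 : t ≤ i + k - 2) : Done G := by
  obtain ⟨n, hp⟩ := hX x hx z hz
  have c1 := h.reroute hp hXc a2 a3 (t - i - 1).toNat (by omega) (by omega) (by omega)
  have c2 := h.reroute hp hXc a1 a3 (t - i + 1).toNat (by omega) (by omega) (by omega)
  have c3 := h.reroute' hp hXc a1 a3 (t - i + 1).toNat (by omega) (by omega) (by omega)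
  have c4 := h.reroute' hp hXc a2 a3 (t - i - 1).toNat (by omega) (by omega) (by omega)
  obtain ⟨e, he⟩ := hk
  rcases Nat.even_or_odd (n + 2 + (t - i - 1).toNat) with hh | ⟨f, hf⟩
  · exact Done.of c1 c2 (by omega) hh
  · exact Done.of c3 c4 (by omega) ⟨n + 1 + e - f, by omega⟩

theorem Cyc.compo [Fintype V] (hc : Cut3 G) (h6 : 6 ≤ Fintype.card V) (hom : OddMeet G) (hnd : ¬ Done G)
    (h : Cyc G k c) (hk : Odd k) (hk5 : 5 ≤ k) (hmin : ∀ S n, CycIn G S n → Odd n → k ≤ n) {v : V}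
    (hv : v ∉ Set.range c) : ∃ i : ℤ, (∃ n, Odd n ∧ CycIn G (insert (c (i - 1)) (comp G (Set.range c)ᶜ v)) n) ∧
      (∃ n, Odd n ∧ CycIn G (insert (c (i + 1)) (comp G (Set.range c)ᶜ v)) n) ∧
      ∀ z ∈ comp G (Set.range c)ᶜ v, ∀ t, G.Adj z (c t) → c t = c (i - 1) ∨ c t = c i ∨ c t = c (i + 1) := by
  set X := comp G (Set.range c)ᶜ v with hX
  have hXc : ∀ z ∈ X, z ∉ Set.range c := fun z hz => comp_sub hz
  have hconn : ConnS G X := comp_conn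
  have hac : ∀ n, ¬ CycIn G X n := fun n hn => hom _ _ _ _ h.toIn hk hn (fun z hz hz' => hXc z hz' hz)
  obtain ⟨x, y, q, hp, hmax⟩ := exists_longest (G := G) (X := X) ⟨v, comp_self hv⟩
  have hx := hp.left_mem
  have hy := hp.right_mem
  obtain ⟨⟨w, hw, w', hw', hne, a, a'⟩, hq0⟩ := leaf_out hc h6 hp hmax hac
  obtain ⟨i, b1, b2⟩ := h.two' hk hmin (hXc x hx) hw hw' hne a a'
  have hatt : ∀ z ∈ X, ∀ t, G.Adj z (c t) → c t = c (i - 1) ∨ c t = c i ∨ c t = c (i + 1) := by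
    intro z hz t ha
    obtain ⟨s, e1, e2, e3⟩ := h.window (i - 1) t
    rw [← e3] at ha ⊢
    by_contra hcon
    have n1 : s ≠ i - 1 := by rintro rfl; exact hcon (Or.inl rfl)
    have n2 : s ≠ i := by rintro rfl; exact hcon (Or.inr (Or.inl rfl))
    have n3 : s ≠ i + 1 := by rintro rfl; exact hcon (Or.inr (Or.inr rfl))
    exact hnd (h.far hk hconn hXc hx hz b1 b2 ha (by omega) (by omega))
  have nomid : ∀ z ∈ X, G.Adj z (c i) → G.Adj z (c (i + 1)) → False := by
    intro z hz h1 h2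
    have := h.two hk hmin (hXc z hz) (by omega) (by omega) h1 h2
    omega
  have nomid' : ∀ z ∈ X, G.Adj z (c i) → G.Adj z (c (i - 1)) → False := by
    intro z hz h1 h2
    have := h.two hk hmin (hXc z hz) (by omega) (by omega) h2 h1
    omega
  have hq : q ≠ 0 := by
    intro hq
    obtain ⟨w1, w2, w3, ⟨t1, rfl⟩, ⟨t2, rfl⟩, ⟨t3, rfl⟩, n12, n13, n23, a1, a2, a3⟩ := hq0 hq
    have g1 := hatt x hx t1 a1
    have g2 := hatt x hx t2 a2
    have g3 := hatt x hx t3 a3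
    have := fun hh => nomid x hx hh b2
    grind
  obtain ⟨⟨u, ⟨t1, ht1⟩, u', ⟨t2, ht2⟩, hne', f, f'⟩, -⟩ := leaf_out hc h6 hp.symm hmax hac
  rw [← ht1, ← ht2] at hne'
  rw [← ht1] at f
  rw [← ht2] at f'
  have b3 : G.Adj y (c (i - 1)) ∧ G.Adj y (c (i + 1)) := by
    have g1 := hatt y hy t1 f
    have g2 := hatt y hy t2 f'
    have m1 := nomid y hy
    have m2 := nomid' y hy
    rcases g1 with g1 | g1 | g1 <;> rcases g2 with g2 | g2 | g2 <;> rw [g1] at f hne' <;> rw [g2] at f' hne' <;> tauto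
  have odd : ∀ j, G.Adj x (c j) → G.Adj y (c j) → CycIn G (insert (c j) X) (q + 1 + 1) := by
    intro j ha ha'
    exact (PathIn.cons ha.symm hp (fun hh => hXc _ hh ⟨j, rfl⟩)).close (by omega) ha'
  have hqo : Odd q := by
    by_contra hcon
    rw [Nat.not_odd_iff_even] at hcon
    have c2 := h.reroute hp hXc b1 b3.2 2 (by push_cast; omega) (by omega) (by omega)
    exact hnd (Done.of (odd _ b1 b3.1) c2 (by omega) (by obtain ⟨e, he⟩ := hcon; exact ⟨e + 1, by omega⟩))
  have hqo' : Odd (q + 1 + 1) := by obtain ⟨e, he⟩ := hqo; exact ⟨e + 1, by omega⟩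
  exact ⟨i, ⟨_, hqo', odd _ b1 b3.1⟩, ⟨_, hqo', odd _ b2 b3.2⟩, hatt⟩

theorem case3big [Fintype V] (hc : Cut3 G) (h6 : 6 ≤ Fintype.card V) (hom : OddMeet G)
    (h : Cyc G k c) (hk : Odd k) (hk5 : 5 ≤ k) (hmin : ∀ S n, CycIn G S n → Odd n → k ≤ n) : Done G := by
  by_contra hnd
  have hex : ∀ i, Exit G c i := by
    intro i
    rcases h.exit_or_chord hc h6 i with hh | ⟨r, h1, h2, h3⟩
    · exact hh
    · exact (h.not_chord hk hmin h1 h2 h3).elim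
  obtain ⟨v, hv, -⟩ := hex 0
  obtain ⟨i, -, ⟨n, hn, cy⟩, hatt⟩ := h.compo hc h6 hom hnd hk hk5 hmin hv
  obtain ⟨v', hv', ha⟩ := hex (i + 2)
  obtain ⟨i', ⟨n1, hn1, cy1⟩, ⟨n2, hn2, cy2⟩, hatt'⟩ := h.compo hc h6 hom hnd hk hk5 hmin hv'
  have hnot : v' ∉ comp G (Set.range c)ᶜ v := by
    intro hh
    rcases hatt v' hh _ ha.symm with e | e | e
    · exact h.inj (i - 1) (i + 2) (by omega) (by omega) e.symm
    · exact h.inj (i) (i + 2) (by omega) (by omega) e.symm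
    · exact h.inj (i + 1) (i + 2) (by omega) (by omega) e.symm
  have hd := comp_disj hnot
  have key : ∀ j m, CycIn G (insert (c j) (comp G (Set.range c)ᶜ v')) m → c (i + 1) ≠ c j → False := by
    intro j m hm hne
    refine hom _ _ _ _ cy hn hm ?_
    rintro z (rfl | hz) (hz' | hz')
    · exact hne hz'
    · exact comp_sub hz' ⟨_, rfl⟩
    · subst hz'; exact comp_sub hz ⟨_, rfl⟩
    · exact hd z hz hz'
  by_cases he : c (i + 1) = c (i' + 1)
  · refine key _ _ cy1 ?_
    rw [he]
    exact (h.inj (i' - 1) (i' + 1) (by omega) (by omega)).symm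
  · exact key _ _ cy2 he

end
end CE
end

section
namespace CE
variable {V : Type*} {G : SimpleGraph V}

structure Dia (G : SimpleGraph V) (x a c b : V) : Prop where
  xa : G.Adj x a
  xb : G.Adj x b
  ab : G.Adj a b
  ac : G.Adj a c
  bc : G.Adj b c
  xc : x ≠ c

theorem path2 {S : Set V} {a b c : V} (h1 : G.Adj a b) (h2 : G.Adj b c) (hac : a ≠ c) (ha : a ∈ S) (hb : b ∈ S)
    (hc : c ∈ S) : PathIn G S a c 2 := by
  have p0 : PathIn G {c} c c 0 := PathIn.refl rfl
  have p1 := PathIn.cons h2 p0 (by simp [h2.ne])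
  have p2 := PathIn.cons h1 p1 (by simp [h1.ne, hac])
  refine p2.mono ?_
  rintro z (rfl | rfl | rfl) <;> assumption

theorem path3 {S : Set V} {a b c d : V} (h1 : G.Adj a b) (h2 : G.Adj b c) (h3 : G.Adj c d) (hac : a ≠ c) (had : a ≠ d)
    (hbd : b ≠ d) (ha : a ∈ S) (hb : b ∈ S) (hc : c ∈ S) (hd : d ∈ S) : PathIn G S a d 3 := by
  have p0 : PathIn G {d} d d 0 := PathIn.refl rfl
  have p1 := PathIn.cons h3 p0 (by simp [h3.ne])
  have p2 := PathIn.cons h2 p1 (by simp [h2.ne, hbd])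
  have p3 := PathIn.cons h1 p2 (by simp [h1.ne, hac, had])
  refine p3.mono ?_
  rintro z (rfl | rfl | rfl | rfl) <;> assumption

namespace Dia
variable {x a c b : V}

theorem four (h : Dia G x a c b) : CycIn G Set.univ 4 := cyc4 h.xa h.ac h.bc.symm h.xb.symm h.xc h.ab.ne

theorem two (h : Dia G x a c b) {d d' : V} (hd : d ∈ ({x, a, c, b} : Set V)) (hd' : d' ∈ ({x, a, c, b} : Set V))
    (hne : d ≠ d') : PathIn G {x, a, c, b} d d' 2 := by
  have p1 : PathIn G {x, a, c, b} x a 2 := path2 h.xb h.ab.symm h.xa.ne (by simp) (by simp) (by simp)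
  have p2 : PathIn G {x, a, c, b} x c 2 := path2 h.xa h.ac h.xc (by simp) (by simp) (by simp)
  have p3 : PathIn G {x, a, c, b} x b 2 := path2 h.xa h.ab h.xb.ne (by simp) (by simp) (by simp)
  have p4 : PathIn G {x, a, c, b} a c 2 := path2 h.ab h.bc h.ac.ne (by simp) (by simp) (by simp)
  have p5 : PathIn G {x, a, c, b} a b 2 := path2 h.xa.symm h.xb h.ab.ne (by simp) (by simp) (by simp)
  have p6 : PathIn G {x, a, c, b} c b 2 := path2 h.ac.symm h.ab h.bc.ne' (by simp) (by simp) (by simp)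
  rcases hd with rfl | rfl | rfl | rfl <;> rcases hd' with rfl | rfl | rfl | rfl <;>
    first
      | exact (hne rfl).elim
      | assumption
      | exact PathIn.symm ‹_›

theorem cons13 (h : Dia G x a c b) {d d' : V} (hd : d = x ∨ d = c) (hd' : d' = a ∨ d' = b) :
    PathIn G {x, a, c, b} d d' 1 ∧ PathIn G {x, a, c, b} d d' 3 := by
  rcases hd with rfl | rfl <;> rcases hd' with rfl | rfl
  · exact ⟨PathIn.edge h.xa (by simp) (by simp),
      path3 h.xb h.bc h.ac.symm h.xc h.xa.ne h.ab.ne' (by simp) (by simp) (by simp) (by simp)⟩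
  · exact ⟨PathIn.edge h.xb (by simp) (by simp),
      path3 h.xa h.ac h.bc.symm h.xc h.xb.ne h.ab.ne (by simp) (by simp) (by simp) (by simp)⟩
  · exact ⟨PathIn.edge h.ac.symm (by simp) (by simp),
      path3 h.bc.symm h.xb.symm h.xa h.xc.symm h.ac.ne' h.ab.ne' (by simp) (by simp) (by simp) (by simp)⟩
  · exact ⟨PathIn.edge h.bc.symm (by simp) (by simp),
      path3 h.ac.symm h.xa.symm h.xb h.xc.symm h.bc.ne' h.ab.ne (by simp) (by simp) (by simp) (by simp)⟩

theorem colour_eq (h : Dia G x a c b) (hnd : ¬ Done G) {Z : Set V} (hZ : ∀ z ∈ Z, z ∉ ({x, a, c, b} : Set V)) {col : V → Bool}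
    (hcol : ∀ x ∈ Z, ∀ y ∈ Z, ∃ n, PathIn G Z x y n ∧ (Even n ↔ col x = col y)) {z z' d d' : V} (hz : z ∈ Z)
    (hz' : z' ∈ Z) (ha : G.Adj z d) (ha' : G.Adj z' d') (hd : d = x ∨ d = c) (hd' : d' = a ∨ d' = b) : col z = col z' := by
  by_contra hne
  obtain ⟨n, hn, he⟩ := hcol z hz z' hz'
  obtain ⟨p1, p3⟩ := h.cons13 hd hd'
  have c1 := CycIn.out hn p1 hZ ha ha' (by omega) rfl
  have c3 := CycIn.out hn p3 hZ ha ha' (by omega) rfl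
  have hodd : Odd n := by rw [← Nat.not_even_iff_odd, he]; exact hne
  obtain ⟨e, he⟩ := hodd
  exact hnd (Done.of c1 c3 rfl ⟨e + 2, by omega⟩)

theorem caseA [Fintype V] (h : Dia G x a c b) (hc : Cut3 G) (h6 : 6 ≤ Fintype.card V)
    (hac : ∀ n, ¬ CycIn G ({x, a, c, b} : Set V)ᶜ n) {v v' : V} (hv : v ∉ ({x, a, c, b} : Set V))
    (hv' : v' ∉ ({x, a, c, b} : Set V)) (hvv : G.Adj v v') : Done G := by
  classical
  by_contra hnd
  set D : Set V := {x, a, c, b} with hD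
  set Z := comp G Dᶜ v with hZdef
  have hZ : ∀ z ∈ Z, z ∉ D := fun z hz => comp_sub hz
  have hZc : ConnS G Z := comp_conn
  have hacZ : ∀ n, ¬ CycIn G Z n := fun n hn => hac n (hn.mono comp_sub)
  have hvZ : v ∈ Z := comp_self hv
  have hvZ' : v' ∈ Z := comp_closed hvZ hvv hv'
  obtain ⟨col, hcol⟩ := hZc.colour
  have proper : ∀ u ∈ Z, ∀ u' ∈ Z, G.Adj u u' → col u ≠ col u' := by
    intro u hu u' hu' ha
    obtain ⟨n, hn, he⟩ := hcol u hu u' hu'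
    intro hh
    have := he.2 hh
    have h0 : n ≠ 0 := by
      rintro rfl
      exact ha.ne hn.zero_eq
    have h1 : n ≠ 1 := by rintro rfl; exact absurd this (by decide)
    exact hacZ _ (hn.close (by omega) ha.symm)
  have hxZ : x ∉ Z := fun hh => hZ _ hh (by simp [hD])
  have haZ : a ∉ Z := fun hh => hZ _ hh (by simp [hD])
  have hcZ : c ∉ Z := fun hh => hZ _ hh (by simp [hD])
  have hout : ∀ u ∈ Z, ∀ w, w ∉ Z → G.Adj u w → w ∈ D := by
    intro u hu w hw ha
    by_contra hh
    exact hw (comp_closed hu ha hh)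
  obtain ⟨u1, g1, u2, g2, u3, g3, w1, w2, w3, f1, f2, f3, n12, n13, n23, a1, a2, a3⟩ :=
    hc.att3 hvZ hxZ haZ hcZ h.xa.ne h.xc h.ac.ne
  have k1 := hout _ g1 _ f1 a1
  have k2 := hout _ g2 _ f2 a2
  have k3 := hout _ g3 _ f3 a3
  have side : ∀ w ∈ D, (w = x ∨ w = c) ∨ (w = a ∨ w = b) := by
    rintro w (rfl | rfl | rfl | rfl) <;> simp
  have hs1 : ∃ u ∈ Z, ∃ w, G.Adj u w ∧ (w = x ∨ w = c) := by
    rcases side _ k1 with s1 | s1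
    · exact ⟨u1, g1, w1, a1, s1⟩
    · rcases side _ k2 with s2 | s2
      · exact ⟨u2, g2, w2, a2, s2⟩
      · rcases side _ k3 with s3 | s3
        · exact ⟨u3, g3, w3, a3, s3⟩
        · grind
  have hs2 : ∃ u ∈ Z, ∃ w, G.Adj u w ∧ (w = a ∨ w = b) := by
    rcases side _ k1 with s1 | s1
    · rcases side _ k2 with s2 | s2
      · rcases side _ k3 with s3 | s3
        · grind
        · exact ⟨u3, g3, w3, a3, s3⟩
      · exact ⟨u2, g2, w2, a2, s2⟩
    · exact ⟨u1, g1, w1, a1, s1⟩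
  obtain ⟨e1, he1, d1, b1, m1⟩ := hs1
  obtain ⟨e2, he2, d2, b2, m2⟩ := hs2
  have e12 := h.colour_eq hnd hZ hcol he1 he2 b1 b2 m1 m2
  have same : ∀ u ∈ Z, ∀ w ∈ D, G.Adj u w → col u = col e1 := by
    intro u hu w hw ha
    rcases side w hw with s | s
    · exact (h.colour_eq hnd hZ hcol hu he2 ha b2 s m2).trans e12.symm
    · exact (h.colour_eq hnd hZ hcol he1 hu b1 ha m1 s).symm
  obtain ⟨p0, y, q, hp, hmax⟩ := exists_longest (G := G) (X := Z) ⟨v, hvZ⟩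
  have hq1 := hmax _ _ _ (PathIn.edge hvv hvZ hvZ')
  obtain ⟨⟨r1, hr1, r2, hr2, rne, ar1, ar2⟩, -⟩ := leaf_out hc h6 hp hmax hacZ
  obtain ⟨⟨t1, ht1, -, -, -, at1, -⟩, -⟩ := leaf_out hc h6 hp.symm hmax hacZ
  have hp0Z := hp.left_mem
  have hyZ := hp.right_mem
  have cp0 := same _ hp0Z _ hr1 ar1
  have cy := same _ hyZ _ ht1 at1
  obtain ⟨q, rfl⟩ : ∃ q', q = q' + 1 := ⟨q - 1, by omega⟩
  obtain ⟨p1, ap, hp1⟩ := hp.strip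
  have hp1Z := hp1.left_mem.1
  have hcp : col p0 ≠ col p1 := proper _ hp0Z _ hp1Z ap
  have hq0 : q ≠ 0 := by
    rintro rfl
    have := hp1.zero_eq
    subst this
    exact hcp (cp0.trans cy.symm)
  obtain ⟨q, rfl⟩ : ∃ q', q = q' + 1 := ⟨q - 1, by omega⟩
  obtain ⟨p2, ap2, hp2⟩ := hp1.strip
  obtain ⟨r, har, rn0, rn2⟩ := hc.deg h6 p1 p0 p2
  have hrZ : r ∈ Z := by
    by_contra hh
    exact hcp (cp0.trans (same _ hp1Z _ (hout _ hp1Z _ hh har) har).symm)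
  obtain ⟨p, hpp, hpl, hps⟩ := hp2
  have hrp : r ∉ p.support := by
    intro hr
    obtain ⟨n, hn⟩ : Rch G (Z \ {p1}) p2 r := Rch.of_walk (p.takeUntil r hr) (fun z hz => by
      have := hps z (p.support_takeUntil_subset_support hr hz)
      exact ⟨this.1.1, this.2⟩)
    have hn0 : n ≠ 0 := by
      rintro rfl
      exact rn2 hn.zero_eq.symm
    have := (PathIn.cons ap2 hn (by simp)).close (by omega) har.symm
    refine hacZ _ (this.mono ?_)
    rintro z (rfl | hz)
    · exact hp1Z
    · exact hz.1
  have hS : PathIn G {z | z ∈ p.support} p2 y q := ⟨p, hpp, hpl, fun z hz => hz⟩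
  have hS1 := PathIn.cons ap2 hS (fun hh => (hps _ hh).2 rfl)
  have hS2 := PathIn.cons har.symm hS1 (by
    rintro (hh | hh)
    · exact har.ne hh.symm
    · exact hrp hh)
  have hS3 : PathIn G Z r y (q + 1 + 1) := hS2.mono (by
    rintro z (rfl | rfl | hz)
    · exact hrZ
    · exact hp1Z
    · exact (hps z hz).1.1)
  obtain ⟨⟨s1, hs1, s2, hs2, sne, as1, as2⟩, -⟩ := leaf_out hc h6 hS3 hmax hacZ
  have fin : ∀ d ∈ D, ∀ d' ∈ D, d ≠ d' → G.Adj p0 d → G.Adj r d' → False := by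
    intro d hd d' hd' hne ha ha'
    have pp : PathIn G Z p0 r 2 := path2 ap har rn0.symm hp0Z hp1Z hrZ
    have c6 := CycIn.out pp (h.two hd hd' hne) hZ ha ha' (by omega) rfl
    exact hnd (done46 h.four (c6.mono (Set.subset_univ _)))
  by_cases hh : r1 = s1
  · exact fin _ hr1 _ hs2 (by rw [hh]; exact sne) ar1 as2
  · exact fin _ hr1 _ hs1 hh ar1 as1

theorem pairs (h : Dia G x a c b) {z z' u v u' v' : V} (hn : [z, u, u', z', v', v].Nodup) (a1 : G.Adj z u) (a2 : G.Adj z v)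
    (a3 : G.Adj z' u') (a4 : G.Adj z' v') (a5 : G.Adj u u') (a6 : G.Adj v v') : Done G :=
  done46 h.four (cyc6 a1 a5 a3.symm a4 a6.symm a2.symm hn)

set_option maxHeartbeats 1000000 in
theorem caseB [Fintype V] (h : Dia G x a c b) (hc : Cut3 G) (h6 : 6 ≤ Fintype.card V)
    (hno : ∀ v v', v ∉ ({x, a, c, b} : Set V) → v' ∉ ({x, a, c, b} : Set V) → ¬ G.Adj v v') : Done G := by
  obtain ⟨z, hz⟩ := exists_not_mem_list [x, a, c, b] (by simp; omega)
  obtain ⟨z', hz'⟩ := exists_not_mem_list [z, x, a, c, b] (by simp; omega)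
  simp only [List.mem_cons, List.not_mem_nil, or_false, not_or] at hz hz'
  obtain ⟨y1, y2, y3, y4⟩ := hz
  obtain ⟨y0, y5, y6, y7, y8⟩ := hz'
  have key : ∀ z, z ≠ x → z ≠ a → z ≠ c → z ≠ b → (G.Adj z a ∧ G.Adj z c ∧ G.Adj z b) ∨ (G.Adj z x ∧ G.Adj z c ∧ G.Adj z b) ∨
      (G.Adj z x ∧ G.Adj z a ∧ G.Adj z b) ∨ (G.Adj z x ∧ G.Adj z a ∧ G.Adj z c) := by
    intro z h1 h2 h3 h4
    obtain ⟨w1, w2, w3, n12, n13, n23, a1, a2, a3⟩ := hc.deg3 h6 z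
    have hin : ∀ w, G.Adj z w → w = x ∨ w = a ∨ w = c ∨ w = b := by
      intro w ha
      by_contra hw
      exact hno z w (by simp [h1, h2, h3, h4]) (by simpa using hw) ha
    rcases hin _ a1 with rfl | rfl | rfl | rfl <;> rcases hin _ a2 with rfl | rfl | rfl | rfl <;>
      first
        | exact (n12 rfl).elim
        | (rcases hin _ a3 with rfl | rfl | rfl | rfl <;>
            first
              | exact (n13 rfl).elim
              | exact (n23 rfl).elim
              | tauto)
  have xa := h.xa
  have xb := h.xb
  have ab := h.ab
  have ac := h.ac
  have bc := h.bc
  have xc := h.xc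
  have nxa := xa.ne
  have nxb := xb.ne
  have nab := ab.ne
  have nac := ac.ne
  have nbc := bc.ne
  have P1 := h.pairs (z := z) (z' := z') (u := x) (v := a) (u' := b) (v' := c) (by simp; grind)
  have P2 := h.pairs (z := z) (z' := z') (u := x) (v := b) (u' := a) (v' := c) (by simp; grind)
  have P3 := h.pairs (z := z) (z' := z') (u := a) (v := b) (u' := x) (v' := c) (by simp; grind)
  have P4 := h.pairs (z := z') (z' := z) (u := x) (v := a) (u' := b) (v' := c) (by simp; grind)
  have P5 := h.pairs (z := z') (z' := z) (u := x) (v := b) (u' := a) (v' := c) (by simp; grind)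
  have P6 := h.pairs (z := z') (z' := z) (u := a) (v := b) (u' := x) (v' := c) (by simp; grind)
  have Q1 : G.Adj z a ∧ G.Adj z c ∧ G.Adj z b → G.Adj z' a ∧ G.Adj z' c ∧ G.Adj z' b → Done G := fun e f =>
    done46 h.four (cyc6 e.2.1 f.2.1.symm f.1 xa.symm xb e.2.2.symm (by simp; grind))
  have Q2 : G.Adj z x ∧ G.Adj z c ∧ G.Adj z b → G.Adj z' x ∧ G.Adj z' c ∧ G.Adj z' b → Done G := fun e f =>
    done46 h.four (cyc6 e.1 xa ac f.2.1.symm f.2.2 e.2.2.symm (by simp; grind))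
  have Q3 : G.Adj z x ∧ G.Adj z a ∧ G.Adj z b → G.Adj z' x ∧ G.Adj z' a ∧ G.Adj z' b → Done G := fun e f =>
    done46 h.four (cyc6 e.1 f.1.symm f.2.1 ac bc.symm e.2.2.symm (by simp; grind))
  have Q4 : G.Adj z x ∧ G.Adj z a ∧ G.Adj z c → G.Adj z' x ∧ G.Adj z' a ∧ G.Adj z' c → Done G := fun e f =>
    done46 h.four (cyc6 e.1 xb bc f.2.2.symm f.2.1 e.2.1.symm (by simp; grind))
  have kz := key z y1 y2 y3 y4
  have kz' := key z' y5 y6 y7 y8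
  rcases kz with kz | kz | kz | kz <;> rcases kz' with kz' | kz' | kz' | kz' <;>
    first
      | exact Q1 kz kz'
      | exact Q2 kz kz'
      | exact Q3 kz kz'
      | exact Q4 kz kz'
      | (obtain ⟨k1, k2, k3⟩ := kz
         obtain ⟨l1, l2, l3⟩ := kz'
         first
          | exact P1 ‹_› ‹_› ‹_› ‹_› xb ac
          | exact P2 ‹_› ‹_› ‹_› ‹_› xa bc
          | exact P3 ‹_› ‹_› ‹_› ‹_› xa.symm bc
          | exact P4 ‹_› ‹_› ‹_› ‹_› xb ac
          | exact P5 ‹_› ‹_› ‹_› ‹_› xa bc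
          | exact P6 ‹_› ‹_› ‹_› ‹_› xa.symm bc)

end Dia

theorem case3small [Fintype V] (hc : Cut3 G) (h6 : 6 ≤ Fintype.card V) (hom : OddMeet G) {c : ℤ → V}
    (h : Cyc G 3 c) : Done G := by
  obtain ⟨v, hv⟩ := exists_not_mem_list [c 0, c 1, c 2] (by simp; omega)
  simp only [List.mem_cons, List.not_mem_nil, or_false, not_or] at hv
  have hv' : v ∉ Set.range c := by
    rintro ⟨i, rfl⟩
    obtain ⟨t, e1, e2, e3⟩ := h.window 0 i
    have : t = 0 ∨ t = 1 ∨ t = 2 := by push_cast at e2; omega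
    rw [← e3] at hv
    rcases this with rfl | rfl | rfl <;> tauto
  have hac : ∀ n, ¬ CycIn G (Set.range c)ᶜ n := fun n hn => hom _ _ _ _ h.toIn (by decide) hn (fun z hz hz' => hz' hz)
  obtain ⟨x, y, q, hp, hmax⟩ := exists_longest (G := G) (X := comp G (Set.range c)ᶜ v) ⟨v, comp_self hv'⟩
  obtain ⟨⟨a, ⟨s, hs⟩, b, ⟨s', hs'⟩, hne, xa, xb⟩, -⟩ := leaf_out hc h6 hp hmax (fun n hn => hac n (hn.mono comp_sub))
  have hx : x ∉ Set.range c := comp_sub hp.left_mem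
  obtain ⟨j, e1, e2, e3⟩ := h.window s s'
  have h01 := h.adj s
  have h12 := h.adj (s + 1)
  have h20 := h.adj (s + 2)
  have er : s + 1 + 1 = s + 2 := by omega
  rw [er] at h12
  have er' : s + 2 + 1 = s + (3 : ℕ) := by push_cast; omega
  rw [er', h.per] at h20
  have hcov : ∀ i, c i = c s ∨ c i = c (s + 1) ∨ c i = c (s + 2) := by
    intro i
    obtain ⟨t, f1, f2, f3⟩ := h.window s i
    have : t = s ∨ t = s + 1 ∨ t = s + 2 := by push_cast at f2; omega
    rw [← f3]
    rcases this with rfl | rfl | rfl <;> simp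
  have hj : j = s ∨ j = s + 1 ∨ j = s + 2 := by push_cast at e2; omega
  have key : ∃ d, Dia G x a d b ∧ ∀ i, c i ∈ ({x, a, d, b} : Set V) := by
    rcases hj with rfl | rfl | rfl
    · exact (hne (by rw [← hs, ← hs', e3])).elim
    · refine ⟨c (s + 2), ⟨xa, xb, ?_, ?_, ?_, fun hh => hx ⟨_, hh.symm⟩⟩, ?_⟩
      · rw [← hs, ← hs', ← e3]; exact h01
      · rw [← hs]; exact h20.symm
      · rw [← hs', ← e3]; exact h12
      · intro i
        rw [← hs, ← hs', ← e3]
        rcases hcov i with hh | hh | hh <;> simp [hh]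
    · refine ⟨c (s + 1), ⟨xa, xb, ?_, ?_, ?_, fun hh => hx ⟨_, hh.symm⟩⟩, ?_⟩
      · rw [← hs, ← hs', ← e3]; exact h20.symm
      · rw [← hs]; exact h01
      · rw [← hs', ← e3]; exact h12.symm
      · intro i
        rw [← hs, ← hs', ← e3]
        rcases hcov i with hh | hh | hh <;> simp [hh]
  obtain ⟨d, hD, hsub⟩ := key
  have hacD : ∀ n, ¬ CycIn G ({x, a, d, b} : Set V)ᶜ n := fun n hn => hac n (hn.mono (by
    rintro z hz ⟨i, rfl⟩
    exact hz (hsub i)))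
  by_cases hA : ∃ v v', v ∉ ({x, a, d, b} : Set V) ∧ v' ∉ ({x, a, d, b} : Set V) ∧ G.Adj v v'
  · obtain ⟨v, v', h1, h2, h3⟩ := hA
    exact hD.caseA hc h6 hacD h1 h2 h3
  · exact hD.caseB hc h6 (fun v v' h1 h2 h3 => hA ⟨v, v', h1, h2, h3⟩)

theorem main [Fintype V] (hc : Cut3 G) (h6 : 6 ≤ Fintype.card V) : Done G := by
  classical
  by_contra hnd
  have hno : NoOE G := by
    rintro S T n n' ⟨d, hd, hdS⟩ hn hT ⟨m, rfl⟩ hdis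
    rw [← two_mul] at hT
    refine hnd (case1 hc h6 hd hn (hT.mono (T := (Set.range d)ᶜ) ?_))
    rintro z hz ⟨i, rfl⟩
    exact hdis _ (hdS i) hz
  have hom : OddMeet G := by
    intro S T n n' hS hn hT hdis
    rcases Nat.even_or_odd n' with hn' | hn'
    · exact hno _ _ _ _ hS hn hT hn' hdis
    · obtain ⟨c, hcc, hcS⟩ := hS
      obtain ⟨d, hdc, hdT⟩ := hT
      have hp : OPair G n n' c d := ⟨hcc, hdc, hn, hn', fun i j e => hdis _ (hcS i) (e ▸ hdT j)⟩
      exact hnd (hp.done hc h6 hno)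
  have hex : ∃ n, Odd n ∧ CycIn G Set.univ n := by
    by_contra hcon
    push Not at hcon
    refine hnd (case0 hc h6 (fun S n hn => ?_))
    by_contra he
    exact hcon n (Nat.not_even_iff_odd.1 he) (hn.mono (Set.subset_univ _))
  have hmin : ∀ S n, CycIn G S n → Odd n → Nat.find hex ≤ n := fun S n h1 h2 =>
    Nat.find_min' hex ⟨h2, h1.mono (Set.subset_univ _)⟩
  obtain ⟨hk, c, hcc, -⟩ := Nat.find_spec hex
  generalize Nat.find hex = k at *
  by_cases h3 : k = 3
  · subst h3
    exact hnd (case3small hc h6 hom hcc)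
  · have := hcc.three
    refine hnd (case3big hc h6 hom hcc hk ?_ hmin)
    obtain ⟨e, he⟩ := hk
    omega

end CE
end

/-- Every 3-connected graph with at least 6 vertices contains two cycles of
consecutive even lengths. -/
theorem stmt_1 {V : Type*} [Fintype V] (G : SimpleGraph V)
    (h3 : KConnected 3 G) (h6 : 6 ≤ Fintype.card V) :
    HasTwoConsecEvenCycles G := by
  obtain ⟨m, ha, hb⟩ := CE.main (CE.cut3_of_conn h3.2) h6
  have hm : 0 < m := by
    obtain ⟨c, hc, -⟩ := ha
    have := hc.three
    omega
  obtain ⟨u, p, hp, hpl⟩ := ha.exists_walk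
  obtain ⟨v, q, hq, hql⟩ := hb.exists_walk
  exact ⟨u, v, p, q, m, hp, hq, hm, hpl, hql⟩
end

section
/- Let G be a graph with distinct vertices x, y such that G+xy is 2-connected, every vertex other than x and y has degree at least 3 in G, and every edge uv of G with {u,v} disjoint from {x,y} satisfies deg(u)+deg(v) ≥ 7. Then G-xy contains two paths from x to y whose lengths differ by exactly two. -/
open SimpleGraph

universe uu

/-- Working hypotheses: `x`, `y` nonadjacent, every nonempty set avoiding `x,y` has at least two
outer neighbours, and the degree conditions. -/
structure GoodTriple {V : Type uu} (G : SimpleGraph V) (x y : V) : Prop where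
  ne : x ≠ y
  nadj : ¬ G.Adj x y
  ex : ∃ z, z ≠ x ∧ z ≠ y
  conn : ∀ U : Set V, U.Nonempty → x ∉ U → y ∉ U → ∀ v, v ∉ U →
    ∃ u ∈ U, ∃ w, w ∉ U ∧ w ≠ v ∧ G.Adj u w
  deg : ∀ v : V, v ≠ x → v ≠ y → 3 ≤ {w : V | G.Adj v w}.ncard
  sum : ∀ u v : V, G.Adj u v → u ≠ x → u ≠ y → v ≠ x → v ≠ y →
      7 ≤ {w : V | G.Adj u w}.ncard + {w : V | G.Adj v w}.ncard

def TwoPaths {V : Type uu} (G : SimpleGraph V) (x y : V) : Prop :=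
  ∃ p q : G.Walk x y, p.IsPath ∧ q.IsPath ∧ q.length = p.length + 2

theorem GoodTriple.symm {V : Type uu} {G : SimpleGraph V} {x y : V} (h : GoodTriple G x y) :
    GoodTriple G y x where
  ne := h.ne.symm
  nadj := fun h' => h.nadj h'.symm
  ex := by obtain ⟨z, h1, h2⟩ := h.ex; exact ⟨z, h2, h1⟩
  conn := fun U hU hy hx v hv => h.conn U hU hx hy v hv
  deg := fun v h1 h2 => h.deg v h2 h1
  sum := fun u v ha h1 h2 h3 h4 => h.sum u v ha h2 h1 h4 h3

theorem TwoPaths.symm {V : Type uu} {G : SimpleGraph V} {x y : V} (h : TwoPaths G x y) :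
    TwoPaths G y x := by
  obtain ⟨p, q, hp, hq, hl⟩ := h
  exact ⟨p.reverse, q.reverse, hp.reverse, hq.reverse, by simpa using hl⟩

theorem isPath_append_of {V : Type uu} {G : SimpleGraph V} {u v w : V} (p : G.Walk u v)
    (q : G.Walk v w) (hp : p.IsPath) (hq : q.IsPath)
    (h : ∀ z ∈ p.support, z ∈ q.support → z = v) : (p.append q).IsPath := by
  induction p with
  | nil => simpa using hq
  | cons hadj p ih =>
    rw [Walk.cons_isPath_iff] at hp
    rw [Walk.cons_append, Walk.cons_isPath_iff]
    refine ⟨ih q hp.1 hq (fun z hz => h z (by simp [hz])), ?_⟩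
    rw [Walk.mem_support_append_iff]
    rintro (h1 | h1)
    · exact hp.2 h1
    · have := h _ (by simp) h1
      exact hp.2 (this ▸ p.end_mem_support)

/-- component of `a` in `G - Z` -/
def compAvoid {V : Type uu} (G : SimpleGraph V) (Z : Set V) (a : V) : Set V :=
  {u | ∃ p : G.Walk a u, p.IsPath ∧ ∀ z ∈ p.support, z ∉ Z}

theorem compAvoid_self {V : Type uu} {G : SimpleGraph V} {Z : Set V} {a : V} (ha : a ∉ Z) :
    a ∈ compAvoid G Z a := ⟨Walk.nil, by simp, by simpa using ha⟩

theorem compAvoid_notMem {V : Type uu} {G : SimpleGraph V} {Z : Set V} {a u : V}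
    (h : u ∈ compAvoid G Z a) : u ∉ Z := by
  obtain ⟨p, -, hp⟩ := h
  exact hp _ p.end_mem_support

theorem compAvoid_closed {V : Type uu} {G : SimpleGraph V} {Z : Set V} {a u w : V}
    (h : u ∈ compAvoid G Z a) (hadj : G.Adj u w) (hw : w ∉ Z) : w ∈ compAvoid G Z a := by
  classical
  obtain ⟨p, -, hp⟩ := h
  refine ⟨(p.concat hadj).bypass, Walk.bypass_isPath _, fun z hz => ?_⟩
  have := Walk.support_bypass_subset _ hz
  rw [Walk.support_concat] at this
  simp only [List.concat_eq_append, List.mem_append, List.mem_singleton] at this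
  rcases this with h | h
  · exact hp z h
  · exact h ▸ hw

theorem walk_in_compAvoid {V : Type uu} {G : SimpleGraph V} {Z : Set V} {a b u : V}
    (p : G.Walk b u) (hb : b ∈ compAvoid G Z a) (hp : ∀ z ∈ p.support, z ∉ Z) :
    ∀ z ∈ p.support, z ∈ compAvoid G Z a := by
  induction p with
  | nil => simpa using hb
  | cons hadj p ih =>
    intro z hz
    rw [Walk.support_cons, List.mem_cons] at hz
    rcases hz with rfl | hz
    · exact hb
    · exact ih (compAvoid_closed hb hadj (hp _ (by simp))) (fun z hz => hp z (by simp [hz])) z hz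

theorem walk_crosses {V : Type uu} {G : SimpleGraph V} {a b : V} (p : G.Walk a b) (U : Set V)
    (ha : a ∈ U) (hb : b ∉ U) : ∃ u ∈ p.support, ∃ w ∈ p.support, u ∈ U ∧ w ∉ U ∧ G.Adj u w := by
  induction p with
  | nil => exact absurd ha hb
  | @cons a c b hadj p ih =>
    by_cases hc : c ∈ U
    · obtain ⟨u, hu, w, hw, h⟩ := ih hc hb
      exact ⟨u, by simp [hu], w, by simp [hw], h⟩
    · exact ⟨a, by simp, c, by simp, ha, hc, hadj⟩

theorem compAvoid_conn {V : Type uu} {G : SimpleGraph V} {Z : Set V} {a : V} (haZ : a ∉ Z)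
    (U : Set V)
    (hU : U ⊆ compAvoid G Z a) (hne : U.Nonempty) (hne' : U ≠ compAvoid G Z a) :
    ∃ u ∈ U, ∃ w ∈ compAvoid G Z a, w ∉ U ∧ G.Adj u w := by
  obtain ⟨b, hb, hbU⟩ : ∃ b ∈ compAvoid G Z a, b ∉ U := by
    by_contra! hcon
    exact hne' (Set.Subset.antisymm hU hcon)
  obtain ⟨c, hc⟩ := hne
  obtain ⟨p, hp, hpZ⟩ := hb
  obtain ⟨q, hq, hqZ⟩ := hU hc
  have hr : ∀ z ∈ (q.reverse.append p).support, z ∉ Z := by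
    intro z hz
    rw [Walk.mem_support_append_iff] at hz
    rcases hz with hz | hz
    · exact hqZ z (by simpa using hz)
    · exact hpZ z hz
  obtain ⟨u, hu, w, hw, huU, hwU, hadj⟩ := walk_crosses (q.reverse.append p) U hc hbU
  exact ⟨u, huU, w, walk_in_compAvoid _ (hU hc) hr w hw, hwU, hadj⟩

/-- The graph on `D` plus two vertices obtained by contracting `S` and `T`. -/
def redGraph {V : Type uu} (G : SimpleGraph V) (D S T : Set V) : SimpleGraph (D ⊕ Bool) where
  Adj a b := match a, b with
    | .inl u, .inl v => G.Adj u v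
    | .inl u, .inr false => ∃ s ∈ S, G.Adj u s
    | .inl u, .inr true => ∃ s ∈ T, G.Adj u s
    | .inr false, .inl u => ∃ s ∈ S, G.Adj u s
    | .inr true, .inl u => ∃ s ∈ T, G.Adj u s
    | .inr _, .inr _ => False
  symm := ⟨by
    rintro (u | (_ | _)) (v | (_ | _)) h
    · exact SimpleGraph.Adj.symm (G := G) h
    all_goals exact h⟩
  loopless := ⟨by
    rintro (u | (_ | _)) h
    · exact G.loopless.irrefl _ h
    all_goals exact h⟩

theorem red_lift {V : Type uu} {G : SimpleGraph V} {D S T : Set V} (hTD : ∀ t ∈ T, t ∉ D)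
    {a b : D ⊕ Bool} (p : (redGraph G D S T).Walk a b) (hp : p.IsPath)
    (hs : Sum.inr false ∉ p.support) (hb : b = Sum.inr true) :
    ∀ d : D, a = Sum.inl d → ∃ t ∈ T, ∃ q : G.Walk d t, q.IsPath ∧ q.length = p.length ∧
      ∀ z ∈ q.support, z = t ∨ ∃ hz : z ∈ D, Sum.inl ⟨z, hz⟩ ∈ p.support := by
  induction p with
  | nil => rintro d rfl; simp at hb
  | @cons a c b hadj p ih =>
    rintro d rfl
    subst hb
    rw [Walk.cons_isPath_iff] at hp
    rcases c with c | (_ | _)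
    · obtain ⟨t, ht, q, hq, hl, hsup⟩ := ih hp.1 (fun h => hs (by simp [h])) rfl c rfl
      have hdc : G.Adj d c := hadj
      refine ⟨t, ht, Walk.cons hdc q, ?_, by simp [hl], ?_⟩
      · rw [Walk.cons_isPath_iff]
        refine ⟨hq, fun hd => ?_⟩
        rcases hsup _ hd with h | ⟨hz, h⟩
        · exact hTD t ht (h ▸ d.2)
        · exact hp.2 h
      · intro z hz
        rw [Walk.support_cons, List.mem_cons] at hz
        rcases hz with rfl | hz
        · exact Or.inr ⟨d.2, by simp⟩
        · rcases hsup z hz with h | ⟨h1, h2⟩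
          · exact Or.inl h
          · exact Or.inr ⟨h1, by simp [h2]⟩
    · exact absurd (by simp) hs
    · obtain ⟨t, ht, hdt⟩ : ∃ s ∈ T, G.Adj d s := hadj
      have hp0 : p = Walk.nil := by
        cases p with
        | nil => rfl
        | cons h p' =>
          have := hp.1
          rw [Walk.cons_isPath_iff] at this
          exact absurd p'.end_mem_support this.2
      subst hp0
      refine ⟨t, ht, Walk.cons hdt Walk.nil, ?_, rfl, ?_⟩
      · simp [Walk.cons_isPath_iff]
        rintro h
        exact hTD t ht (h ▸ d.2)
      · intro z hz
        simp only [Walk.support_cons, Walk.support_nil, List.mem_cons, List.not_mem_nil,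
          or_false] at hz
        rcases hz with rfl | rfl
        · exact Or.inr ⟨d.2, by simp⟩
        · exact Or.inl rfl

theorem red_lift' {V : Type uu} {G : SimpleGraph V} {D S T : Set V} (hTD : ∀ t ∈ T, t ∉ D)
    (hSD : ∀ t ∈ S, t ∉ D) (hST : ∀ s ∈ S, s ∉ T)
    (p : (redGraph G D S T).Walk (Sum.inr false) (Sum.inr true)) (hp : p.IsPath) :
    ∃ s ∈ S, ∃ t ∈ T, ∃ q : G.Walk s t, q.IsPath ∧ q.length = p.length ∧
      ∀ z ∈ q.support, z = s ∨ z = t ∨ z ∈ D := by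
  cases p with
  | @cons _ c _ hadj p =>
    rw [Walk.cons_isPath_iff] at hp
    rcases c with c | (_ | _)
    · obtain ⟨s, hs, hcs⟩ : ∃ s ∈ S, G.Adj c s := hadj
      obtain ⟨t, ht, q, hq, hl, hsup⟩ := red_lift hTD p hp.1 hp.2 rfl c rfl
      refine ⟨s, hs, t, ht, Walk.cons hcs.symm q, ?_, congrArg (· + 1) hl, ?_⟩
      · rw [Walk.cons_isPath_iff]
        refine ⟨hq, fun h => ?_⟩
        rcases hsup _ h with h | ⟨h, -⟩
        · exact hST s hs (h ▸ ht)
        · exact hSD s hs h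
      · intro z hz
        rw [Walk.support_cons, List.mem_cons] at hz
        rcases hz with rfl | hz
        · exact Or.inl rfl
        · rcases hsup z hz with h | ⟨h1, h2⟩
          · exact Or.inr (Or.inl h)
          · exact Or.inr (Or.inr h1)
    · exact absurd hadj (by simp [redGraph])
    · exact absurd hadj (by simp [redGraph])

/-- Induction hypothesis. -/
def IndHyp (N : ℕ) : Prop :=
  ∀ (W : Type uu) [Fintype W] (H : SimpleGraph W) (x y : W), Fintype.card W < N →
    GoodTriple H x y → TwoPaths H x y

theorem red_deg {V : Type uu} [Fintype V] {G : SimpleGraph V} {D S T : Set V}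
    (hnb : ∀ u ∈ D, ∀ w, G.Adj u w → w ∈ D ∨ w ∈ S ∨ w ∈ T)
    (hS1 : ∀ v ∈ D, ∀ a ∈ S, ∀ b ∈ S, G.Adj v a → G.Adj v b → a = b)
    (hT1 : ∀ v ∈ D, ∀ a ∈ T, ∀ b ∈ T, G.Adj v a → G.Adj v b → a = b) (v : D) :
    {w : V | G.Adj v w}.ncard ≤ {w | (redGraph G D S T).Adj (Sum.inl v) w}.ncard := by
  classical
  let f : V → D ⊕ Bool := fun w =>
    if h : w ∈ D then Sum.inl ⟨w, h⟩ else if w ∈ S then Sum.inr false else Sum.inr true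
  apply Set.ncard_le_ncard_of_injOn f
  · intro w hw
    have hw : G.Adj v w := hw
    simp only [f, Set.mem_setOf_eq]
    split_ifs with h1 h2
    · exact hw
    · exact ⟨w, h2, hw⟩
    · refine ⟨w, ?_, hw⟩
      rcases hnb v v.2 w hw with h | h | h
      · exact absurd h h1
      · exact absurd h h2
      · exact h
  · intro a ha b hb hab
    have ha : G.Adj v a := ha
    have hb : G.Adj v b := hb
    have h1 := hnb v v.2 a ha
    have h2 := hnb v v.2 b hb
    have h3 := hS1 v v.2 a
    have h4 := hT1 v v.2 a
    simp only [f] at hab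
    split_ifs at hab with g1 g2 g3 g4 g5 g6 g7
    all_goals first
      | (cases hab; done)
      | (cases hab; rfl)
      | exact hS1 v v.2 a (by assumption) b (by assumption) ha hb
      | exact hT1 v v.2 a (by tauto) b (by tauto) ha hb

theorem red_main {V : Type uu} [Fintype V] {G : SimpleGraph V} {x y : V}
    (hG : GoodTriple G x y) (ih : IndHyp.{uu} (Fintype.card V)) {D S T : Set V}
    (hxD : x ∉ D) (hyD : y ∉ D) {e : V} (heD : e ∉ D) (hex : e ≠ x) (hey : e ≠ y)
    (hne : D.Nonempty)
    (hconn : ∀ U ⊆ D, U.Nonempty → U ≠ D → ∃ u ∈ U, ∃ w ∈ D, w ∉ U ∧ G.Adj u w)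
    (hTD : ∀ t ∈ T, t ∉ D) (hSD : ∀ t ∈ S, t ∉ D) (hST : ∀ s ∈ S, s ∉ T)
    (hnb : ∀ u ∈ D, ∀ w, G.Adj u w → w ∈ D ∨ w ∈ S ∨ w ∈ T)
    (hS : ∃ u ∈ D, ∃ s ∈ S, G.Adj u s) (hT : ∃ u ∈ D, ∃ s ∈ T, G.Adj u s)
    (hS1 : ∀ v ∈ D, ∀ a ∈ S, ∀ b ∈ S, G.Adj v a → G.Adj v b → a = b)
    (hT1 : ∀ v ∈ D, ∀ a ∈ T, ∀ b ∈ T, G.Adj v a → G.Adj v b → a = b) :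
    ∃ s ∈ S, ∃ t ∈ T, ∃ s' ∈ S, ∃ t' ∈ T, ∃ (p : G.Walk s t) (q : G.Walk s' t'),
      p.IsPath ∧ q.IsPath ∧ q.length = p.length + 2 ∧
      (∀ z ∈ p.support, z = s ∨ z = t ∨ z ∈ D) ∧ (∀ z ∈ q.support, z = s' ∨ z = t' ∨ z ∈ D) := by
  classical
  have hcard : Fintype.card (D ⊕ Bool) < Fintype.card V := by
    have h1 : Disjoint D.toFinset {x, y, e} := by
      rw [Finset.disjoint_left]
      intro z hz hz'
      simp only [Set.mem_toFinset, Finset.mem_insert, Finset.mem_singleton] at hz hz'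
      rcases hz' with rfl | rfl | rfl <;> contradiction
    have h2 : ({x, y, e} : Finset V).card = 3 :=
      Finset.card_eq_three.2 ⟨x, y, e, hG.ne, hex.symm, hey.symm, rfl⟩
    have h3 := Finset.card_le_univ (D.toFinset ∪ {x, y, e})
    rw [Finset.card_union_of_disjoint h1, h2, Set.toFinset_card] at h3
    rw [Fintype.card_sum, Fintype.card_bool]
    omega
  have hgood : GoodTriple (redGraph G D S T) (Sum.inr false) (Sum.inr true) := by
    refine ⟨by simp, by simp [redGraph], ?_, ?_, ?_, ?_⟩
    · obtain ⟨d, hd⟩ := hne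
      exact ⟨Sum.inl ⟨d, hd⟩, by simp, by simp⟩
    · intro U hU hsU htU v hv
      let U' : Set V := {z | ∃ h : z ∈ D, Sum.inl ⟨z, h⟩ ∈ U}
      have hU'D : U' ⊆ D := fun z hz => hz.1
      have hU' : U'.Nonempty := by
        obtain ⟨(d | (_ | _)), hd⟩ := hU
        · exact ⟨d, d.2, hd⟩
        · exact absurd hd hsU
        · exact absurd hd htU
      by_cases hUD : U' = D
      · have hall : ∀ d : D, Sum.inl d ∈ U := by
          intro d
          have : (d : V) ∈ U' := by rw [hUD]; exact d.2
          exact this.2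
        rcases v with v | (_ | _)
        · exact absurd (hall v) hv
        · obtain ⟨u, hu, s, hs, hadj⟩ := hT
          exact ⟨Sum.inl ⟨u, hu⟩, hall _, Sum.inr true, htU, by simp, ⟨s, hs, hadj⟩⟩
        · obtain ⟨u, hu, s, hs, hadj⟩ := hS
          exact ⟨Sum.inl ⟨u, hu⟩, hall _, Sum.inr false, hsU, by simp, ⟨s, hs, hadj⟩⟩
      · rcases v with v | b
        · obtain ⟨u, hu, w, hw, hwv, hadj⟩ := hG.conn U' hU' (fun h => hxD h.1)
            (fun h => hyD h.1) v (fun h => hv h.2)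
          rcases hnb u hu.1 w hadj with h | h | h
          · refine ⟨Sum.inl ⟨u, hu.1⟩, hu.2, Sum.inl ⟨w, h⟩, fun h' => hw ⟨h, h'⟩, ?_, hadj⟩
            intro h'
            exact hwv (by simpa using congrArg (Sum.elim (fun d : D => (d : V)) (fun _ => v)) h')
          · exact ⟨Sum.inl ⟨u, hu.1⟩, hu.2, Sum.inr false, hsU, by simp, ⟨w, h, hadj⟩⟩
          · exact ⟨Sum.inl ⟨u, hu.1⟩, hu.2, Sum.inr true, htU, by simp, ⟨w, h, hadj⟩⟩
        · obtain ⟨u, hu, w, hwD, hw, hadj⟩ := hconn U' hU'D hU' hUD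
          exact ⟨Sum.inl ⟨u, hu.1⟩, hu.2, Sum.inl ⟨w, hwD⟩, fun h' => hw ⟨hwD, h'⟩, by simp, hadj⟩
    · rintro (v | (_ | _)) h1 h2
      · exact (hG.deg v (fun h => hxD (h ▸ v.2)) (fun h => hyD (h ▸ v.2))).trans
          (red_deg hnb hS1 hT1 v)
      · exact absurd rfl h1
      · exact absurd rfl h2
    · rintro (u | (_ | _)) (v | (_ | _)) hadj h1 h2 h3 h4 <;> try contradiction
      exact (hG.sum u v hadj (fun h => hxD (h ▸ u.2)) (fun h => hyD (h ▸ u.2))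
        (fun h => hxD (h ▸ v.2)) (fun h => hyD (h ▸ v.2))).trans
          (add_le_add (red_deg hnb hS1 hT1 u) (red_deg hnb hS1 hT1 v))
  obtain ⟨p, q, hp, hq, hl⟩ := ih _ _ _ _ hcard hgood
  obtain ⟨s, hs, t, ht, p', hp', hpl, hps⟩ := red_lift' hTD hSD hST p hp
  obtain ⟨s', hs', t', ht', q', hq', hql, hqs⟩ := red_lift' hTD hSD hST q hq
  exact ⟨s, hs, t, ht, s', hs', t', ht', p', q', hp', hq', by omega, hps, hqs⟩

/-- A path from `a` to `y` avoiding `x, w, b` in presence of a 4-cycle `x a w b`. -/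
theorem c4_direct {V : Type uu} {G : SimpleGraph V} {x y a b w : V}
    (hxa : G.Adj x a) (hxb : G.Adj x b) (hwa : G.Adj w a) (hwb : G.Adj w b) (hwx : w ≠ x)
    (p : G.Walk a y) (hp : p.IsPath) (h1 : x ∉ p.support) (h2 : w ∉ p.support)
    (h3 : b ∉ p.support) : TwoPaths G x y := by
  refine ⟨Walk.cons hxa p, Walk.cons hxb (Walk.cons hwb.symm (Walk.cons hwa p)), ?_, ?_, by simp⟩
  · rw [Walk.cons_isPath_iff]; exact ⟨hp, h1⟩
  · simp only [Walk.cons_isPath_iff, Walk.support_cons, List.mem_cons, not_or]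
    exact ⟨⟨⟨hp, h2⟩, hwb.ne', h3⟩, hxb.ne, hwx.symm, h1⟩

theorem c4_case {V : Type uu} [Fintype V] {G : SimpleGraph V} {x y : V}
    (hG : GoodTriple G x y) (ih : IndHyp.{uu} (Fintype.card V)) {a b w : V} (hab : a ≠ b)
    (hxa : G.Adj x a) (hxb : G.Adj x b) (hwa : G.Adj w a) (hwb : G.Adj w b) (hwx : w ≠ x)
    (hwy : w ≠ y) : TwoPaths G x y := by
  classical
  have haZ : a ∉ ({x, w} : Set V) := by simp [hxa.ne', hwa.ne']
  have hyZ : y ∉ ({x, w} : Set V) := by simp [hG.ne.symm, hwy.symm]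
  by_cases hy : y ∈ compAvoid G {x, w} a
  · obtain ⟨p, hp, hpZ⟩ := hy
    have hx : x ∉ p.support := fun h => hpZ x h (by simp)
    have hw : w ∉ p.support := fun h => hpZ w h (by simp)
    by_cases hb : b ∈ p.support
    · have hsub := p.support_dropUntil_subset hb
      refine c4_direct hxb hxa hwb hwa hwx (p.dropUntil b hb) (hp.dropUntil hb)
        (fun h => hx (hsub h)) (fun h => hw (hsub h)) ?_
      intro ha
      have h1 := p.take_spec hb
      have h2 : ((p.takeUntil b hb).append (p.dropUntil b hb)).IsPath := by rw [h1]; exact hp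
      have h3 := h2.support_nodup
      rw [Walk.support_append] at h3
      have h4 := List.disjoint_of_nodup_append h3
      refine h4 (Walk.start_mem_support _) ?_
      rw [Walk.mem_support_iff] at ha
      exact ha.resolve_left hab
    · exact c4_direct hxa hxb hwa hwb hwx p hp hx hw hb
  · set D := compAvoid G {x, w} a with hD
    have haD : a ∈ D := compAvoid_self haZ
    have hxD : x ∉ D := fun h => compAvoid_notMem h (by simp)
    have hwD : w ∉ D := fun h => compAvoid_notMem h (by simp)
    have hnb : ∀ u ∈ D, ∀ z, G.Adj u z → z ∈ D ∨ z ∈ ({x} : Set V) ∨ z ∈ ({w} : Set V) := by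
      intro u hu z huz
      by_cases hz : z ∈ ({x, w} : Set V)
      · right; simpa using hz
      · left; exact compAvoid_closed hu huz hz
    obtain ⟨s, hs, t, ht, s', hs', t', ht', p, q, hp, hq, hl, hps, hqs⟩ :=
      red_main hG ih (D := D) (S := {x}) (T := {w}) hxD hy hwD hwx hwy ⟨a, haD⟩
        (compAvoid_conn haZ) (by simpa using hwD) (by simpa using hxD)
        (by simpa using hwx.symm) hnb ⟨a, haD, x, rfl, hxa.symm⟩ ⟨a, haD, w, rfl, hwa.symm⟩
        (by rintro v - _ rfl _ rfl - -; rfl) (by rintro v - _ rfl _ rfl - -; rfl)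
    obtain rfl : s = x := hs
    obtain rfl : t = w := ht
    obtain rfl : s' = s := hs'
    obtain rfl : t' = t := ht'
    set E := compAvoid G {s', t'} y with hE
    have hyE : y ∈ E := compAvoid_self hyZ
    have haE : a ∉ E := by
      rintro ⟨r, hr, hrZ⟩
      exact hy ⟨r.reverse, hr.reverse, by simpa using hrZ⟩
    have hdisj : ∀ z ∈ D, z ∉ E := by
      intro z hzD hzE
      obtain ⟨u, hu, v, hv, hvU, hadj⟩ := compAvoid_conn haZ (D ∩ E) Set.inter_subset_left
        ⟨z, hzD, hzE⟩ (fun h => haE (h.symm ▸ haD : a ∈ D ∩ E).2)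
      exact hvU ⟨hv, compAvoid_closed hu.2 hadj (compAvoid_notMem hv)⟩
    have hsE : s' ∉ E := fun h => compAvoid_notMem h (by simp)
    have htE : t' ∉ E := fun h => compAvoid_notMem h (by simp)
    obtain ⟨u, hu, e, he, hes, hue⟩ := hG.conn {z | z ∉ E ∧ z ≠ s'} ⟨t', htE, hwx⟩
      (fun h => h.2 rfl) (fun h => h.1 hyE) s' (fun h => h.2 rfl)
    have heE : e ∈ E := by
      by_contra h
      exact he ⟨h, hes⟩
    have hut : u = t' := by
      by_contra h
      exact hu.1 (compAvoid_closed heE hue.symm (by simp [h, hu.2]))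
    subst hut
    have heE' := heE
    obtain ⟨r, hr, hrZ⟩ := heE
    have hrE := walk_in_compAvoid r hyE hrZ
    let R : G.Walk u y := Walk.cons hue r.reverse
    have hR : R.IsPath := by
      rw [Walk.cons_isPath_iff]
      refine ⟨hr.reverse, fun h => htE (hrE u (by simpa using h))⟩
    have hRs : ∀ z ∈ R.support, z = u ∨ z ∈ E := by
      intro z hz
      simp only [R, Walk.support_cons, List.mem_cons, Walk.support_reverse,
        List.mem_reverse] at hz
      exact hz.imp id (hrE z)
    have key : ∀ p : G.Walk s' u, p.IsPath → (∀ z ∈ p.support, z = s' ∨ z = u ∨ z ∈ D) →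
        (p.append R).IsPath := by
      intro p hp hps
      apply isPath_append_of p R hp hR
      intro z hz hz'
      rcases hRs z hz' with h | h
      · exact h
      · rcases hps z hz with rfl | h' | h'
        · exact absurd h hsE
        · exact h'
        · exact absurd h (hdisj z h')
    exact ⟨p.append R, q.append R, key p hp hps, key q hq hqs, by
      simp only [Walk.length_append]; omega⟩

theorem contract_case {V : Type uu} [Fintype V] {G : SimpleGraph V} {x y : V}
    (hG : GoodTriple G x y) (ih : IndHyp.{uu} (Fintype.card V))
    (hno : ∀ a b w, a ≠ b → G.Adj x a → G.Adj x b → G.Adj w a → G.Adj w b → w ≠ x → w = y)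
    (d : V) (hyd : G.Adj y d) (hxd : ¬ G.Adj x d) : TwoPaths G x y := by
  have hdx : d ≠ x := by rintro rfl; exact hG.nadj hyd.symm
  set Z : Set V := {z | z = x ∨ z = y ∨ G.Adj x z} with hZ
  have hdZ : d ∉ Z := by
    rintro (h | h | h)
    · exact hdx h
    · exact hyd.ne' h
    · exact hxd h
  set D := compAvoid G Z d with hD
  have hdD : d ∈ D := compAvoid_self hdZ
  have hxD : x ∉ D := fun h => compAvoid_notMem h (Or.inl rfl)
  have hyD : y ∉ D := fun h => compAvoid_notMem h (Or.inr (Or.inl rfl))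
  have hAD : ∀ z, G.Adj x z → z ∉ D := fun z hz h => compAvoid_notMem h (Or.inr (Or.inr hz))
  have hnb : ∀ u ∈ D, ∀ z, G.Adj u z → z ∈ D ∨ z ∈ {z | G.Adj x z} ∨ z ∈ ({y} : Set V) := by
    intro u hu z huz
    by_cases hz : z ∈ Z
    · rcases hz with rfl | h | h
      · exact absurd hu (hAD u huz.symm)
      · exact Or.inr (Or.inr h)
      · exact Or.inr (Or.inl h)
    · left; exact compAvoid_closed hu huz hz
  obtain ⟨u, hu, e, he, hey, hue⟩ := hG.conn D ⟨d, hdD⟩ hxD hyD y hyD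
  have hxe : G.Adj x e := by
    rcases hnb u hu e hue with h | h | h
    · exact absurd h he
    · exact h
    · exact absurd h hey
  obtain ⟨s, hs, t, ht, s', hs', t', ht', p, q, hp, hq, hl, hps, hqs⟩ :=
      red_main hG ih (D := D) (S := {z | G.Adj x z}) (T := {y}) hxD hyD he hxe.ne' hey ⟨d, hdD⟩
        (compAvoid_conn hdZ) (by simpa using hyD) hAD
        (by rintro s hs rfl; exact hG.nadj hs) hnb ⟨u, hu, e, hxe, hue⟩
        ⟨d, hdD, y, rfl, hyd.symm⟩
        (by
          intro v hv a ha b hb hva hvb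
          by_contra hab
          have := hno a b v hab ha hb hva hvb (fun h => hxD (h ▸ hv))
          exact hyD (this ▸ hv))
        (by rintro v - _ rfl _ rfl - -; rfl)
  obtain rfl : t = y := ht
  obtain rfl : t' = t := ht'
  have key : ∀ s (hs : G.Adj x s) (p : G.Walk s t'), p.IsPath →
      (∀ z ∈ p.support, z = s ∨ z = t' ∨ z ∈ D) → (Walk.cons hs p).IsPath := by
    intro s hs p hp hps
    rw [Walk.cons_isPath_iff]
    refine ⟨hp, fun h => ?_⟩
    rcases hps x h with h | h | h
    · exact hs.ne h
    · exact hG.ne h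
    · exact hxD h
  exact ⟨Walk.cons hs p, Walk.cons hs' q, key s hs p hp hps, key s' hs' q hq hqs, by
    simp only [Walk.length_cons]; omega⟩

theorem final_case {V : Type uu} [Fintype V] {G : SimpleGraph V} {x y : V}
    (hG : GoodTriple G x y) (ih : IndHyp.{uu} (Fintype.card V))
    (hno : ∀ a b w, a ≠ b → G.Adj x a → G.Adj x b → G.Adj w a → G.Adj w b → w ≠ x → w = y)
    (hA : ∀ z, G.Adj x z ↔ G.Adj y z) (d : V) (hdx : d ≠ x) (hdy : d ≠ y)
    (hxd : ¬ G.Adj x d) : TwoPaths G x y := by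
  set Z : Set V := {z | z = x ∨ z = y ∨ G.Adj x z} with hZ
  have hdZ : d ∉ Z := by
    rintro (h | h | h)
    · exact hdx h
    · exact hdy h
    · exact hxd h
  set D := compAvoid G Z d with hD
  have hdD : d ∈ D := compAvoid_self hdZ
  have hxD : x ∉ D := fun h => compAvoid_notMem h (Or.inl rfl)
  have hyD : y ∉ D := fun h => compAvoid_notMem h (Or.inr (Or.inl rfl))
  have hAD : ∀ z, G.Adj x z → z ∉ D := fun z hz h => compAvoid_notMem h (Or.inr (Or.inr hz))
  have hnb' : ∀ u ∈ D, ∀ z, G.Adj u z → z ∈ D ∨ G.Adj x z := by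
    intro u hu z huz
    by_cases hz : z ∈ Z
    · rcases hz with rfl | rfl | h
      · exact absurd hu (hAD u huz.symm)
      · exact absurd hu (hAD u ((hA u).2 huz.symm))
      · exact Or.inr h
    · left; exact compAvoid_closed hu huz hz
  obtain ⟨u, hu, e, he, hey, hue⟩ := hG.conn D ⟨d, hdD⟩ hxD hyD y hyD
  have hxe : G.Adj x e := (hnb' u hu e hue).resolve_left he
  obtain ⟨u', hu', e', he', hee', hue'⟩ := hG.conn D ⟨d, hdD⟩ hxD hyD e he
  have hxe' : G.Adj x e' := (hnb' u' hu' e' hue').resolve_left he'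
  obtain ⟨s, hs, t, ht, s', hs', t', ht', p, q, hp, hq, hl, hps, hqs⟩ :=
      red_main hG ih (D := D) (S := {e}) (T := {z | G.Adj x z ∧ z ≠ e}) hxD hyD he hxe.ne' hey
        ⟨d, hdD⟩
        (compAvoid_conn hdZ) (fun t ht => hAD t ht.1) (by simpa using he)
        (by rintro s hs h; exact h.2 hs)
        (by
          intro u hu z hz
          rcases hnb' u hu z hz with h | h
          · exact Or.inl h
          · by_cases hze : z = e
            · exact Or.inr (Or.inl hze)
            · exact Or.inr (Or.inr ⟨h, hze⟩))
        ⟨u, hu, e, rfl, hue⟩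
        ⟨u', hu', e', ⟨hxe', hee'⟩, hue'⟩
        (by rintro v - _ rfl _ rfl - -; rfl)
        (by
          intro v hv a ha b hb hva hvb
          by_contra hab
          have := hno a b v hab ha.1 hb.1 hva hvb (fun h => hxD (h ▸ hv))
          exact hyD (this ▸ hv))
  have key : ∀ s t (hs : G.Adj x s) (ht : G.Adj t y) (p : G.Walk s t), p.IsPath →
      (∀ z ∈ p.support, z = s ∨ z = t ∨ z ∈ D) →
      ((Walk.cons hs p).append (Walk.cons ht Walk.nil)).IsPath := by
    intro s t hs ht p hp hps
    have hyp : y ∉ p.support := by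
      intro h
      rcases hps y h with h | h | h
      · exact hG.nadj (h ▸ hs)
      · exact ht.ne' h
      · exact hyD h
    apply isPath_append_of
    · rw [Walk.cons_isPath_iff]
      refine ⟨hp, fun h => ?_⟩
      rcases hps x h with h | h | h
      · exact hs.ne h
      · exact hG.nadj (h ▸ ht)
      · exact hxD h
    · simp [Walk.cons_isPath_iff, ht.ne]
    · intro z hz hz'
      simp only [Walk.support_cons, Walk.support_nil, List.mem_cons, List.not_mem_nil,
          or_false] at hz hz'
      rcases hz' with h | rfl
      · exact h
      · rcases hz with h | h
        · exact absurd h hG.ne.symm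
        · exact absurd h hyp
  have h1 : G.Adj x s := by rw [Set.mem_singleton_iff.1 hs]; exact hxe
  have h2 : G.Adj x s' := by rw [Set.mem_singleton_iff.1 hs']; exact hxe
  exact ⟨_, _, key s t h1 ((hA t).1 ht.1).symm p hp hps,
    key s' t' h2 ((hA t').1 ht'.1).symm q hq hqs, by
    simp only [Walk.length_cons, Walk.length_append, Walk.length_nil]; omega⟩

theorem base_case {V : Type uu} [Fintype V] {G : SimpleGraph V} {x y : V}
    (hG : GoodTriple G x y) 
    (hno : ∀ a b w, a ≠ b → G.Adj x a → G.Adj x b → G.Adj w a → G.Adj w b → w ≠ x → w = y)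
    (hall : ∀ d, d ≠ x → d ≠ y → G.Adj x d) : False := by
  classical
  have hbig : ∀ v, v ≠ x → v ≠ y → {w : V | G.Adj v w}.ncard ≤ 3 := by
    intro v hvx hvy
    have hsub : {w : V | G.Adj v w} ⊆ {x, y} ∪ {w | G.Adj v w ∧ G.Adj x w} := by
      intro w hw
      by_cases h1 : w = x
      · simp [h1]
      by_cases h2 : w = y
      · simp [h2]
      exact Or.inr ⟨hw, hall w h1 h2⟩
    have h1 : {w | G.Adj v w ∧ G.Adj x w}.ncard ≤ 1 := by
      rw [Set.ncard_le_one (Set.toFinite _)]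
      intro a ha b hb
      by_contra hab
      exact hvy (hno a b v hab ha.2 hb.2 ha.1 hb.1 hvx)
    have h2 := Set.ncard_le_ncard hsub (Set.toFinite _)
    have h3 := Set.ncard_union_le {x, y} {w | G.Adj v w ∧ G.Adj x w}
    rw [Set.ncard_pair hG.ne] at h3
    omega
  obtain ⟨z, hzx, hzy⟩ := hG.ex
  have hz := hG.deg z hzx hzy
  obtain ⟨b, hb, hb'⟩ : ∃ b ∈ {w : V | G.Adj z w}, b ∉ ({x, y} : Set V) := by
    by_contra! hcon
    have := Set.ncard_le_ncard (show {w : V | G.Adj z w} ⊆ {x, y} from hcon) (Set.toFinite _)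
    rw [Set.ncard_pair hG.ne] at this
    omega
  simp only [Set.mem_insert_iff, Set.mem_singleton_iff, not_or] at hb'
  have h1 := hG.sum z b hb hzx hzy hb'.1 hb'.2
  have h2 := hbig z hzx hzy
  have h3 := hbig b hb'.1 hb'.2
  omega

theorem main_ind (N : ℕ) : IndHyp.{uu} N := by
  induction N with
  | zero => intro W _ H x y h; omega
  | succ N IH =>
    intro W _ H x y hcard hG
    have ih : IndHyp.{uu} (Fintype.card W) := by
      intro W' _ H' x' y' h' hG'
      exact IH W' H' x' y' (by omega) hG'
    by_cases hno : ∀ a b w, a ≠ b → H.Adj x a → H.Adj x b → H.Adj w a → H.Adj w b → w ≠ x → w = y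
    swap
    · push Not at hno
      obtain ⟨a, b, w, hab, hxa, hxb, hwa, hwb, hwx, hwy⟩ := hno
      exact c4_case hG ih hab hxa hxb hwa hwb hwx hwy
    by_cases h1 : ∀ d, H.Adj y d → H.Adj x d
    swap
    · push Not at h1
      obtain ⟨d, hyd, hxd⟩ := h1
      exact contract_case hG ih hno d hyd hxd
    by_cases h2 : ∀ d, H.Adj x d → H.Adj y d
    swap
    · push Not at h2
      obtain ⟨d, hxd, hyd⟩ := h2
      refine (contract_case hG.symm ih ?_ d hxd hyd).symm
      intro a b w hab hya hyb hwa hwb hwy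
      by_contra hwx
      exact hwy (hno a b w hab (h1 a hya) (h1 b hyb) hwa hwb hwx)
    by_cases h3 : ∀ d, d ≠ x → d ≠ y → H.Adj x d
    · exact (base_case hG hno h3).elim
    · push Not at h3
      obtain ⟨d, hdx, hdy, hd⟩ := h3
      exact final_case hG ih hno (fun z => ⟨h2 z, h1 z⟩) d hdx hdy hd

/-- If `G + xy` is 2-connected, every vertex other than `x, y` has degree at least 3,
and every edge `uv` with `{u,v} ∩ {x,y} = ∅` has `deg u + deg v ≥ 7`, then `G - xy`
contains two paths from `x` to `y` whose lengths differ by exactly two. -/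
theorem stmt_2 {V : Type*} [Fintype V] (G : SimpleGraph V) (x y : V) (hxy : x ≠ y)
    (h2 : KConnected 2 (G ⊔ fromEdgeSet {s(x, y)}))
    (hdeg : ∀ v : V, v ≠ x → v ≠ y → 3 ≤ {w : V | G.Adj v w}.ncard)
    (hsum : ∀ u v : V, G.Adj u v → u ≠ x → u ≠ y → v ≠ x → v ≠ y →
      7 ≤ {w : V | G.Adj u w}.ncard + {w : V | G.Adj v w}.ncard) :
    ∃ p q : (G.deleteEdges {s(x, y)}).Walk x y,
      p.IsPath ∧ q.IsPath ∧ q.length = p.length + 2 := by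
  classical
  have hadj : ∀ v, v ≠ x → v ≠ y → ∀ w, (G.deleteEdges {s(x, y)}).Adj v w ↔ G.Adj v w := by
    intro v hvx hvy w
    simp [deleteEdges_adj, hvx, hvy]
  refine main_ind _ V (G.deleteEdges {s(x, y)}) x y (Nat.lt_succ_self _) ⟨hxy, ?_, ?_, ?_, ?_, ?_⟩
  · simp
  · by_contra! hcon
    have h1 := h2.1
    have h3 : (Set.univ : Set V) ⊆ {x, y} := by
      intro z _
      by_cases hz : z = x
      · simp [hz]
      · simp [hcon z hz]
    have h4 := Set.ncard_le_ncard h3 (Set.toFinite _)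
    rw [Set.ncard_univ, Set.ncard_pair hxy] at h4
    omega
  · intro U hU hxU hyU v hv
    obtain ⟨u, hu⟩ := hU
    obtain ⟨t, htU, htv⟩ : ∃ t, t ∉ U ∧ t ≠ v := by
      by_cases h : x = v
      · exact ⟨y, hyU, h ▸ hxy.symm⟩
      · exact ⟨x, hxU, h⟩
    have hc := h2.2 {v} (by simp)
    have huv : u ≠ v := fun h => hv (h ▸ hu)
    obtain ⟨p⟩ := hc.preconnected ⟨u, by simpa using huv⟩ ⟨t, by simpa using htv⟩
    obtain ⟨a, -, b, -, haU, hbU, hab⟩ := walk_crosses p {z | (z : V) ∈ U} hu htU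
    refine ⟨a, haU, b, hbU, fun h => b.2 h, ?_⟩
    have hax : (a : V) ≠ x := fun h => hxU (h ▸ haU)
    have hay : (a : V) ≠ y := fun h => hyU (h ▸ haU)
    rw [hadj a hax hay]
    simpa [hax, hay] using hab
  · intro v hvx hvy
    simp only [hadj v hvx hvy]
    exact hdeg v hvx hvy
  · intro u v huv h1 h2 h3 h4
    simp only [hadj v h3 h4, hadj u h1 h2]
    exact hsum u v ((hadj u h1 h2 v).1 huv) h1 h2 h3 h4
end
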